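/- For every m ∈ [1/2, 3/5): any two periodic orbits of Bacciotti's system X_m have the same image (so X_m has at most one limit cycle); a periodic orbit and a heteroclinic connection of X_m cannot coexist; and every periodic orbit γ of X_m with minimal period T satisfies ∫₀ᵀ div X_m(γ(t)) dt > 0, i.e. the limit cycle, when it exists, is hyperbolic and repelling. -/

import Mathlib

open Real Filter Set

noncomputable section

/-- Bacciotti's system `X_m(x,y) = (y³ − x³, −x + m·y⁵)`. -/
def bacciotti (m : ℝ) (p : ℝ × ℝ) : ℝ × ℝ :=
  (p.2 ^ 3 - p.1 ^ 3, -p.1 + m * p.2 ^ 5)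

/-- A (global) solution of Bacciotti's system. -/
def IsSolution (m : ℝ) (γ : ℝ → ℝ × ℝ) : Prop :=
  ∀ t : ℝ, HasDerivAt γ (bacciotti m (γ t)) t

/-- A periodic orbit: a nonconstant `T`-periodic solution with `T > 0`. -/
def IsPeriodicOrbit (m : ℝ) (γ : ℝ → ℝ × ℝ) (T : ℝ) : Prop :=
  IsSolution m γ ∧ (¬ ∃ c : ℝ × ℝ, ∀ t, γ t = c) ∧ 0 < T ∧ Function.Periodic γ T

/-- The saddle point `p_m^+ = (m^{−1/4}, m^{−1/4})`. -/
def pPlus (m : ℝ) : ℝ × ℝ := (m ^ (-(1 : ℝ) / 4), m ^ (-(1 : ℝ) / 4))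

/-- The saddle point `p_m^− = (−m^{−1/4}, −m^{−1/4})`. -/
def pMinus (m : ℝ) : ℝ × ℝ := (-(m ^ (-(1 : ℝ) / 4)), -(m ^ (-(1 : ℝ) / 4)))

/-- A heteroclinic connection from `p_m^−` to `p_m^+`. -/
def IsHeteroclinic (m : ℝ) (γ : ℝ → ℝ × ℝ) : Prop :=
  IsSolution m γ ∧ Tendsto γ atBot (nhds (pMinus m)) ∧ Tendsto γ atTop (nhds (pPlus m))

/-- The divergence of Bacciotti's system: `div X_m(x,y) = −3x² + 5m·y⁴`. -/
def divBacciotti (m : ℝ) (p : ℝ × ℝ) : ℝ :=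
  -3 * p.1 ^ 2 + 5 * m * p.2 ^ 4

/-- `T` is the minimal period of `γ`. -/
def IsMinimalPeriod (γ : ℝ → ℝ × ℝ) (T : ℝ) : Prop :=
  0 < T ∧ Function.Periodic γ T ∧ ∀ T' : ℝ, 0 < T' → Function.Periodic γ T' → T ≤ T'

/-- The coefficient of `x ^ 2 * y ^ 6` in the Dulac function. -/
def coefA (m : ℝ) : ℝ := (10 * m - 3) / 90

/-- The coefficient of `v * x ^ 2 * y ^ 8` in the Dulac function. -/
def coefB (m : ℝ) : ℝ := -(13 * m - 3) / 252

/-- The coefficient of `x ^ 2 * y ^ 12` in the Dulac function. -/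
def coefC (m : ℝ) : ℝ := coefA m * (3 + 35 * m) / 990

/-- The coefficient of `x ^ 2` in the Dulac function. -/
def dulacTwo (m v y : ℝ) : ℝ := -1 + v * y ^ 2 + coefA m * y ^ 6 + v * coefB m * y ^ 8 + coefC m * y ^ 12

/-- The coefficient of `x` in the Dulac function. -/
def dulacOne (m v y : ℝ) : ℝ := 2 * v * y + 6 * coefA m * y ^ 5 + 8 * v * coefB m * y ^ 7 + 12 * coefC m * y ^ 11

/-- The part of the Dulac function that does not involve `x`. -/
def dulacZero (m v y : ℝ) : ℝ := v - y ^ 4 / 2 + v * (3 - 7 * m) / 9 * y ^ 6 + coefA m * (1 + 5 * m) / 5 * y ^ 10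

/-- A Dulac function for Bacciotti's system, with a free parameter `v`. -/
def dulac (m v x y : ℝ) : ℝ := dulacTwo m v y * x ^ 2 + dulacOne m v y * x + dulacZero m v y

/-- The derivative of `dulac m v` in `x`. -/
def dulacX (m v x y : ℝ) : ℝ := 2 * dulacTwo m v y * x + dulacOne m v y

/-- The derivative of `dulac m v` in `y`. -/
def dulacY (m v x y : ℝ) : ℝ :=
  (2 * v * y + 6 * coefA m * y ^ 5 + 8 * v * coefB m * y ^ 7 + 12 * coefC m * y ^ 11) * x ^ 2
  + (2 * v + 30 * coefA m * y ^ 4 + 56 * v * coefB m * y ^ 6 + 132 * coefC m * y ^ 10) * x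
  + (- 2 * y ^ 3 + 6 * (v * (3 - 7 * m) / 9) * y ^ 5 + 10 * (coefA m * (1 + 5 * m) / 5) * y ^ 9)

/-- The derivative of `dulac m v` along the field minus `2 / 3` of its product with the divergence. -/
def dulacM (m v x y : ℝ) : ℝ :=
  dulacX m v x y * (y ^ 3 - x ^ 3) + dulacY m v x y * (-x + m * y ^ 5)
    - 2 / 3 * dulac m v x y * (-3 * x ^ 2 + 5 * m * y ^ 4)

lemma dulacM_eq (m v x y : ℝ) : dulacM m v x y = y ^ 4 * (10 / 3 * (3 / 5 - m) * v - (3 / 5 - m) / 3 * (y ^ 2) ^ 2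
   + (12 * coefC m + 4 / 3 * m * coefA m * (1 + 5 * m)) * (y ^ 2) ^ 5
   - v * (2 * (13 * m - 3) / 63 - 8 * m / 27 * (3 - 7 * m)) * (y ^ 2) ^ 3
   + x * y * (y ^ 2) ^ 3 * (coefC m * (2 + 92 * m) * (y ^ 2) ^ 2 - v * (-coefB m * (2 + 88 * m / 3)))
   + x ^ 2 * (y ^ 2) ^ 4 * (26 / 3 * m * coefC m * (y ^ 2) ^ 2 - v * (-(14 / 3) * m * coefB m))) := by
  simp only [dulacM, dulacX, dulacY, dulac, dulacTwo, dulacOne, dulacZero, coefA, coefB, coefC]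
  ring

lemma dulac_coef_bounds {m : ℝ} (h1 : 1 / 2 ≤ m) (h2 : m < 3 / 5) :
    2 * (13 * m - 3) / 63 - 8 * m / 27 * (3 - 7 * m) ≤ 3658 / 10000 - 9 / 5 * (3 / 5 - m) ∧
    113 / 1000 - 59 / 100 * (3 / 5 - m) ≤ 12 * coefC m + 4 / 3 * m * coefA m * (1 + 5 * m) ∧
    -coefB m * (2 + 88 * m / 3) ≤ 3734 / 10000 - 141 / 100 * (3 / 5 - m) ∧
    coefC m * (2 + 92 * m) ≤ 463 / 10000 - 24 / 100 * (3 / 5 - m) ∧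
    -(14 / 3) * m * coefB m ≤ 534 / 10000 - 1 / 5 * (3 / 5 - m) := by
  simp only [coefA, coefB, coefC]
  refine ⟨?_, ?_, ?_, ?_, ?_⟩ <;>
  nlinarith [mul_nonneg (sub_nonneg.2 h1) (sub_nonneg.2 h2.le), mul_nonneg (mul_nonneg (sub_nonneg.2 h1) (sub_nonneg.2 h2.le)) (sub_nonneg.2 h1),
    mul_nonneg (sub_nonneg.2 h1) (sq_nonneg (m - 11 / 20)), sq_nonneg (m - 11 / 20)]

lemma coef_signs {m : ℝ} (h1 : 1 / 2 ≤ m) (h2 : m < 3 / 5) : 0 ≤ coefA m ∧ coefB m ≤ 0 ∧ 0 ≤ coefC m := by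
  have hA : 0 ≤ coefA m := by unfold coefA; linarith
  refine ⟨hA, by unfold coefB; linarith, ?_⟩
  unfold coefC
  have : 0 ≤ 3 + 35 * m := by linarith
  positivity

lemma sq_le_of_mul_pow_four_le_one {m y : ℝ} (h1 : 1 / 2 ≤ m) (hy : m * y ^ 4 ≤ 1) : y ^ 2 ≤ 14143 / 10000 := by
  by_contra! h
  nlinarith [mul_self_nonneg (y ^ 2)]

lemma dulac_bracket_pos {m δ z w X : ℝ} (h1 : 1 / 2 ≤ m) (hδ : 0 < δ) (hm : m = 3 / 5 - δ ^ 3)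
    (hz : 0 ≤ z) (hX : 0 ≤ X) (hX' : X ≤ 14143 / 10000)
    (hw : w ^ 2 = X * z)
    (pos : 0 < 10 / 3 * δ ^ 3 * (7 / 20 * δ ^ 2) - δ ^ 3 / 3 * z ^ 2 + (113 / 1000 - 59 / 100 * δ ^ 3) * z ^ 5
      - 7 / 20 * δ ^ 2 * z ^ 3 * (3658 / 10000 - 9 / 5 * δ ^ 3)
      - 14143 / 10000 * (7 / 20 * δ ^ 2) * (534 / 10000 - 1 / 5 * δ ^ 3) * z ^ 4
      - 7 / 20 * δ ^ 2 * z ^ 3 * (3734 / 10000 - 141 / 100 * δ ^ 3) * (3 / 5 * z + 59 / 100))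
    (neg : 0 < 10 / 3 * δ ^ 3 * (7 / 20 * δ ^ 2) - δ ^ 3 / 3 * z ^ 2 + (113 / 1000 - 59 / 100 * δ ^ 3) * z ^ 5
      - 7 / 20 * δ ^ 2 * z ^ 3 * (3658 / 10000 - 9 / 5 * δ ^ 3)
      - 14143 / 10000 * (7 / 20 * δ ^ 2) * (534 / 10000 - 1 / 5 * δ ^ 3) * z ^ 4
      - (463 / 10000 - 24 / 100 * δ ^ 3) * z ^ 5 * (3 / 5 * z + 59 / 100)) :
    0 < 10 / 3 * (3 / 5 - m) * (7 / 20 * δ ^ 2) - (3 / 5 - m) / 3 * z ^ 2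
   + (12 * coefC m + 4 / 3 * m * coefA m * (1 + 5 * m)) * z ^ 5
   - (7 / 20 * δ ^ 2) * (2 * (13 * m - 3) / 63 - 8 * m / 27 * (3 - 7 * m)) * z ^ 3
   + w * z ^ 3 * (coefC m * (2 + 92 * m) * z ^ 2 - (7 / 20 * δ ^ 2) * (-coefB m * (2 + 88 * m / 3)))
   + X * z ^ 4 * (26 / 3 * m * coefC m * z ^ 2 - (7 / 20 * δ ^ 2) * (-(14 / 3) * m * coefB m)) := by
  have h2 : m < 3 / 5 := by have := pow_pos hδ 3; linarith
  have hε : 3 / 5 - m = δ ^ 3 := by linarith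
  obtain ⟨b3, b5, b11, b15, b12⟩ := dulac_coef_bounds h1 h2
  obtain ⟨hA, hB, hC⟩ := coef_signs h1 h2
  rw [hε] at *
  have p11 : 0 ≤ -coefB m * (2 + 88 * m / 3) := mul_nonneg (by linarith) (by linarith)
  have p15 : 0 ≤ coefC m * (2 + 92 * m) := mul_nonneg (by linarith) (by linarith)
  have p12 : 0 ≤ -(14 / 3) * m * coefB m := by nlinarith
  have p16 : 0 ≤ 26 / 3 * m * coefC m := by positivity
  generalize 2 * (13 * m - 3) / 63 - 8 * m / 27 * (3 - 7 * m) = K3 at *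
  generalize 12 * coefC m + 4 / 3 * m * coefA m * (1 + 5 * m) = K5 at *
  generalize -coefB m * (2 + 88 * m / 3) = r11 at *
  generalize coefC m * (2 + 92 * m) = r15 at *
  generalize -(14 / 3) * m * coefB m = r12 at *
  generalize 26 / 3 * m * coefC m = r16 at *
  have hwb : |w| ≤ 3 / 5 * z + 59 / 100 := by
    apply abs_le_of_sq_le_sq _ (by positivity)
    rw [hw]
    nlinarith [mul_le_mul_of_nonneg_right hX' hz, sq_nonneg (z - 7063 / 7200)]
  have v0 : 0 ≤ 7 / 20 * δ ^ 2 := by positivity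
  generalize 7 / 20 * δ ^ 2 = v at *
  have e5 := mul_le_mul_of_nonneg_right b5 (pow_nonneg hz 5)
  have e3 := mul_le_mul_of_nonneg_left b3 (mul_nonneg v0 (pow_nonneg hz 3))
  have e16 : 0 ≤ X * z ^ 4 * (r16 * z ^ 2) := by positivity
  have e12 : X * z ^ 4 * (v * r12) ≤ 14143 / 10000 * z ^ 4 * (v * (534 / 10000 - 1 / 5 * δ ^ 3)) := by
    gcongr
  rcases le_total 0 w with h0 | h0
  · have e15 : 0 ≤ w * z ^ 3 * (r15 * z ^ 2) := by positivity
    have e11 : w * z ^ 3 * (v * r11) ≤ (3 / 5 * z + 59 / 100) * z ^ 3 * (v * (3734 / 10000 - 141 / 100 * δ ^ 3)) := by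
      have := (le_abs_self w).trans hwb
      gcongr
    linarith
  · have h0' : 0 ≤ -w := by linarith
    have e11 : 0 ≤ -w * z ^ 3 * (v * r11) := by positivity
    have e15 : -w * z ^ 3 * (r15 * z ^ 2) ≤ (3 / 5 * z + 59 / 100) * z ^ 3 * ((463 / 10000 - 24 / 100 * δ ^ 3) * z ^ 2) := by
      have := (neg_le_abs w).trans hwb
      gcongr
    linarith

/-- The radial derivative of `dulac m v`. -/
def dulacEuler (m v x y : ℝ) : ℝ := x * dulacX m v x y + y * dulacY m v x y

lemma dulacEuler_eq (m v x y : ℝ) : dulacEuler m v x y =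
    -(2 * x ^ 2 + 2 * (y ^ 2) ^ 2 - 4 * v * (x * y) - 4 * v * x ^ 2 * y ^ 2 - 8 * coefA m * x ^ 2 * (y ^ 2) ^ 3
      - 36 * coefA m * (x * y) * (y ^ 2) ^ 2 - 10 * (coefA m * (1 + 5 * m) / 5) * (y ^ 2) ^ 5
      - 14 * coefC m * x ^ 2 * (y ^ 2) ^ 6 - 144 * coefC m * (x * y) * (y ^ 2) ^ 5
      + 10 * -coefB m * v * x ^ 2 * (y ^ 2) ^ 4 + 64 * -coefB m * v * (x * y) * (y ^ 2) ^ 3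
      + 6 * v * ((7 * m - 3) / 9) * (y ^ 2) ^ 3) := by
  simp only [dulacEuler, dulacX, dulacY, dulacTwo, dulacOne]
  ring

lemma dulac_eq (m v x y : ℝ) : dulac m v x y =
    v * (1 + x ^ 2 * y ^ 2 * (1 - -coefB m * (y ^ 2) ^ 3) + 2 * (x * y) * (1 - 4 * -coefB m * (y ^ 2) ^ 3)
      - (7 * m - 3) / 9 * (y ^ 2) ^ 3) - (x ^ 2 + (y ^ 2) ^ 2 / 2) + coefA m * x ^ 2 * (y ^ 2) ^ 3
      + coefC m * x ^ 2 * (y ^ 2) ^ 6 + 6 * coefA m * (x * y) * (y ^ 2) ^ 2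
      + 12 * coefC m * (x * y) * (y ^ 2) ^ 5 + coefA m * (1 + 5 * m) / 5 * (y ^ 2) ^ 5 := by
  simp only [dulac, dulacTwo, dulacOne, dulacZero]
  ring

lemma quadratic_form_pos {a b c s t : ℝ} (ha : 0 < a) (hc : c ^ 2 < 4 * a * b) (h : s ≠ 0 ∨ t ≠ 0) :
    0 < a * s ^ 2 - c * s * t + b * t ^ 2 := by
  have : 0 < 4 * a * (a * s ^ 2 - c * s * t + b * t ^ 2) := by
    rcases eq_or_ne t 0 with ht | ht
    · have hs : s ≠ 0 := by simpa [ht] using h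
      subst ht
      have : 0 < 4 * a ^ 2 * s ^ 2 := by positivity
      linarith
    · have : 0 < (4 * a * b - c ^ 2) * t ^ 2 := mul_pos (by linarith) (by positivity)
      nlinarith [sq_nonneg (2 * a * s - c * t)]
  exact pos_of_mul_pos_right this (by positivity)

lemma dulacEuler_neg_of_xy_nonpos {m v x y : ℝ} (h1 : 1 / 2 ≤ m) (h2 : m < 3 / 5) (hv : 0 < v)
    (hv' : v ≤ 755 / 10000) (hy : y ^ 2 ≤ 14143 / 10000) (hw : x * y ≤ 0) (h0 : x ≠ 0 ∨ y ≠ 0) :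
    dulacEuler m v x y < 0 := by
  rw [dulacEuler_eq, neg_lt_zero]
  obtain ⟨hA, hB, hC⟩ := coef_signs h1 h2
  have hA' : coefA m ≤ 1 / 30 := by unfold coefA; linarith
  have hA'' : 1 / 45 ≤ coefA m := by unfold coefA; linarith
  have hC' : coefC m ≤ 82 / 100000 := by unfold coefC; unfold coefA at *; nlinarith
  have hB' : -coefB m ≤ 1 / 52 := by unfold coefB; linarith
  have hG : coefA m * (1 + 5 * m) / 5 ≤ 4 / 150 := by nlinarith
  have hG0 : 0 ≤ coefA m * (1 + 5 * m) / 5 := by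
    have : 0 ≤ 1 + 5 * m := by linarith
    positivity
  have hB0 : 0 ≤ -coefB m := by linarith
  have hH : 0 ≤ (7 * m - 3) / 9 := by linarith
  have hz : 0 ≤ y ^ 2 := by positivity
  have h0' : x ≠ 0 ∨ y ^ 2 ≠ 0 := by simpa using h0
  generalize y ^ 2 = z at *
  generalize coefA m * (1 + 5 * m) / 5 = g at *
  generalize coefA m = p at *
  generalize coefC m = r at *
  generalize -coefB m = q at *
  generalize (7 * m - 3) / 9 = h at *
  obtain ⟨w, hxy, hw'⟩ : ∃ w, x * y = -w ∧ 0 ≤ w := ⟨-(x * y), by ring, by linarith⟩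
  rw [hxy]
  have hz3 : z ^ 3 ≤ 283 / 100 := by
    calc z ^ 3 ≤ (14143 / 10000) ^ 3 := by gcongr
      _ ≤ _ := by norm_num
  have hz6 : z ^ 6 ≤ 81 / 10 := by
    calc z ^ 6 ≤ (14143 / 10000) ^ 6 := by gcongr
      _ ≤ _ := by norm_num
  have e1 : x ^ 2 * (4 * (v * z) + 8 * (p * z ^ 3) + 14 * (r * z ^ 6)) ≤ x ^ 2 * (13 / 10) := by
    gcongr
    have : v * z ≤ 755 / 10000 * (14143 / 10000) := by gcongr
    have : p * z ^ 3 ≤ 1 / 30 * (283 / 100) := by gcongr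
    have : r * z ^ 6 ≤ 82 / 100000 * (81 / 10) := by gcongr
    linarith
  have e2 : g * z ^ 3 * z ^ 2 ≤ 4 / 150 * (283 / 100) * z ^ 2 := by gcongr
  have e3 : q * v * z * (w * z ^ 2) ≤ 1 / 52 * (755 / 10000) * (14143 / 10000) * (w * z ^ 2) := by gcongr
  have e4 : 1 / 45 * (w * z ^ 2) ≤ p * (w * z ^ 2) := by gcongr
  have e5 : 0 ≤ v * w + r * w * z ^ 5 + q * v * x ^ 2 * z ^ 4 + v * h * z ^ 3 := by positivity
  have e6 : 0 < x ^ 2 + z ^ 2 := by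
    rcases h0' with h | h <;> positivity
  have : 0 ≤ v * w := by positivity
  have : 0 ≤ r * w * z ^ 5 := by positivity
  have : 0 ≤ q * v * x ^ 2 * z ^ 4 := by positivity
  have : 0 ≤ v * h * z ^ 3 := by positivity
  have : 0 ≤ w * z ^ 2 := by positivity
  nlinarith [sq_nonneg x, sq_nonneg z]

set_option maxHeartbeats 2000000 in
lemma dulacEuler_neg_of_xy_nonneg {m v x y : ℝ} (h1 : 1 / 2 ≤ m) (h2 : m < 3 / 5) (hv : 0 < v)
    (hv' : v ≤ 755 / 10000) (hv'' : 56 / 100 ≤ m → v ≤ 41 / 1000)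
    (hy : m * y ^ 4 ≤ 1) (hw : 0 ≤ x * y) (h0 : x ≠ 0 ∨ y ≠ 0) (hV : dulac m v x y ≤ 0) :
    dulacEuler m v x y < 0 := by
  rw [dulacEuler_eq, neg_lt_zero]
  rw [dulac_eq] at hV
  have hym := hy
  have hy := sq_le_of_mul_pow_four_le_one h1 hy
  obtain ⟨hA, hB, hC⟩ := coef_signs h1 h2
  have hA' : coefA m ≤ 1 / 30 := by unfold coefA; linarith
  have hAm : m ≤ 56 / 100 → coefA m ≤ 289 / 10000 := by unfold coefA; intro; linarith
  have hA3 : coefA m ^ 2 ≤ (718 / 10000) ^ 2 * m ^ 3 := by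
    unfold coefA; nlinarith [mul_nonneg (sub_nonneg.2 h1) (sub_nonneg.2 h2.le), mul_nonneg (mul_nonneg (sub_nonneg.2 h1) (sub_nonneg.2 h2.le)) (sub_nonneg.2 h1)]
  have hA3m : m ≤ 56 / 100 → coefA m ^ 2 ≤ (69 / 1000) ^ 2 * m ^ 3 := by
    intro h3
    unfold coefA; nlinarith [mul_nonneg (sub_nonneg.2 h1) (sub_nonneg.2 h3), mul_nonneg (mul_nonneg (sub_nonneg.2 h1) (sub_nonneg.2 h3)) (sub_nonneg.2 h1)]
  have hC3 : coefC m ≤ 38 / 10000 * m ^ 3 := by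
    unfold coefC coefA
    nlinarith [mul_nonneg (sub_nonneg.2 h1) (sub_nonneg.2 h2.le), mul_nonneg (mul_nonneg (sub_nonneg.2 h1) (sub_nonneg.2 h2.le)) (sub_nonneg.2 h1), mul_nonneg (sub_nonneg.2 h1) (sq_nonneg (m - 11 / 20))]
  have hC' : coefC m ≤ 82 / 100000 := by unfold coefC; unfold coefA at *; nlinarith
  have hCm : m ≤ 56 / 100 → coefC m ≤ 67 / 100000 := by intro h3; have := hAm h3; unfold coefC; unfold coefA at *; nlinarith
  have hB' : -coefB m ≤ 1 / 52 := by unfold coefB; linarith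
  have hH' : (7 * m - 3) / 9 ≤ 4 / 30 := by linarith
  have hH : 0 ≤ (7 * m - 3) / 9 := by linarith
  have hB0 : 0 ≤ -coefB m := by linarith
  have hG : coefA m * (1 + 5 * m) / 5 ≤ 4 / 5 * coefA m := by nlinarith
  have hGm : m ≤ 56 / 100 → coefA m * (1 + 5 * m) / 5 ≤ 38 / 50 * coefA m := by intro; nlinarith
  have hG0 : 0 ≤ coefA m * (1 + 5 * m) / 5 := by
    have : 0 ≤ 1 + 5 * m := by linarith
    positivity
  have hz : 0 ≤ y ^ 2 := by positivity
  have hmz : (m * (y ^ 2) ^ 2) ^ 3 ≤ 1 := by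
    apply pow_le_one₀ (by positivity)
    calc m * (y ^ 2) ^ 2 = m * y ^ 4 := by ring
      _ ≤ 1 := hym
  have hpair : (x * y) ^ 2 = x ^ 2 * y ^ 2 := by ring
  have hxy3 : ∀ k, x * y * y ^ 2 * k = y * k * x * y ^ 2 := fun k => by ring
  have h0' : x ≠ 0 ∨ y ^ 2 ≠ 0 := by simpa using h0
  have hsq : ∀ k, (y * k) ^ 2 = y ^ 2 * k ^ 2 := fun k => by ring
  generalize x * y = w at *
  generalize y ^ 2 = z at *
  generalize coefA m * (1 + 5 * m) / 5 = g at *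
  generalize coefA m = p at *
  generalize coefC m = r at *
  generalize -coefB m = q at *
  generalize (7 * m - 3) / 9 = h at *
  have hz3 : z ^ 3 ≤ 283 / 100 := by
    calc z ^ 3 ≤ (14143 / 10000) ^ 3 := by gcongr
      _ ≤ _ := by norm_num
  have hpz : p * z ^ 3 ≤ 718 / 10000 := by
    refine le_of_abs_le (abs_le_of_sq_le_sq ?_ (by norm_num))
    nlinarith [mul_le_mul_of_nonneg_right hA3 (by positivity : 0 ≤ (z ^ 3) ^ 2)]
  have hpzm : m ≤ 56 / 100 → p * z ^ 3 ≤ 69 / 1000 := by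
    intro h3
    refine le_of_abs_le (abs_le_of_sq_le_sq ?_ (by norm_num))
    nlinarith [mul_le_mul_of_nonneg_right (hA3m h3) (by positivity : 0 ≤ (z ^ 3) ^ 2)]
  have hrz : r * z ^ 6 ≤ 38 / 10000 := by
    nlinarith [mul_le_mul_of_nonneg_right hC3 (by positivity : 0 ≤ z ^ 6)]
  have d1 : 0 ≤ q * v * x ^ 2 * z ^ 4 := by positivity
  have d2 : 0 ≤ v * h * z ^ 3 := by positivity
  have d3 : 0 ≤ q * v * w * z ^ 3 := by positivity
  suffices H : 4 * v * w < x ^ 2 * (2 - 4 * (v * z) - 8 * (p * z ^ 3) - 14 * (r * z ^ 6))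
      - y * (z * (36 * p + 144 * r * z ^ 3)) * x * z + z ^ 2 * (2 - 10 * (g * z ^ 3)) by
    have := hxy3 (z * (36 * p + 144 * r * z ^ 3))
    nlinarith
  have hc : (y * (z * (36 * p + 144 * r * z ^ 3))) ^ 2 =
      1296 * p * (p * z ^ 3) + 10368 * p * (r * z ^ 6) + 20736 * r * (r * z ^ 6) * z ^ 3 := by
    rw [hsq]; ring
  generalize y * (z * (36 * p + 144 * r * z ^ 3)) = c at *
  rcases le_total z 1 with hz1 | hz1
  · have t1 : z ^ 3 ≤ 1 := pow_le_one₀ hz hz1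
    have t2 : z ^ 6 ≤ 1 := pow_le_one₀ hz hz1
    have hp1 : p * z ^ 3 ≤ 1 / 30 * 1 := by gcongr
    have hr1 : r * z ^ 6 ≤ 82 / 100000 * 1 := by gcongr
    have hv1 : v * z ≤ 755 / 10000 * 1 := by gcongr
    have hg1 : g * z ^ 3 ≤ 4 / 150 * 1 := by gcongr; linarith
    have hvle : v * (13 / 15) ≤ x ^ 2 + z ^ 2 / 2 := by
      have k1 : 0 ≤ v * (x ^ 2 * z * (1 - q * z ^ 3)) := by
        have : q * z ^ 3 ≤ 1 / 52 * 1 := by gcongr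
        have : 0 ≤ 1 - q * z ^ 3 := by linarith
        positivity
      have k2 : 0 ≤ v * (w * (1 - 4 * q * z ^ 3)) := by
        have : q * z ^ 3 ≤ 1 / 52 * 1 := by gcongr
        have : 0 ≤ 1 - 4 * q * z ^ 3 := by linarith
        positivity
      have k3 : v * (h * z ^ 3) ≤ v * (4 / 30 * 1) := by gcongr
      have k4 : 0 ≤ p * x ^ 2 * z ^ 3 := by positivity
      have k5 : 0 ≤ r * x ^ 2 * z ^ 6 := by positivity
      have k6 : 0 ≤ p * w * z ^ 2 := by positivity
      have k7 : 0 ≤ r * w * z ^ 5 := by positivity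
      have k8 : 0 ≤ g * z ^ 5 := by positivity
      linarith
    have hvw : 4 * v * w ≤ 44 / 100 * x ^ 2 + 445 / 1000 * z ^ 2 := by
      have a1 : 2 * w ≤ x ^ 2 + z := by
        refine le_of_abs_le (abs_le_of_sq_le_sq ?_ (by positivity))
        nlinarith [sq_nonneg (x ^ 2 - z)]
      have a2 : 2 * v * (2 * w) ≤ 2 * v * (x ^ 2 + z) := by gcongr
      have a3 : v * x ^ 2 ≤ 755 / 10000 * x ^ 2 := by gcongr
      have a4 : v * v ≤ 755 / 10000 * v := by gcongr
      nlinarith [sq_nonneg (3 * z - 10 * v)]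
    have hq : c ^ 2 < 4 * (979 / 1000) * (1285 / 1000) := by
      have : p * (p * z ^ 3) ≤ 1 / 30 * (1 / 30) := by gcongr; linarith
      have : p * (r * z ^ 6) ≤ 1 / 30 * (38 / 10000) := by gcongr
      have : r * (r * z ^ 6) * z ^ 3 ≤ 82 / 100000 * (38 / 10000) * 1 := by gcongr
      rw [hc]; linarith
    have := quadratic_form_pos (by norm_num) hq h0'
    have b1 : x ^ 2 * (1419 / 1000) ≤ x ^ 2 * (2 - 4 * (v * z) - 8 * (p * z ^ 3) - 14 * (r * z ^ 6)) := by
      gcongr; linarith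
    have b2 : z ^ 2 * (173 / 100) ≤ z ^ 2 * (2 - 10 * (g * z ^ 3)) := by
      gcongr; linarith
    linarith
  · have hvw : 4 * v * w ≤ 2 * v * (x ^ 2 + z ^ 2) := by
      have a1 : 2 * w ≤ x ^ 2 + z ^ 2 := by
        refine le_of_abs_le (abs_le_of_sq_le_sq ?_ (by positivity))
        nlinarith [sq_nonneg (x ^ 2 - z ^ 2), mul_nonneg (sq_nonneg x) (sub_nonneg.2 hz1), mul_nonneg (mul_nonneg (sq_nonneg x) hz) (sub_nonneg.2 hz1)]
      have a2 : 2 * v * (2 * w) ≤ 2 * v * (x ^ 2 + z ^ 2) := by gcongr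
      linarith
    obtain ⟨a, b, ha, hab, hα, hβ⟩ : ∃ a b : ℝ, 0 < a ∧ c ^ 2 < 4 * a * b ∧
        a ≤ 2 - 4 * (v * z) - 8 * (p * z ^ 3) - 14 * (r * z ^ 6) - 2 * v ∧
        b ≤ 2 - 10 * (g * z ^ 3) - 2 * v := by
      rw [hc]
      rcases le_total m (56 / 100) with h3 | h3
      · refine ⟨816 / 1000, 1324 / 1000, by norm_num, ?_, ?_, ?_⟩
        · have hp := hAm h3
          have hp3 := hpzm h3
          have hr := hCm h3
          have : p * (p * z ^ 3) ≤ 289 / 10000 * (69 / 1000) := by gcongr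
          have : p * (r * z ^ 6) ≤ 289 / 10000 * (38 / 10000) := by gcongr
          have : r * (r * z ^ 6) * z ^ 3 ≤ 67 / 100000 * (38 / 10000) * (283 / 100) := by gcongr
          linarith
        · have : v * z ≤ 755 / 10000 * (14143 / 10000) := by gcongr
          have hp3 := hpzm h3
          linarith
        · have : g * z ^ 3 ≤ 38 / 50 * p * z ^ 3 := by gcongr; exact hGm h3
          have hp3 := hpzm h3
          linarith
      · have hv3 := hv'' h3
        refine ⟨1, 13 / 10, by norm_num, ?_, ?_, ?_⟩
        · have : p * (p * z ^ 3) ≤ 1 / 30 * (718 / 10000) := by gcongr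
          have : p * (r * z ^ 6) ≤ 1 / 30 * (38 / 10000) := by gcongr
          have : r * (r * z ^ 6) * z ^ 3 ≤ 82 / 100000 * (38 / 10000) * (283 / 100) := by gcongr
          linarith
        · have : v * z ≤ 41 / 1000 * (14143 / 10000) := by gcongr
          linarith
        · have : g * z ^ 3 ≤ 4 / 5 * p * z ^ 3 := by gcongr
          linarith
    have := quadratic_form_pos ha hab h0'
    have b1 := mul_le_mul_of_nonneg_left hα (sq_nonneg x)
    have b2 := mul_le_mul_of_nonneg_left hβ (sq_nonneg z)
    linarith

lemma bracket_pos_inner {ζ η : ℝ} (hζ : 0 ≤ ζ) (hζ' : ζ ≤ 1) (hη : 0 ≤ η) (hη' : η ≤ 2321 / 5000) :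
    1 / 400 ≤
      7 / 6 + (-1 / 3) * ζ ^ 2 + (-2051371 / 10000000) * ζ ^ 3 + 184233 / 200000 * ζ ^ 3 * η ^ 3 +
      (-104847267 / 1000000000) * ζ ^ 4 * η + 395101 / 1000000 * ζ ^ 4 * η ^ 4 + 113 / 1000 * ζ ^ 5 +
      (-59 / 100) * ζ ^ 5 * η ^ 3 := by
  obtain ⟨α, hα, hα0⟩ : ∃ α, α = ζ - 0 ∧ 0 ≤ α := ⟨_, rfl, by linarith⟩
  obtain ⟨β, hβ, hβ0⟩ : ∃ β, β = 1 - ζ ∧ 0 ≤ β := ⟨_, rfl, by linarith⟩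
  obtain ⟨θ, hθ, hθ0⟩ : ∃ θ, θ = 2321 / 5000 - η ∧ 0 ≤ θ := ⟨_, rfl, by linarith⟩
  have key : 0 ≤
      198437500000000 / 7914602927913 * β ^ 5 * θ ^ 4 +
      793750000000000 / 7914602927913 * β ^ 5 * η * θ ^ 3 +
      396875000000000 / 2638200975971 * β ^ 5 * η ^ 2 * θ ^ 2 +
      793750000000000 / 7914602927913 * β ^ 5 * η ^ 3 * θ +
      198437500000000 / 7914602927913 * β ^ 5 * η ^ 4 +
      992187500000000 / 7914602927913 * α * β ^ 4 * θ ^ 4 +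
      3968750000000000 / 7914602927913 * α * β ^ 4 * η * θ ^ 3 +
      1984375000000000 / 2638200975971 * α * β ^ 4 * η ^ 2 * θ ^ 2 +
      3968750000000000 / 7914602927913 * α * β ^ 4 * η ^ 3 * θ +
      992187500000000 / 7914602927913 * α * β ^ 4 * η ^ 4 +
      21203125000000000 / 87060632207043 * α ^ 2 * β ^ 3 * θ ^ 4 +
      84812500000000000 / 87060632207043 * α ^ 2 * β ^ 3 * η * θ ^ 3 +
      42406250000000000 / 29020210735681 * α ^ 2 * β ^ 3 * η ^ 2 * θ ^ 2 +
      84812500000000000 / 87060632207043 * α ^ 2 * β ^ 3 * η ^ 3 * θ +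
      21203125000000000 / 87060632207043 * α ^ 2 * β ^ 3 * η ^ 4 +
      19568492937500000 / 87060632207043 * α ^ 3 * β ^ 2 * θ ^ 4 +
      78273971750000000 / 87060632207043 * α ^ 3 * β ^ 2 * η * θ ^ 3 +
      39136985875000000 / 29020210735681 * α ^ 3 * β ^ 2 * η ^ 2 * θ ^ 2 +
      3137869443655062539 / 3482425288281720 * α ^ 3 * β ^ 2 * η ^ 3 * θ +
      789650291155062539 / 3482425288281720 * α ^ 3 * β ^ 2 * η ^ 4 +
      8269798375000000 / 87060632207043 * α ^ 4 * β * θ ^ 4 +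
      32987937059984875 / 87060632207043 * α ^ 4 * β * η * θ ^ 3 +
      16448340309984875 / 29020210735681 * α ^ 4 * β * η ^ 2 * θ ^ 2 +
      663019057254155039 / 1741212644140860 * α ^ 4 * β * η ^ 3 * θ +
      8558468360583636846343 / 87060632207043000000 * α ^ 4 * β * η ^ 4 +
      1385055437500000 / 87060632207043 * α ^ 5 * θ ^ 4 +
      5448965309984875 / 87060632207043 * α ^ 5 * η * θ ^ 3 +
      2678854434984875 / 29020210735681 * α ^ 5 * η ^ 2 * θ ^ 2 +
      213142494808253539 / 3482425288281720 * α ^ 5 * η ^ 3 * θ +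
      1390306680582223371343 / 87060632207043000000 * α ^ 5 * η ^ 4 := by
    positivity
  rw [hα, hβ, hθ] at key
  ring_nf at key ⊢
  linarith

lemma bracket_pos_mid {ζ η : ℝ} (hζ : 1 ≤ ζ) (hζ' : ζ ≤ 2) (hη : 0 ≤ η) (hη' : η ≤ 2321 / 5000) :
    1 / 400 ≤
      7 / 6 + (-1 / 3) * ζ ^ 2 + (-2051371 / 10000000) * ζ ^ 3 + 184233 / 200000 * ζ ^ 3 * η ^ 3 +
      (-104847267 / 1000000000) * ζ ^ 4 * η + 395101 / 1000000 * ζ ^ 4 * η ^ 4 + 113 / 1000 * ζ ^ 5 +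
      (-59 / 100) * ζ ^ 5 * η ^ 3 := by
  obtain ⟨α, hα, hα0⟩ : ∃ α, α = ζ - 1 ∧ 0 ≤ α := ⟨_, rfl, by linarith⟩
  obtain ⟨β, hβ, hβ0⟩ : ∃ β, β = 2 - ζ ∧ 0 ≤ β := ⟨_, rfl, by linarith⟩
  obtain ⟨θ, hθ, hθ0⟩ : ∃ θ, θ = 2321 / 5000 - η ∧ 0 ≤ θ := ⟨_, rfl, by linarith⟩
  have key : 0 ≤
      1385055437500000 / 87060632207043 * β ^ 5 * θ ^ 4 +
      5448965309984875 / 87060632207043 * β ^ 5 * η * θ ^ 3 +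
      2678854434984875 / 29020210735681 * β ^ 5 * η ^ 2 * θ ^ 2 +
      213142494808253539 / 3482425288281720 * β ^ 5 * η ^ 3 * θ +
      1390306680582223371343 / 87060632207043000000 * β ^ 5 * η ^ 4 +
      1860252000000000 / 29020210735681 * α * β ^ 4 * θ ^ 4 +
      7167238679954625 / 29020210735681 * α * β ^ 4 * η * θ ^ 3 +
      10340204039863875 / 29020210735681 * α * β ^ 4 * η ^ 2 * θ ^ 2 +
      33557784732259388 / 145101053678405 * α * β ^ 4 * η ^ 3 * θ +
      1781532815079532289029 / 29020210735681000000 * α * β ^ 4 * η ^ 4 +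
      801120312500000 / 7914602927913 * α ^ 2 * β ^ 3 * θ ^ 4 +
      2939007969956000 / 7914602927913 * α ^ 2 * β ^ 3 * η * θ ^ 3 +
      1336767344956000 / 2638200975971 * α ^ 2 * β ^ 3 * η ^ 2 * θ ^ 2 +
      19186623998522245 / 63316823423304 * α ^ 2 * β ^ 3 * η ^ 3 * θ +
      78247472926095494977 / 989325365989125000 * α ^ 2 * β ^ 3 * η ^ 4 +
      8537106625000000 / 87060632207043 * α ^ 3 * β ^ 2 * θ ^ 4 +
      29038065859153000 / 87060632207043 * α ^ 3 * β ^ 2 * η * θ ^ 3 +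
      11963852609153000 / 29020210735681 * α ^ 3 * β ^ 2 * η ^ 2 * θ ^ 2 +
      330600749195608241 / 1741212644140860 * α ^ 3 * β ^ 2 * η ^ 3 * θ +
      383214058228745780651 / 10882579025880375000 * α ^ 3 * β ^ 2 * η ^ 4 +
      214980750000000 / 2638200975971 * α ^ 4 * β * θ ^ 4 +
      727186359978000 / 2638200975971 * α ^ 4 * β * η * θ ^ 3 +
      891674579934000 / 2638200975971 * α ^ 4 * β * η ^ 2 * θ ^ 2 +
      3400479123144781 / 26382009759710 * α ^ 4 * β * η ^ 3 * θ +
      663251428826235463 / 164887560998187500 * α ^ 4 * β * η ^ 4 +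
      307796000000000 / 7914602927913 * α ^ 5 * θ ^ 4 +
      1098447359978000 / 7914602927913 * α ^ 5 * η * θ ^ 3 +
      482855359978000 / 2638200975971 * α ^ 5 * η ^ 2 * θ ^ 2 +
      3183585806496049 / 39573014639565 * α ^ 5 * η ^ 3 * θ +
      1802220115371966713 / 494662682994562500 * α ^ 5 * η ^ 4 := by
    positivity
  rw [hα, hβ, hθ] at key
  ring_nf at key ⊢
  linarith

lemma bracket_pos_outer {ζ η : ℝ} (hζ : 2 ≤ ζ) (hζ' : ζ ≤ 3) (hη : 0 ≤ η) (hη' : η ≤ 2321 / 5000) :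
    1 / 400 ≤
      7 / 6 + (-1 / 3) * ζ ^ 2 + (-2051371 / 10000000) * ζ ^ 3 + 184233 / 200000 * ζ ^ 3 * η ^ 3 +
      (-104847267 / 1000000000) * ζ ^ 4 * η + 395101 / 1000000 * ζ ^ 4 * η ^ 4 + 113 / 1000 * ζ ^ 5 +
      (-59 / 100) * ζ ^ 5 * η ^ 3 := by
  obtain ⟨α, hα, hα0⟩ : ∃ α, α = ζ - 2 ∧ 0 ≤ α := ⟨_, rfl, by linarith⟩
  obtain ⟨β, hβ, hβ0⟩ : ∃ β, β = 3 - ζ ∧ 0 ≤ β := ⟨_, rfl, by linarith⟩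
  obtain ⟨θ, hθ, hθ0⟩ : ∃ θ, θ = 2321 / 5000 - η ∧ 0 ≤ θ := ⟨_, rfl, by linarith⟩
  have key : 0 ≤
      307796000000000 / 7914602927913 * β ^ 5 * θ ^ 4 +
      1098447359978000 / 7914602927913 * β ^ 5 * η * θ ^ 3 +
      482855359978000 / 2638200975971 * β ^ 5 * η ^ 2 * θ ^ 2 +
      3183585806496049 / 39573014639565 * β ^ 5 * η ^ 3 * θ +
      1802220115371966713 / 494662682994562500 * β ^ 5 * η ^ 4 +
      2433017750000000 / 7914602927913 * α * β ^ 4 * θ ^ 4 +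
      8802914519846000 / 7914602927913 * α * β ^ 4 * η * θ ^ 3 +
      3936879019846000 / 2638200975971 * α * β ^ 4 * η ^ 2 * θ ^ 2 +
      53470278760486637 / 79146029279130 * α * β ^ 4 * η ^ 3 * θ +
      16032446867240960741 / 494662682994562500 * α * β ^ 4 * η ^ 4 +
      87212428625000000 / 87060632207043 * α ^ 2 * β ^ 3 * θ ^ 4 +
      320377705215281000 / 87060632207043 * α ^ 2 * β ^ 3 * η * θ ^ 3 +
      145952847965281000 / 29020210735681 * α ^ 2 * β ^ 3 * η ^ 2 * θ ^ 2 +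
      4138258791608210113 / 1741212644140860 * α ^ 2 * β ^ 3 * η ^ 3 * θ +
      1618971005335824163627 / 10882579025880375000 * α ^ 2 * β ^ 3 * η ^ 4 +
      143006042312500000 / 87060632207043 * α ^ 3 * β ^ 2 * θ ^ 4 +
      532601387163466000 / 87060632207043 * α ^ 3 * β ^ 2 * η * θ ^ 3 +
      246589302538466000 / 29020210735681 * α ^ 3 * β ^ 2 * η ^ 2 * θ ^ 2 +
      14551670886038094169 / 3482425288281720 * α ^ 3 * β ^ 2 * η ^ 3 * θ +
      3559879286979328680647 / 10882579025880375000 * α ^ 3 * β ^ 2 * η ^ 4 +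
      116617549750000000 / 87060632207043 * α ^ 4 * β * θ ^ 4 +
      439367036315507875 / 87060632207043 * α ^ 4 * β * η * θ ^ 3 +
      206131936815507875 / 29020210735681 * α ^ 4 * β * η ^ 2 * θ ^ 2 +
      3141891949040639803 / 870606322070430 * α ^ 4 * β * η ^ 3 * θ +
      28759000648201794513871 / 87060632207043000000 * α ^ 4 * β * η ^ 4 +
      37658371812500000 / 87060632207043 * α ^ 5 * θ ^ 4 +
      143241715608774875 / 87060632207043 * α ^ 5 * η * θ ^ 3 +
      67924971983774875 / 29020210735681 * α ^ 5 * η ^ 2 * θ ^ 2 +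
      4249351602806131553 / 3482425288281720 * α ^ 5 * η ^ 3 * θ +
      10828435085599965428783 / 87060632207043000000 * α ^ 5 * η ^ 4 := by
    positivity
  rw [hα, hβ, hθ] at key
  ring_nf at key ⊢
  linarith

lemma bracket_pos_far {ζ η : ℝ} (hζ : 0 ≤ ζ) (hζ' : ζ ≤ 1 / 3) (hη : 0 ≤ η) (hη' : η ≤ 14143 / 10000) :
    1 / 400 ≤
      113 / 1000 + (-2051371 / 10000000) * ζ ^ 2 + (-104847267 / 1000000000) * ζ ^ 2 * η +
      (-1 / 3) * ζ ^ 3 + (-59 / 100) * ζ ^ 3 * η ^ 3 + 7 / 6 * ζ ^ 5 +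
      184233 / 200000 * ζ ^ 5 * η ^ 3 + 395101 / 1000000 * ζ ^ 5 * η ^ 4 := by
  obtain ⟨α, hα, hα0⟩ : ∃ α, α = ζ - 0 ∧ 0 ≤ α := ⟨_, rfl, by linarith⟩
  obtain ⟨β, hβ, hβ0⟩ : ∃ β, β = 1 / 3 - ζ ∧ 0 ≤ β := ⟨_, rfl, by linarith⟩
  obtain ⟨θ, hθ, hθ0⟩ : ∃ θ, θ = 14143 / 10000 - η ∧ 0 ≤ θ := ⟨_, rfl, by linarith⟩
  have key : 0 ≤
      268515000000000000 / 40009780197753601 * β ^ 5 * θ ^ 4 +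
      1074060000000000000 / 40009780197753601 * β ^ 5 * η * θ ^ 3 +
      1611090000000000000 / 40009780197753601 * β ^ 5 * η ^ 2 * θ ^ 2 +
      1074060000000000000 / 40009780197753601 * β ^ 5 * η ^ 3 * θ +
      268515000000000000 / 40009780197753601 * β ^ 5 * η ^ 4 +
      1342575000000000000 / 40009780197753601 * α * β ^ 4 * θ ^ 4 +
      5370300000000000000 / 40009780197753601 * α * β ^ 4 * η * θ ^ 3 +
      8055450000000000000 / 40009780197753601 * α * β ^ 4 * η ^ 2 * θ ^ 2 +
      5370300000000000000 / 40009780197753601 * α * β ^ 4 * η ^ 3 * θ +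
      1342575000000000000 / 40009780197753601 * α * β ^ 4 * η ^ 4 +
      2629762983000000000 / 40009780197753601 * α ^ 2 * β ^ 3 * θ ^ 4 +
      10479014849776113000 / 40009780197753601 * α ^ 2 * β ^ 3 * η * θ ^ 3 +
      15658466651328339000 / 40009780197753601 * α ^ 2 * β ^ 3 * η ^ 2 * θ ^ 2 +
      10398940685328339000 / 40009780197753601 * α ^ 2 * β ^ 3 * η ^ 3 * θ +
      2589725900776113000 / 40009780197753601 * α ^ 2 * β ^ 3 * η ^ 4 +
      2488988949000000000 / 40009780197753601 * α ^ 3 * β ^ 2 * θ ^ 4 +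
      9835844549328339000 / 40009780197753601 * α ^ 3 * β ^ 2 * η * θ ^ 3 +
      14573599953985017000 / 40009780197753601 * α ^ 3 * β ^ 2 * η ^ 2 * θ ^ 2 +
      9445405034949825300 / 40009780197753601 * α ^ 3 * β ^ 2 * η ^ 3 * θ +
      2218660681293147300 / 40009780197753601 * α ^ 3 * β ^ 2 * η ^ 4 +
      1116413949000000000 / 40009780197753601 * α ^ 4 * β * θ ^ 4 +
      4345544549328339000 / 40009780197753601 * α ^ 4 * β * η * θ ^ 3 +
      6338149953985017000 / 40009780197753601 * α ^ 4 * β * η ^ 2 * θ ^ 2 +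
      3804888013914633600 / 40009780197753601 * α ^ 4 * β * η ^ 3 * θ +
      695868660257955600 / 40009780197753601 * α ^ 4 * β * η ^ 4 +
      584383949000000000 / 120029340593260803 * α ^ 5 * θ ^ 4 +
      2217424549328339000 / 120029340593260803 * α ^ 5 * η * θ ^ 3 +
      1048656651328339000 / 40009780197753601 * α ^ 5 * η ^ 2 * θ ^ 2 +
      32094575362468864693 / 2400586811865216060 * α ^ 5 * η ^ 3 * θ +
      139223126964503171176103 / 120029340593260803000000 * α ^ 5 * η ^ 4 := by
    positivity
  rw [hα, hβ, hθ] at key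
  ring_nf at key ⊢
  linarith

lemma bracket_neg_inner {ζ η : ℝ} (hζ : 0 ≤ ζ) (hζ' : ζ ≤ 1) (hη : 0 ≤ η) (hη' : η ≤ 2321 / 5000) :
    1 / 400 ≤
      7 / 6 + (-1 / 3) * ζ ^ 2 + (-12803 / 100000) * ζ ^ 3 + 63 / 100 * ζ ^ 3 * η ^ 3 +
      (-26433267 / 1000000000) * ζ ^ 4 * η + 99001 / 1000000 * ζ ^ 4 * η ^ 4 +
      85683 / 1000000 * ζ ^ 5 + (-1121 / 2500) * ζ ^ 5 * η ^ 3 + (-1389 / 50000) * ζ ^ 6 * η +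
      18 / 125 * ζ ^ 6 * η ^ 4 := by
  obtain ⟨α, hα, hα0⟩ : ∃ α, α = ζ - 0 ∧ 0 ≤ α := ⟨_, rfl, by linarith⟩
  obtain ⟨β, hβ, hβ0⟩ : ∃ β, β = 1 - ζ ∧ 0 ≤ β := ⟨_, rfl, by linarith⟩
  obtain ⟨θ, hθ, hθ0⟩ : ∃ θ, θ = 2321 / 5000 - η ∧ 0 ≤ θ := ⟨_, rfl, by linarith⟩
  have key : 0 ≤
      198437500000000 / 7914602927913 * β ^ 6 * θ ^ 4 +
      793750000000000 / 7914602927913 * β ^ 6 * η * θ ^ 3 +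
      396875000000000 / 2638200975971 * β ^ 6 * η ^ 2 * θ ^ 2 +
      793750000000000 / 7914602927913 * β ^ 6 * η ^ 3 * θ +
      198437500000000 / 7914602927913 * β ^ 6 * η ^ 4 +
      396875000000000 / 2638200975971 * α * β ^ 5 * θ ^ 4 +
      1587500000000000 / 2638200975971 * α * β ^ 5 * η * θ ^ 3 +
      2381250000000000 / 2638200975971 * α * β ^ 5 * η ^ 2 * θ ^ 2 +
      1587500000000000 / 2638200975971 * α * β ^ 5 * η ^ 3 * θ +
      396875000000000 / 2638200975971 * α * β ^ 5 * η ^ 4 +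
      32117187500000000 / 87060632207043 * α ^ 2 * β ^ 4 * θ ^ 4 +
      128468750000000000 / 87060632207043 * α ^ 2 * β ^ 4 * η * θ ^ 3 +
      64234375000000000 / 29020210735681 * α ^ 2 * β ^ 4 * η ^ 2 * θ ^ 2 +
      128468750000000000 / 87060632207043 * α ^ 2 * β ^ 4 * η ^ 3 * θ +
      32117187500000000 / 87060632207043 * α ^ 2 * β ^ 4 * η ^ 4 +
      13638731250000000 / 29020210735681 * α ^ 3 * β ^ 3 * θ ^ 4 +
      54554925000000000 / 29020210735681 * α ^ 3 * β ^ 3 * η * θ ^ 3 +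
      81832387500000000 / 29020210735681 * α ^ 3 * β ^ 3 * η ^ 2 * θ ^ 2 +
      54594310464807150 / 29020210735681 * α ^ 3 * β ^ 3 * η ^ 3 * θ +
      13678116714807150 / 29020210735681 * α ^ 3 * β ^ 3 * η ^ 4 +
      9424006250000000 / 29020210735681 * α ^ 4 * β ^ 2 * θ ^ 4 +
      37688356048411625 / 29020210735681 * α ^ 4 * β ^ 2 * η * θ ^ 3 +
      56521030645234875 / 29020210735681 * α ^ 4 * β ^ 2 * η ^ 2 * θ ^ 2 +
      37791174539656325 / 29020210735681 * α ^ 4 * β ^ 2 * η ^ 3 * θ +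
      9537366722716118154681 / 29020210735681000000 * α ^ 4 * β ^ 2 * η ^ 4 +
      10037361875000000 / 87060632207043 * α ^ 5 * β * θ ^ 4 +
      40103433790469750 / 87060632207043 * α ^ 5 * β * η * θ ^ 3 +
      20028710040469750 / 29020210735681 * α ^ 5 * β * η ^ 2 * θ ^ 2 +
      40281778209818714 / 87060632207043 * α ^ 5 * β * η ^ 3 * θ +
      5139479091588736464043 / 43530316103521500000 * α ^ 5 * β * η ^ 4 +
      1478411875000000 / 87060632207043 * α ^ 6 * θ ^ 4 +
      5866461627734875 / 87060632207043 * α ^ 6 * η * θ ^ 3 +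
      2909637877734875 / 29020210735681 * α ^ 6 * η ^ 2 * θ ^ 2 +
      5806148932771189 / 87060632207043 * α ^ 6 * η ^ 3 * θ +
      1486440872988382656043 / 87060632207043000000 * α ^ 6 * η ^ 4 := by
    positivity
  rw [hα, hβ, hθ] at key
  ring_nf at key ⊢
  linarith

lemma bracket_neg_mid {ζ η : ℝ} (hζ : 1 ≤ ζ) (hζ' : ζ ≤ 2) (hη : 0 ≤ η) (hη' : η ≤ 2321 / 5000) :
    1 / 400 ≤
      7 / 6 + (-1 / 3) * ζ ^ 2 + (-12803 / 100000) * ζ ^ 3 + 63 / 100 * ζ ^ 3 * η ^ 3 +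
      (-26433267 / 1000000000) * ζ ^ 4 * η + 99001 / 1000000 * ζ ^ 4 * η ^ 4 +
      85683 / 1000000 * ζ ^ 5 + (-1121 / 2500) * ζ ^ 5 * η ^ 3 + (-1389 / 50000) * ζ ^ 6 * η +
      18 / 125 * ζ ^ 6 * η ^ 4 := by
  obtain ⟨α, hα, hα0⟩ : ∃ α, α = ζ - 1 ∧ 0 ≤ α := ⟨_, rfl, by linarith⟩
  obtain ⟨β, hβ, hβ0⟩ : ∃ β, β = 2 - ζ ∧ 0 ≤ β := ⟨_, rfl, by linarith⟩
  obtain ⟨θ, hθ, hθ0⟩ : ∃ θ, θ = 2321 / 5000 - η ∧ 0 ≤ θ := ⟨_, rfl, by linarith⟩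
  have key : 0 ≤
      1478411875000000 / 87060632207043 * β ^ 6 * θ ^ 4 +
      5866461627734875 / 87060632207043 * β ^ 6 * η * θ ^ 3 +
      2909637877734875 / 29020210735681 * β ^ 6 * η ^ 2 * θ ^ 2 +
      5806148932771189 / 87060632207043 * β ^ 6 * η ^ 3 * θ +
      1486440872988382656043 / 87060632207043000000 * β ^ 6 * η ^ 4 +
      7703580625000000 / 87060632207043 * α * β ^ 5 * θ ^ 4 +
      30294105742348750 / 87060632207043 * α * β ^ 5 * η * θ ^ 3 +
      14886944492348750 / 29020210735681 * α * β ^ 5 * η ^ 2 * θ ^ 2 +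
      29392008983435554 / 87060632207043 * α * β ^ 5 * η ^ 3 * θ +
      755833229268311894443 / 8706063220704300000 * α * β ^ 5 * η ^ 4 +
      16603112500000000 / 87060632207043 * α ^ 2 * β ^ 4 * θ ^ 4 +
      64018427904629875 / 87060632207043 * α ^ 2 * β ^ 4 * η * θ ^ 3 +
      30812202904629875 / 29020210735681 * α ^ 2 * β ^ 4 * η ^ 2 * θ ^ 2 +
      58924677487053175 / 87060632207043 * α ^ 2 * β ^ 4 * η ^ 3 * θ +
      15008970715676584545763 / 87060632207043000000 * α ^ 2 * β ^ 4 * η ^ 4 +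
      20311381250000000 / 87060632207043 * α ^ 3 * β ^ 3 * θ ^ 4 +
      75352278980669000 / 87060632207043 * α ^ 3 * β ^ 3 * η * θ ^ 3 +
      34729516480669000 / 29020210735681 * α ^ 3 * β ^ 3 * η ^ 2 * θ ^ 2 +
      60917958407972030 / 87060632207043 * α ^ 3 * β ^ 3 * η ^ 3 * θ +
      1816832943975961694473 / 10882579025880375000 * α ^ 3 * β ^ 3 * η ^ 4 +
      16978375000000000 / 87060632207043 * α ^ 4 * β ^ 2 * θ ^ 4 +
      59717822904427000 / 87060632207043 * α ^ 4 * β ^ 2 * η * θ ^ 3 +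
      25761072904427000 / 29020210735681 * α ^ 4 * β ^ 2 * η ^ 2 * θ ^ 2 +
      37669215568314940 / 87060632207043 * α ^ 4 * β ^ 2 * η ^ 3 * θ +
      878830691505726292559 / 10882579025880375000 * α ^ 4 * β ^ 2 * η ^ 4 +
      9948280000000000 / 87060632207043 * α ^ 5 * β * θ ^ 4 +
      33678309935032000 / 87060632207043 * α ^ 5 * β * η * θ ^ 3 +
      13781749935032000 / 29020210735681 * α ^ 5 * β * η ^ 2 * θ ^ 2 +
      16283417380520968 / 87060632207043 * α ^ 5 * β * η ^ 3 * θ +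
      25419868863462165043 / 1360322378235046875 * α ^ 5 * β * η ^ 4 +
      2903342500000000 / 87060632207043 * α ^ 6 * θ ^ 4 +
      9697803203758000 / 87060632207043 * α ^ 6 * η * θ ^ 3 +
      3891118203758000 / 29020210735681 * α ^ 6 * η ^ 2 * θ ^ 2 +
      4120805731289248 / 87060632207043 * α ^ 6 * η ^ 3 * θ +
      11385502786214232043 / 5441289512940187500 * α ^ 6 * η ^ 4 := by
    positivity
  rw [hα, hβ, hθ] at key
  ring_nf at key ⊢
  linarith

lemma bracket_neg_outer {ζ η : ℝ} (hζ : 2 ≤ ζ) (hζ' : ζ ≤ 3) (hη : 0 ≤ η) (hη' : η ≤ 2321 / 5000) :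
    1 / 400 ≤
      7 / 6 + (-1 / 3) * ζ ^ 2 + (-12803 / 100000) * ζ ^ 3 + 63 / 100 * ζ ^ 3 * η ^ 3 +
      (-26433267 / 1000000000) * ζ ^ 4 * η + 99001 / 1000000 * ζ ^ 4 * η ^ 4 +
      85683 / 1000000 * ζ ^ 5 + (-1121 / 2500) * ζ ^ 5 * η ^ 3 + (-1389 / 50000) * ζ ^ 6 * η +
      18 / 125 * ζ ^ 6 * η ^ 4 := by
  obtain ⟨α, hα, hα0⟩ : ∃ α, α = ζ - 2 ∧ 0 ≤ α := ⟨_, rfl, by linarith⟩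
  obtain ⟨β, hβ, hβ0⟩ : ∃ β, β = 3 - ζ ∧ 0 ≤ β := ⟨_, rfl, by linarith⟩
  obtain ⟨θ, hθ, hθ0⟩ : ∃ θ, θ = 2321 / 5000 - η ∧ 0 ≤ θ := ⟨_, rfl, by linarith⟩
  have key : 0 ≤
      2903342500000000 / 87060632207043 * β ^ 6 * θ ^ 4 +
      9697803203758000 / 87060632207043 * β ^ 6 * η * θ ^ 3 +
      3891118203758000 / 29020210735681 * β ^ 6 * η ^ 2 * θ ^ 2 +
      4120805731289248 / 87060632207043 * β ^ 6 * η ^ 3 * θ +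
      11385502786214232043 / 5441289512940187500 * β ^ 6 * η ^ 4 +
      24891830000000000 / 87060632207043 * α * β ^ 5 * θ ^ 4 +
      82695328510064000 / 87060632207043 * α * β ^ 5 * η * θ ^ 3 +
      32911668510064000 / 29020210735681 * α * β ^ 5 * η ^ 2 * θ ^ 2 +
      33166251394950008 / 87060632207043 * α * β ^ 5 * η ^ 3 * θ +
      8736639495180531086 / 1360322378235046875 * α * β ^ 5 * η ^ 4 +
      30565375000000000 / 29020210735681 * α ^ 2 * β ^ 4 * θ ^ 4 +
      101600971926529000 / 29020210735681 * α ^ 2 * β ^ 4 * η * θ ^ 3 +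
      121410665779587000 / 29020210735681 * α ^ 2 * β ^ 4 * η ^ 2 * θ ^ 2 +
      40694461880153380 / 29020210735681 * α ^ 2 * β ^ 4 * η ^ 3 * θ +
      70500505591486978093 / 3627526341960125000 * α ^ 2 * β ^ 4 * η ^ 4 +
      60706406250000000 / 29020210735681 * α ^ 3 * β ^ 3 * θ ^ 4 +
      202302139818249000 / 29020210735681 * α ^ 3 * β ^ 3 * η * θ ^ 3 +
      242667981954747000 / 29020210735681 * α ^ 3 * β ^ 3 * η ^ 2 * θ ^ 2 +
      82809329307996150 / 29020210735681 * α ^ 3 * β ^ 3 * η ^ 3 * θ +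
      240938481116836695333 / 3627526341960125000 * α ^ 3 * β ^ 3 * η ^ 4 +
      203155625000000000 / 87060632207043 * α ^ 4 * β ^ 2 * θ ^ 4 +
      678340477826223875 / 87060632207043 * α ^ 4 * β ^ 2 * η * θ ^ 3 +
      272029227826223875 / 29020210735681 * α ^ 4 * β ^ 2 * η ^ 2 * θ ^ 2 +
      283798085746521635 / 87060632207043 * α ^ 4 * β ^ 2 * η ^ 3 * θ +
      10107084292066237407347 / 87060632207043000000 * α ^ 4 * β ^ 2 * η ^ 4 +
      39953218125000000 / 29020210735681 * α ^ 5 * β * θ ^ 4 +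
      133412003789594250 / 29020210735681 * α ^ 5 * β * η * θ ^ 3 +
      160516702618782750 / 29020210735681 * α ^ 5 * β * η ^ 2 * θ ^ 2 +
      56409136073683014 / 29020210735681 * α ^ 5 * β * η ^ 3 * θ +
      1311463492020110546709 / 14510105367840500000 * α ^ 5 * β * η ^ 4 +
      29115610625000000 / 87060632207043 * α ^ 6 * θ ^ 4 +
      96972383506524875 / 87060632207043 * α ^ 6 * η * θ ^ 3 +
      38741162256524875 / 29020210735681 * α ^ 6 * η ^ 2 * θ ^ 2 +
      40746833369216477 / 87060632207043 * α ^ 6 * η ^ 3 * θ +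
      2217542669312759555483 / 87060632207043000000 * α ^ 6 * η ^ 4 := by
    positivity
  rw [hα, hβ, hθ] at key
  ring_nf at key ⊢
  linarith

lemma bracket_neg_far {ζ η : ℝ} (hζ : 0 ≤ ζ) (hζ' : ζ ≤ 1 / 3) (hη : 0 ≤ η) (hη' : η ≤ 14143 / 10000) :
    1 / 400 ≤
      85683 / 1000000 + (-1389 / 50000) * η + (-12803 / 100000) * ζ ^ 2 +
      (-26433267 / 1000000000) * ζ ^ 2 * η + (-1 / 3) * ζ ^ 3 + (-1121 / 2500) * ζ ^ 3 * η ^ 3 +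
      18 / 125 * ζ ^ 3 * η ^ 4 + 7 / 6 * ζ ^ 5 + 63 / 100 * ζ ^ 5 * η ^ 3 +
      99001 / 1000000 * ζ ^ 5 * η ^ 4 := by
  obtain ⟨α, hα, hα0⟩ : ∃ α, α = ζ - 0 ∧ 0 ≤ α := ⟨_, rfl, by linarith⟩
  obtain ⟨β, hβ, hβ0⟩ : ∃ β, β = 1 / 3 - ζ ∧ 0 ≤ β := ⟨_, rfl, by linarith⟩
  obtain ⟨θ, hθ, hθ0⟩ : ∃ θ, θ = 14143 / 10000 - η ∧ 0 ≤ θ := ⟨_, rfl, by linarith⟩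
  have key : 0 ≤
      202134690000000000 / 40009780197753601 * β ^ 5 * θ ^ 4 +
      713065872780000000 / 40009780197753601 * β ^ 5 * η * θ ^ 3 +
      926389478340000000 / 40009780197753601 * β ^ 5 * η ^ 2 * θ ^ 2 +
      522120098340000000 / 40009780197753601 * β ^ 5 * η ^ 3 * θ +
      106661802780000000 / 40009780197753601 * β ^ 5 * η ^ 4 +
      1010673450000000000 / 40009780197753601 * α * β ^ 4 * θ ^ 4 +
      3565329363900000000 / 40009780197753601 * α * β ^ 4 * η * θ ^ 3 +
      4631947391700000000 / 40009780197753601 * α * β ^ 4 * η ^ 2 * θ ^ 2 +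
      2610600491700000000 / 40009780197753601 * α * β ^ 4 * η ^ 3 * θ +
      533309013900000000 / 40009780197753601 * α * β ^ 4 * η ^ 4 +
      1986778800000000000 / 40009780197753601 * α ^ 2 * β ^ 3 * θ ^ 4 +
      6982292494030113000 / 40009780197753601 * α ^ 2 * β ^ 3 * η * θ ^ 3 +
      9026204682090339000 / 40009780197753601 * α ^ 2 * β ^ 3 * η ^ 2 * θ ^ 2 +
      5052647082090339000 / 40009780197753601 * α ^ 2 * β ^ 3 * η ^ 3 * θ +
      1021956094030113000 / 40009780197753601 * α ^ 2 * β ^ 3 * η ^ 4 +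
      1887642600000000000 / 40009780197753601 * α ^ 3 * β ^ 2 * θ ^ 4 +
      6565560026490339000 / 40009780197753601 * α ^ 3 * β ^ 2 * η * θ ^ 3 +
      8370824479471017000 / 40009780197753601 * α ^ 3 * β ^ 2 * η ^ 2 * θ ^ 2 +
      4481374343484271308 / 40009780197753601 * α ^ 3 * β ^ 2 * η ^ 3 * θ +
      105039995704985246862 / 5001222524719200125 * α ^ 3 * β ^ 2 * η ^ 4 +
      846969150000000000 / 40009780197753601 * α ^ 4 * β * θ ^ 4 +
      2880230662590339000 / 40009780197753601 * α ^ 4 * β * η * θ ^ 3 +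
      3558877087771017000 / 40009780197753601 * α ^ 4 * β * η ^ 2 * θ ^ 2 +
      1636608915797525616 / 40009780197753601 * α ^ 4 * β * η ^ 3 * θ +
      26837336361178118724 / 5001222524719200125 * α ^ 4 * β * η ^ 4 +
      447699770000000000 / 120029340593260803 * α ^ 5 * θ ^ 4 +
      1474098917030339000 / 120029340593260803 * α ^ 5 * η * θ ^ 3 +
      578699377030339000 / 40009780197753601 * α ^ 5 * η ^ 2 * θ ^ 2 +
      551670858414492224 / 120029340593260803 * α ^ 5 * η ^ 3 * θ +
      9412924510753637445803 / 120029340593260803000000 * α ^ 5 * η ^ 4 := by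
    positivity
  rw [hα, hβ, hθ] at key
  ring_nf at key ⊢
  linarith

lemma cube_root_bound {m δ c d : ℝ} (hm : m = 3 / 5 - δ ^ 3) (h1 : c ≤ m) (hd : 0 ≤ d)
    (hcd : 3 / 5 - c ≤ d ^ 3) : δ ≤ d := by
  by_contra! h
  have : d ^ 3 < δ ^ 3 := by gcongr
  linarith

lemma bracket_pos_bound {δ z : ℝ} (hδ : 0 < δ) (hδ' : δ ≤ 2321 / 5000) (hz : 0 ≤ z) (hz' : z ≤ 14143 / 10000) :
    0 < 10 / 3 * δ ^ 3 * (7 / 20 * δ ^ 2) - δ ^ 3 / 3 * z ^ 2 + (113 / 1000 - 59 / 100 * δ ^ 3) * z ^ 5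
      - 7 / 20 * δ ^ 2 * z ^ 3 * (3658 / 10000 - 9 / 5 * δ ^ 3)
      - 14143 / 10000 * (7 / 20 * δ ^ 2) * (534 / 10000 - 1 / 5 * δ ^ 3) * z ^ 4
      - 7 / 20 * δ ^ 2 * z ^ 3 * (3734 / 10000 - 141 / 100 * δ ^ 3) * (3 / 5 * z + 59 / 100) := by
  rcases le_total z (3 * δ) with h | h
  · obtain ⟨ζ, rfl⟩ : ∃ ζ, z = δ * ζ := ⟨z / δ, by field_simp⟩
    have h0 : 0 ≤ ζ := nonneg_of_mul_nonneg_right hz hδ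
    have h3 : ζ ≤ 3 := le_of_mul_le_mul_left (by linarith) hδ
    have h5 : 0 < δ ^ 5 := by positivity
    rcases le_total ζ 1 with hζ | hζ
    · nlinarith [mul_le_mul_of_nonneg_left (bracket_pos_inner h0 hζ hδ.le hδ') h5.le]
    rcases le_total ζ 2 with hζ' | hζ'
    · nlinarith [mul_le_mul_of_nonneg_left (bracket_pos_mid hζ hζ' hδ.le hδ') h5.le]
    · nlinarith [mul_le_mul_of_nonneg_left (bracket_pos_outer hζ' h3 hδ.le hδ') h5.le]
  · have hz0 : 0 < z := by linarith
    obtain ⟨ζ, rfl⟩ : ∃ ζ, δ = z * ζ := ⟨δ / z, by field_simp⟩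
    have h0 : 0 ≤ ζ := nonneg_of_mul_nonneg_right hδ.le hz0
    have h3 : ζ ≤ 1 / 3 := le_of_mul_le_mul_left (by linarith) hz0
    have h5 : 0 < z ^ 5 := by positivity
    nlinarith [mul_le_mul_of_nonneg_left (bracket_pos_far h0 h3 hz hz') h5.le]

lemma bracket_neg_bound {δ z : ℝ} (hδ : 0 < δ) (hδ' : δ ≤ 2321 / 5000) (hz : 0 ≤ z) (hz' : z ≤ 14143 / 10000) :
    0 < 10 / 3 * δ ^ 3 * (7 / 20 * δ ^ 2) - δ ^ 3 / 3 * z ^ 2 + (113 / 1000 - 59 / 100 * δ ^ 3) * z ^ 5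
      - 7 / 20 * δ ^ 2 * z ^ 3 * (3658 / 10000 - 9 / 5 * δ ^ 3)
      - 14143 / 10000 * (7 / 20 * δ ^ 2) * (534 / 10000 - 1 / 5 * δ ^ 3) * z ^ 4
      - (463 / 10000 - 24 / 100 * δ ^ 3) * z ^ 5 * (3 / 5 * z + 59 / 100) := by
  rcases le_total z (3 * δ) with h | h
  · obtain ⟨ζ, rfl⟩ : ∃ ζ, z = δ * ζ := ⟨z / δ, by field_simp⟩
    have h0 : 0 ≤ ζ := nonneg_of_mul_nonneg_right hz hδ
    have h3 : ζ ≤ 3 := le_of_mul_le_mul_left (by linarith) hδ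
    have h5 : 0 < δ ^ 5 := by positivity
    rcases le_total ζ 1 with hζ | hζ
    · nlinarith [mul_le_mul_of_nonneg_left (bracket_neg_inner h0 hζ hδ.le hδ') h5.le]
    rcases le_total ζ 2 with hζ' | hζ'
    · nlinarith [mul_le_mul_of_nonneg_left (bracket_neg_mid hζ hζ' hδ.le hδ') h5.le]
    · nlinarith [mul_le_mul_of_nonneg_left (bracket_neg_outer hζ' h3 hδ.le hδ') h5.le]
  · have hz0 : 0 < z := by linarith
    obtain ⟨ζ, rfl⟩ : ∃ ζ, δ = z * ζ := ⟨δ / z, by field_simp⟩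
    have h0 : 0 ≤ ζ := nonneg_of_mul_nonneg_right hδ.le hz0
    have h3 : ζ ≤ 1 / 3 := le_of_mul_le_mul_left (by linarith) hz0
    have h5 : 0 < z ^ 5 := by positivity
    nlinarith [mul_le_mul_of_nonneg_left (bracket_neg_far h0 h3 hz hz') h5.le]

lemma dulacM_pos {m δ x y : ℝ} (h1 : 1 / 2 ≤ m) (hδ : 0 < δ) (hm : m = 3 / 5 - δ ^ 3)
    (hx : m * x ^ 4 ≤ 1) (hy : m * y ^ 4 ≤ 1) (hy0 : y ≠ 0) : 0 < dulacM m (7 / 20 * δ ^ 2) x y := by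
  have hδ' : δ ≤ 2321 / 5000 := cube_root_bound hm h1 (by norm_num) (by norm_num)
  have hx := sq_le_of_mul_pow_four_le_one h1 hx
  have hy := sq_le_of_mul_pow_four_le_one h1 hy
  rw [dulacM_eq]
  exact mul_pos (by positivity) (dulac_bracket_pos h1 hδ hm (by positivity) (by positivity) hx (by ring)
    (bracket_pos_bound hδ hδ' (by positivity) hy) (bracket_neg_bound hδ hδ' (by positivity) hy))

lemma dulacM_nonneg {m δ x y : ℝ} (h1 : 1 / 2 ≤ m) (hδ : 0 < δ) (hm : m = 3 / 5 - δ ^ 3)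
    (hx : m * x ^ 4 ≤ 1) (hy : m * y ^ 4 ≤ 1) : 0 ≤ dulacM m (7 / 20 * δ ^ 2) x y := by
  rcases eq_or_ne y 0 with rfl | hy0
  · simp [dulacM_eq]
  · exact (dulacM_pos h1 hδ hm hx hy hy0).le

lemma dulacEuler_neg {m δ x y : ℝ} (h1 : 1 / 2 ≤ m) (hδ : 0 < δ) (hm : m = 3 / 5 - δ ^ 3)
    (hy : m * y ^ 4 ≤ 1) (hV : dulac m (7 / 20 * δ ^ 2) x y ≤ 0) :
    dulacEuler m (7 / 20 * δ ^ 2) x y < 0 := by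
  have hδ' : δ ≤ 2321 / 5000 := cube_root_bound hm h1 (by norm_num) (by norm_num)
  have h2 : m < 3 / 5 := by have := pow_pos hδ 3; linarith
  have hv : 0 < 7 / 20 * δ ^ 2 := by positivity
  have hv' : 7 / 20 * δ ^ 2 ≤ 755 / 10000 := by
    calc 7 / 20 * δ ^ 2 ≤ 7 / 20 * (2321 / 5000) ^ 2 := by gcongr
      _ ≤ _ := by norm_num
  have hv'' : 56 / 100 ≤ m → 7 / 20 * δ ^ 2 ≤ 41 / 1000 := by
    intro h
    have : δ ≤ 3421 / 10000 := cube_root_bound hm h (by norm_num) (by norm_num)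
    calc 7 / 20 * δ ^ 2 ≤ 7 / 20 * (3421 / 10000) ^ 2 := by gcongr
      _ ≤ _ := by norm_num
  have h0 : x ≠ 0 ∨ y ≠ 0 := by
    by_contra! h
    obtain ⟨rfl, rfl⟩ := h
    simp only [dulac, dulacTwo, dulacOne, dulacZero] at hV
    nlinarith
  rcases le_total (x * y) 0 with hw | hw
  · exact dulacEuler_neg_of_xy_nonpos h1 h2 hv hv' (sq_le_of_mul_pow_four_le_one h1 hy) hw h0
  · exact dulacEuler_neg_of_xy_nonneg h1 h2 hv hv' hv'' hy hw h0 hV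

/-- The angular momentum `x · ẏ - y · ẋ` of the vector field. -/
def angular (m x y : ℝ) : ℝ := x * (-x + m * y ^ 5) - y * (y ^ 3 - x ^ 3)

lemma angular_neg_of_pos {m x y : ℝ} (h1 : 1 / 2 ≤ m) (h2 : m < 3 / 5) (hx : 0 < x) (hy : 0 < y)
    (hmx : m * x ^ 4 ≤ 1) (hmy : m * y ^ 4 ≤ 1) (hne : ¬ (x = y ∧ m * x ^ 4 = 1)) : angular m x y < 0 := by
  unfold angular
  rcases lt_trichotomy x y with h | rfl | h
  · rcases le_total y 1 with hy1 | hy1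
    · have a1 : x ^ 3 * y ≤ x ^ 2 * y ^ 2 := by nlinarith [mul_pos (pow_pos hx 2) hy]
      have a2 : x ^ 2 * y ^ 2 ≤ x ^ 2 * 1 := by
        gcongr; exact pow_le_one₀ hy.le hy1
      have a3 : m * x * y ^ 5 ≤ 3 / 5 * 1 * y ^ 4 := by
        calc m * x * y ^ 5 = m * (x * y) * y ^ 4 := by ring
          _ ≤ 3 / 5 * 1 * y ^ 4 := by gcongr; nlinarith
          _ = _ := by ring
      have : 0 < y ^ 4 := by positivity
      linarith
    · have a1 : m * y ^ 4 * (x * y) ≤ 1 * (x * y) := by gcongr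
      have a2 : y ≤ y ^ 3 := le_self_pow₀ hy1 (by norm_num)
      have a3 : 0 < (y - x) * (y * (y ^ 2 + x * y + x ^ 2) - x) := by
        apply mul_pos (by linarith)
        have : 0 < x * y ^ 2 + x ^ 2 * y := by positivity
        linarith
      linarith
  · have : 0 < x ^ 2 * (1 - m * x ^ 4) := by
      apply mul_pos (by positivity)
      have : m * x ^ 4 ≠ 1 := fun h => hne ⟨rfl, h⟩
      have := lt_of_le_of_ne hmx this
      linarith
    linarith
  · have hx2 := sq_le_of_mul_pow_four_le_one h1 hmx
    have a1 : m * x ^ 4 * y ^ 5 ≤ 1 * y ^ 5 := by gcongr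
    have a2 : x ^ 2 * (x * y * (x ^ 3 - y ^ 3)) ≤ 3 / 2 * (x * y * (x ^ 3 - y ^ 3)) := by
      have : y ^ 3 ≤ x ^ 3 := by gcongr
      have : 0 ≤ x ^ 3 - y ^ 3 := by linarith
      gcongr
      linarith
    have a3 : 0 < (x - y) * (x ^ 4 - x ^ 3 * y / 2 - x ^ 2 * y ^ 2 / 2 - x * y ^ 3 / 2 + y ^ 4) := by
      apply mul_pos (by linarith)
      have : 0 < x ^ 2 * y ^ 2 := by positivity
      nlinarith [sq_nonneg (x ^ 2 - y ^ 2), mul_nonneg (mul_pos hx hy).le (sq_nonneg (x - y)), sq_nonneg (x * (x - y)), sq_nonneg (y * (x - y))]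
    have : 0 < x ^ 3 * (y * (y ^ 3 - x ^ 3) - x * (-x + m * y ^ 5)) := by linarith
    have := pos_of_mul_pos_right this (by positivity)
    linarith

lemma angular_neg {m x y : ℝ} (h1 : 1 / 2 ≤ m) (h2 : m < 3 / 5) (hmx : m * x ^ 4 ≤ 1) (hmy : m * y ^ 4 ≤ 1)
    (h0 : ¬ (x = 0 ∧ y = 0)) (hne : ¬ (x = y ∧ m * x ^ 4 = 1)) : angular m x y < 0 := by
  rcases lt_or_ge 0 (x * y) with h | h
  · rcases (mul_pos_iff.1 h) with ⟨hx, hy⟩ | ⟨hx, hy⟩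
    · exact angular_neg_of_pos h1 h2 hx hy hmx hmy hne
    · have := angular_neg_of_pos (x := -x) (y := -y) h1 h2 (by linarith) (by linarith)
        (by rwa [Even.neg_pow (by decide)]) (by rwa [Even.neg_pow (by decide)])
        (by rwa [neg_inj, Even.neg_pow (by decide)])
      unfold angular at *
      nlinarith
  · have a1 : m * y ^ 4 * (x * y) ≤ 0 := mul_nonpos_of_nonneg_of_nonpos (by positivity) h
    have a2 : x ^ 2 * (x * y) ≤ 0 := mul_nonpos_of_nonneg_of_nonpos (by positivity) h
    have a3 : 0 < x ^ 2 + y ^ 4 := by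
      rcases eq_or_ne x 0 with rfl | hx
      · have : y ≠ 0 := fun h => h0 ⟨rfl, h⟩
        positivity
      · positivity
    unfold angular
    linarith

lemma dulac_neg_of_saddle {m δ x : ℝ} (h1 : 1 / 2 ≤ m) (hδ : 0 < δ) (hm : m = 3 / 5 - δ ^ 3)
    (hx : m * x ^ 4 = 1) : dulac m (7 / 20 * δ ^ 2) x x < 0 := by
  have hx0 : x ≠ 0 := by rintro rfl; norm_num at hx
  have h := dulacM_pos h1 hδ hm hx.le hx.le hx0
  have hx2 := sq_le_of_mul_pow_four_le_one h1 hx.le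
  have e : -x + m * x ^ 5 = 0 := by linear_combination x * hx
  have hd : 0 < -3 * x ^ 2 + 5 * m * x ^ 4 := by linarith
  rw [dulacM, sub_self, e] at h
  nlinarith

lemma contDiff_bacciotti (m : ℝ) : ContDiff ℝ 1 (bacciotti m) := by
  unfold bacciotti
  fun_prop

lemma IsSolution.continuous {m : ℝ} {γ : ℝ → ℝ × ℝ} (h : IsSolution m γ) : Continuous γ :=
  continuous_iff_continuousAt.2 fun t => (h t).continuousAt

lemma IsSolution.fst {m : ℝ} {γ : ℝ → ℝ × ℝ} (h : IsSolution m γ) (t : ℝ) :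
    HasDerivAt (fun t => (γ t).1) ((γ t).2 ^ 3 - (γ t).1 ^ 3) t :=
  (hasFDerivAt_fst.comp_hasDerivAt t (h t) :)

lemma IsSolution.snd {m : ℝ} {γ : ℝ → ℝ × ℝ} (h : IsSolution m γ) (t : ℝ) :
    HasDerivAt (fun t => (γ t).2) (-(γ t).1 + m * (γ t).2 ^ 5) t :=
  (hasFDerivAt_snd.comp_hasDerivAt t (h t) :)

lemma IsSolution.neg {m : ℝ} {γ : ℝ → ℝ × ℝ} (h : IsSolution m γ) : IsSolution m (fun t => -γ t) := by
  intro t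
  have e : bacciotti m (-γ t) = -bacciotti m (γ t) := by ext <;> simp [bacciotti] <;> ring
  rw [e]
  exact (h t).neg

lemma IsSolution.comp_add_const {m : ℝ} {γ : ℝ → ℝ × ℝ} (h : IsSolution m γ) (a : ℝ) :
    IsSolution m (fun t => γ (t + a)) := fun t => (h (t + a)).comp_add_const t a

lemma isSolution_const {m : ℝ} {p : ℝ × ℝ} (hp : bacciotti m p = 0) : IsSolution m (fun _ => p) := by
  intro t
  rw [hp]
  exact hasDerivAt_const t p

lemma IsSolution.unique_of_bounded {m R : ℝ} {γ₁ γ₂ : ℝ → ℝ × ℝ} (h₁ : IsSolution m γ₁)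
    (h₂ : IsSolution m γ₂) (hR₁ : ∀ t, ‖γ₁ t‖ ≤ R) (hR₂ : ∀ t, ‖γ₂ t‖ ≤ R) {t₀ : ℝ}
    (h : γ₁ t₀ = γ₂ t₀) : γ₁ = γ₂ := by
  obtain ⟨K, hK⟩ := (contDiff_bacciotti m).contDiffOn.exists_lipschitzOnWith one_ne_zero
    (convex_closedBall (0 : ℝ × ℝ) R) (isCompact_closedBall 0 R)
  exact ODE_solution_unique_univ (v := fun _ => bacciotti m) (s := fun _ => Metric.closedBall 0 R)
    (fun _ => hK) (fun t => ⟨h₁ t, by simpa using hR₁ t⟩) (fun t => ⟨h₂ t, by simpa using hR₂ t⟩) h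

/-- The square bounded by the coordinates of the saddle points. -/
def InSquare (m : ℝ) (p : ℝ × ℝ) : Prop := m * p.1 ^ 4 ≤ 1 ∧ m * p.2 ^ 4 ≤ 1

lemma InSquare.norm_le {m : ℝ} {p : ℝ × ℝ} (hm : 1 / 2 ≤ m) (h : InSquare m p) : ‖p‖ ≤ 2 := by
  have key : ∀ x : ℝ, m * x ^ 4 ≤ 1 → ‖x‖ ≤ 2 := fun x hx => by
    have := sq_le_of_mul_pow_four_le_one hm hx
    rw [Real.norm_eq_abs]
    exact abs_le_of_sq_le_sq (by linarith) (by norm_num)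
  exact norm_prod_le_iff.2 ⟨key _ h.1, key _ h.2⟩

/-- Every coordinate function exceeding its values at the saddle points somewhere on `γ`
has a maximum on `γ`. -/
def AttainsMax (m : ℝ) (γ : ℝ → ℝ × ℝ) : Prop :=
  ∀ L : ℝ × ℝ → ℝ, Continuous L → ∀ t₁, L (pPlus m) < L (γ t₁) → L (pMinus m) < L (γ t₁) →
    ∃ t₀, ∀ t, L (γ t) ≤ L (γ t₀)

lemma neg_pPlus (m : ℝ) : -pPlus m = pMinus m := rfl

lemma neg_pMinus (m : ℝ) : -pMinus m = pPlus m := by rw [← neg_pPlus, neg_neg]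

lemma AttainsMax.neg {m : ℝ} {γ : ℝ → ℝ × ℝ} (h : AttainsMax m γ) : AttainsMax m (fun t => -γ t) := by
  intro L hL t₁ h1 h2
  refine h (fun p => L (-p)) (by fun_prop) t₁ ?_ ?_
  · rwa [neg_pPlus]
  · rwa [neg_pMinus]

lemma IsPeriodicOrbit.attainsMax {m T : ℝ} {γ : ℝ → ℝ × ℝ} (h : IsPeriodicOrbit m γ T) :
    AttainsMax m γ := by
  intro L hL t₁ _ _
  obtain ⟨hs, -, hT, hp⟩ := h
  obtain ⟨t₀, -, ht₀⟩ := isCompact_Icc.exists_isMaxOn (nonempty_Icc.2 hT.le)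
    (hL.comp hs.continuous).continuousOn
  refine ⟨t₀, fun t => ?_⟩
  obtain ⟨s, hs, hst⟩ := hp.exists_mem_Ico₀ hT t
  rw [hst]
  exact ht₀ (Ico_subset_Icc_self hs)

lemma IsHeteroclinic.attainsMax {m : ℝ} {γ : ℝ → ℝ × ℝ} (h : IsHeteroclinic m γ) :
    AttainsMax m γ := by
  intro L hL t₁ h1 h2
  obtain ⟨hs, hbot, htop⟩ := h
  refine (hL.comp hs.continuous).exists_forall_ge' t₁ ?_
  rw [cocompact_eq_atBot_atTop, eventually_sup]
  exact ⟨(((hL.tendsto _).comp hbot).eventually (gt_mem_nhds h2)).mono fun _ h => h.le,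
    (((hL.tendsto _).comp htop).eventually (gt_mem_nhds h1)).mono fun _ h => h.le⟩

lemma saddle_coord {m : ℝ} (hm : 0 < m) : 0 < m ^ (-(1 : ℝ) / 4) ∧ m * (m ^ (-(1 : ℝ) / 4)) ^ 4 = 1 := by
  refine ⟨by positivity, ?_⟩
  rw [← Real.rpow_natCast, ← Real.rpow_mul hm.le]
  norm_num [Real.rpow_neg_one, hm.ne']

lemma not_isLocalMax_of_second_deriv_pos {f f' : ℝ → ℝ} {f'' t₀ : ℝ} (hf : ∀ t, HasDerivAt f (f' t) t)
    (hf' : HasDerivAt f' f'' t₀) (h0 : 0 < f'') : ¬ IsLocalMax f t₀ := by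
  intro hmax
  have e : deriv f = f' := funext fun t => (hf t).deriv
  have hmin : IsLocalMin f t₀ := by
    apply isLocalMin_of_deriv_deriv_pos _ hmax.deriv_eq_zero (hf t₀).continuousAt
    rwa [e, hf'.deriv]
  have hc : f =ᶠ[nhds t₀] fun _ => f t₀ := by
    filter_upwards [hmax, hmin] with t h1 h2
    exact le_antisymm h1 h2
  have := hc.deriv.deriv_eq
  simp only [e, hf'.deriv, deriv_const', deriv_const] at this
  exact h0.ne' this

lemma snd_le_of_attainsMax {m : ℝ} (hm : 0 < m) {γ : ℝ → ℝ × ℝ} (hs : IsSolution m γ)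
    (hγ : AttainsMax m γ) (t : ℝ) : (γ t).2 ≤ m ^ (-(1 : ℝ) / 4) := by
  obtain ⟨hc, hc4⟩ := saddle_coord hm
  by_contra! h
  obtain ⟨t₀, ht₀⟩ := hγ Prod.snd continuous_snd t h (by simp only [pMinus]; linarith)
  have hy : m ^ (-(1 : ℝ) / 4) < (γ t₀).2 := h.trans_le (ht₀ t)
  have hmax : IsLocalMax (fun t => (γ t).2) t₀ := Eventually.of_forall ht₀
  have hx := hmax.hasDerivAt_eq_zero (hs.snd t₀)
  have hmy : 1 < m * (γ t₀).2 ^ 4 := by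
    rw [← hc4]; gcongr
  have hxy : (γ t₀).2 < (γ t₀).1 := by nlinarith
  refine not_isLocalMax_of_second_deriv_pos hs.snd
    ((hs.fst t₀).neg.add (((hs.snd t₀).pow 5).const_mul m)) ?_ hmax
  rw [hx]
  have : (γ t₀).2 ^ 3 < (γ t₀).1 ^ 3 := by gcongr; exact (hc.trans hy).le
  simp only [mul_zero, add_zero]
  linarith

lemma fst_le_of_attainsMax {m : ℝ} (hm : 0 < m) {γ : ℝ → ℝ × ℝ} (hs : IsSolution m γ)
    (hγ : AttainsMax m γ) (t : ℝ) : (γ t).1 ≤ m ^ (-(1 : ℝ) / 4) := by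
  obtain ⟨hc, hc4⟩ := saddle_coord hm
  by_contra! h
  obtain ⟨t₀, ht₀⟩ := hγ Prod.fst continuous_fst t h (by simp only [pMinus]; linarith)
  have hmax : IsLocalMax (fun t => (γ t).1) t₀ := Eventually.of_forall ht₀
  have hx := hmax.hasDerivAt_eq_zero (hs.fst t₀)
  have hxy : (γ t₀).2 = (γ t₀).1 :=
    (Odd.strictMono_pow (by decide : Odd 3)).injective (sub_eq_zero.1 hx)
  have := snd_le_of_attainsMax hm hs hγ t₀
  rw [hxy] at this
  exact absurd (ht₀ t) (by linarith)

lemma AttainsMax.inSquare {m : ℝ} (hm : 0 < m) {γ : ℝ → ℝ × ℝ} (hs : IsSolution m γ)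
    (hγ : AttainsMax m γ) (t : ℝ) : InSquare m (γ t) := by
  obtain ⟨hc, hc4⟩ := saddle_coord hm
  have h1 := fst_le_of_attainsMax hm hs hγ t
  have h2 := snd_le_of_attainsMax hm hs hγ t
  have h3 := fst_le_of_attainsMax hm hs.neg hγ.neg t
  have h4 := snd_le_of_attainsMax hm hs.neg hγ.neg t
  rw [Prod.fst_neg] at h3
  rw [Prod.snd_neg] at h4
  have key : ∀ x : ℝ, x ≤ m ^ (-(1 : ℝ) / 4) → -x ≤ m ^ (-(1 : ℝ) / 4) → m * x ^ 4 ≤ 1 := by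
    intro x hx hx'
    rw [← hc4, ← Even.pow_abs (by decide : Even 4)]
    gcongr
    exact abs_le'.2 ⟨hx, hx'⟩
  exact ⟨key _ h1 h3, key _ h2 h4⟩

/-- A solution that stays in the square and always turns clockwise. -/
structure IsRotating (m : ℝ) (γ : ℝ → ℝ × ℝ) : Prop where
  isSolution : IsSolution m γ
  inSquare : ∀ t, InSquare m (γ t)
  angular_neg : ∀ t, angular m (γ t).1 (γ t).2 < 0

lemma isRotating_of_nonconstant {m : ℝ} (h1 : 1 / 2 ≤ m) (h2 : m < 3 / 5) {γ : ℝ → ℝ × ℝ}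
    (hs : IsSolution m γ) (hγ : AttainsMax m γ) (hne : ¬ ∃ c : ℝ × ℝ, ∀ t, γ t = c) : IsRotating m γ := by
  have hsq := hγ.inSquare (by linarith) hs
  have hstat : ∀ t, bacciotti m (γ t) ≠ 0 := by
    intro t h
    refine hne ⟨γ t, fun s => ?_⟩
    exact congrFun (hs.unique_of_bounded (isSolution_const h) (fun s => (hsq s).norm_le h1)
      (fun _ => (hsq t).norm_le h1) rfl) s
  refine ⟨hs, hsq, fun t => angular_neg h1 h2 (hsq t).1 (hsq t).2 ?_ ?_⟩
  · rintro ⟨hx, hy⟩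
    exact hstat t (by simp [bacciotti, hx, hy])
  · rintro ⟨hxy, hx⟩
    refine hstat t (Prod.ext ?_ ?_)
    · simp [bacciotti, hxy]
    · simp only [bacciotti, ← hxy, Prod.snd_zero]
      linear_combination (γ t).1 * hx

lemma IsPeriodicOrbit.isRotating {m T : ℝ} (h1 : 1 / 2 ≤ m) (h2 : m < 3 / 5) {γ : ℝ → ℝ × ℝ}
    (h : IsPeriodicOrbit m γ T) : IsRotating m γ :=
  isRotating_of_nonconstant h1 h2 h.1 h.attainsMax h.2.1

lemma IsHeteroclinic.not_constant {m : ℝ} (hm : 0 < m) {γ : ℝ → ℝ × ℝ} (h : IsHeteroclinic m γ) :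
    ¬ ∃ c : ℝ × ℝ, ∀ t, γ t = c := by
  rintro ⟨c, hc⟩
  obtain rfl : γ = fun _ => c := funext hc
  have e1 := tendsto_nhds_unique h.2.1 tendsto_const_nhds
  have e2 := tendsto_nhds_unique h.2.2 tendsto_const_nhds
  have := congrArg Prod.fst (e1.trans e2.symm)
  have := (saddle_coord hm).1
  simp only [pMinus, pPlus] at *
  linarith

lemma IsHeteroclinic.isRotating {m : ℝ} (h1 : 1 / 2 ≤ m) (h2 : m < 3 / 5) {γ : ℝ → ℝ × ℝ}
    (h : IsHeteroclinic m γ) : IsRotating m γ :=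
  isRotating_of_nonconstant h1 h2 h.1 h.attainsMax (h.not_constant (by linarith))

/-- `Wx` and `Wy` are continuous partial derivatives of `W`. -/
structure HasPartials (W Wx Wy : ℝ → ℝ → ℝ) : Prop where
  comp : ∀ {u w : ℝ → ℝ} {u' w' t : ℝ}, HasDerivAt u u' t → HasDerivAt w w' t →
    HasDerivAt (fun t => W (u t) (w t)) (Wx (u t) (w t) * u' + Wy (u t) (w t) * w') t
  continuous : Continuous fun p : ℝ × ℝ => W p.1 p.2
  continuous_fst : Continuous fun p : ℝ × ℝ => Wx p.1 p.2
  continuous_snd : Continuous fun p : ℝ × ℝ => Wy p.1 p.2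

lemma HasPartials.neg {W Wx Wy : ℝ → ℝ → ℝ} (h : HasPartials W Wx Wy) :
    HasPartials (fun x y => -W x y) (fun x y => -Wx x y) (fun x y => -Wy x y) where
  comp hu hw := (h.comp hu hw).fun_neg.congr_deriv (by ring)
  continuous := h.continuous.neg
  continuous_fst := h.continuous_fst.neg
  continuous_snd := h.continuous_snd.neg

/-- The numerator of the divergence of the rescaled field `|W| ^ (-3 / 2) X_m`. -/
def scaledDiv (m : ℝ) (W Wx Wy : ℝ → ℝ → ℝ) (x y : ℝ) : ℝ :=
  Wx x y * (y ^ 3 - x ^ 3) + Wy x y * (-x + m * y ^ 5) - 2 / 3 * W x y * (-3 * x ^ 2 + 5 * m * y ^ 4)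

/-- The properties of the Dulac function used in the comparison of orbits. -/
structure IsDulac (m : ℝ) (V Vx Vy : ℝ → ℝ → ℝ) : Prop extends HasPartials V Vx Vy where
  even : ∀ x y, V (-x) (-y) = V x y
  scaledDiv_nonneg : ∀ {x y}, InSquare m (x, y) → 0 ≤ scaledDiv m V Vx Vy x y
  scaledDiv_pos : ∀ {x y}, InSquare m (x, y) → y ≠ 0 → 0 < scaledDiv m V Vx Vy x y
  euler_neg : ∀ {x y}, InSquare m (x, y) → V x y ≤ 0 → x * Vx x y + y * Vy x y < 0
  center_pos : 0 < V 0 0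
  saddle_neg : ∀ {c}, m * c ^ 4 = 1 → V c c < 0

lemma dulac_comp (m v : ℝ) {u w : ℝ → ℝ} {u' w' t : ℝ} (hu : HasDerivAt u u' t) (hw : HasDerivAt w w' t) :
    HasDerivAt (fun t => dulac m v (u t) (w t))
      (dulacX m v (u t) (w t) * u' + dulacY m v (u t) (w t) * w') t := by
  have h2 := hw.fun_pow 2
  have h4 := hw.fun_pow 4
  have h5 := hw.fun_pow 5
  have h6 := hw.fun_pow 6
  have h7 := hw.fun_pow 7
  have h8 := hw.fun_pow 8
  have h10 := hw.fun_pow 10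
  have h11 := hw.fun_pow 11
  have h12 := hw.fun_pow 12
  have k2 := ((((h2.const_mul v).const_add (-1)).fun_add (h6.const_mul (coefA m))).fun_add
    (h8.const_mul (v * coefB m))).fun_add (h12.const_mul (coefC m))
  have k1 := (((hw.const_mul (2 * v)).fun_add (h5.const_mul (6 * coefA m))).fun_add
    (h7.const_mul (8 * v * coefB m))).fun_add (h11.const_mul (12 * coefC m))
  have k0 := (((h4.div_const 2).const_sub v).fun_add (h6.const_mul (v * (3 - 7 * m) / 9))).fun_add
    (h10.const_mul (coefA m * (1 + 5 * m) / 5))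
  refine (((k2.fun_mul (hu.fun_pow 2)).fun_add (k1.fun_mul hu)).fun_add k0).congr_deriv ?_
  simp only [dulacX, dulacY, dulacTwo, dulacOne]
  norm_num
  ring

lemma isDulac_dulac {m δ : ℝ} (h1 : 1 / 2 ≤ m) (hδ : 0 < δ) (hm : m = 3 / 5 - δ ^ 3) :
    IsDulac m (dulac m (7 / 20 * δ ^ 2)) (dulacX m (7 / 20 * δ ^ 2)) (dulacY m (7 / 20 * δ ^ 2)) where
  comp := dulac_comp m _
  continuous := by unfold dulac dulacTwo dulacOne dulacZero; fun_prop
  continuous_fst := by unfold dulacX dulacTwo dulacOne; fun_prop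
  continuous_snd := by unfold dulacY; fun_prop
  even x y := by simp only [dulac, dulacTwo, dulacOne, dulacZero]; ring
  scaledDiv_nonneg h := dulacM_nonneg h1 hδ hm h.1 h.2
  scaledDiv_pos h hy := dulacM_pos h1 hδ hm h.1 h.2 hy
  euler_neg h hV := dulacEuler_neg h1 hδ hm h.2 hV
  center_pos := by simp only [dulac, dulacTwo, dulacOne, dulacZero]; norm_num; positivity
  saddle_neg h := dulac_neg_of_saddle h1 hδ hm h

lemma InSquare.smul {m lam mu x y : ℝ} (hm : 0 < m) (h : InSquare m (lam * x, lam * y))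
    (hmu : 0 ≤ mu) (hle : mu ≤ lam) : InSquare m (mu * x, mu * y) := by
  have key : ∀ x : ℝ, m * (lam * x) ^ 4 ≤ 1 → m * (mu * x) ^ 4 ≤ 1 := fun x hx => by
    refine le_trans ?_ hx
    rw [mul_pow, mul_pow]
    gcongr
  exact ⟨key _ h.1, key _ h.2⟩

lemma IsDulac.neg_of_neg {m : ℝ} {V Vx Vy : ℝ → ℝ → ℝ} (hm : 0 < m) (hV : IsDulac m V Vx Vy)
    {x y a b : ℝ} (ha : 0 < a) (hab : a ≤ b) (hb : InSquare m (b * x, b * y))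
    (h : V (a * x) (a * y) < 0) : V (b * x) (b * y) < 0 := by
  have hd : ∀ r, HasDerivAt (fun r => V (r * x) (r * y)) (Vx (r * x) (r * y) * x + Vy (r * x) (r * y) * y) r :=
    fun r => hV.comp (hasDerivAt_mul_const x) (hasDerivAt_mul_const y)
  refine lt_of_le_of_lt (image_le_of_deriv_right_lt_deriv_boundary (a := a) (b := b)
    (f := fun r => V (r * x) (r * y)) (B := fun _ => V (a * x) (a * y)) (B' := fun _ => 0)
    (fun r _ => (hd r).continuousAt.continuousWithinAt) (fun r _ => (hd r).hasDerivWithinAt) le_rfl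
    (fun r => hasDerivAt_const _ _) (fun r hr he => ?_) (right_mem_Icc.2 hab)) h
  have hr0 : 0 < r := ha.trans_le hr.1
  have := hV.euler_neg (hb.smul hm hr0.le hr.2.le) (he.trans_lt h).le
  by_contra! h0
  nlinarith

lemma IsDulac.pos_of_pos {m : ℝ} {V Vx Vy : ℝ → ℝ → ℝ} (hm : 0 < m) (hV : IsDulac m V Vx Vy)
    {x y a : ℝ} (ha : 0 ≤ a) (ha' : a ≤ 1) (hs : InSquare m (x, y))
    (h : 0 < V x y) : 0 < V (a * x) (a * y) := by
  have hs1 : InSquare m (1 * x, 1 * y) := by simpa using hs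
  rcases ha.eq_or_lt with rfl | ha
  · simpa using hV.center_pos
  by_contra! hle
  have hd : HasDerivAt (fun r => V (r * x) (r * y)) (Vx (a * x) (a * y) * x + Vy (a * x) (a * y) * y) a :=
    hV.comp (hasDerivAt_mul_const x) (hasDerivAt_mul_const y)
  have hE := hV.euler_neg (hs1.smul hm ha.le ha') hle
  rcases hle.eq_or_lt with h0 | h0
  · have ha1 : a < 1 := lt_of_le_of_ne ha' (by rintro rfl; simp at h0; exact h.ne' h0)
    have hneg : Vx (a * x) (a * y) * x + Vy (a * x) (a * y) * y < 0 := by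
      by_contra! hc
      nlinarith
    have ev : ∀ᶠ r in nhdsWithin a (Ioi a), V (r * x) (r * y) < 0 := by
      have := (hasDerivWithinAt_iff_tendsto_slope' (by simp)).1 (hd.hasDerivWithinAt (s := Ioi a))
      filter_upwards [this.eventually (gt_mem_nhds hneg), self_mem_nhdsWithin] with r hr hra
      rw [slope_def_field, div_neg_iff] at hr
      simp only [h0] at hr
      have : 0 < r - a := sub_pos.2 hra
      rcases hr with hr | hr <;> linarith [hr.1, hr.2]
    obtain ⟨r, hr, hr'⟩ := (ev.and (Ioo_mem_nhdsGT ha1)).exists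
    have := hV.neg_of_neg hm (ha.trans hr'.1) hr'.2.le hs1 hr
    simp only [one_mul] at this
    exact absurd h this.not_gt
  · have := hV.neg_of_neg hm ha ha' hs1 h0
    simp only [one_mul] at this
    exact absurd h this.not_gt

lemma IsRotating.neg {m : ℝ} {γ : ℝ → ℝ × ℝ} (h : IsRotating m γ) : IsRotating m (fun t => -γ t) where
  isSolution := h.isSolution.neg
  inSquare t := by simpa [InSquare, Even.neg_pow (by decide : Even 4)] using h.inSquare t
  angular_neg t := by
    refine lt_of_eq_of_lt ?_ (h.angular_neg t)
    simp only [angular, Prod.fst_neg, Prod.snd_neg]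
    ring

lemma IsRotating.exists_snd_ne_zero {m : ℝ} {γ : ℝ → ℝ × ℝ} (h : IsRotating m γ) {a b : ℝ} (hab : a < b) :
    ∃ t ∈ Ioo a b, (γ t).2 ≠ 0 := by
  by_contra! hc
  obtain ⟨t, ht⟩ := nonempty_Ioo.2 hab
  have e : (fun t => (γ t).2) =ᶠ[nhds t] fun _ => 0 := by
    filter_upwards [isOpen_Ioo.mem_nhds ht] with s hs using hc s hs
  have h0 := (e.hasDerivAt_iff.1 (h.isSolution.snd t)).unique (hasDerivAt_const t 0)
  have hy := hc t ht
  have hx : (γ t).1 = 0 := by simpa [hy] using h0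
  have := h.angular_neg t
  simp [angular, hx, hy] at this

lemma IsRotating.strictMono {m : ℝ} {γ : ℝ → ℝ × ℝ} (h : IsRotating m γ) {F F' : ℝ → ℝ}
    (hF : ∀ t, HasDerivAt F (F' t) t) (h0 : ∀ t, 0 ≤ F' t) (hpos : ∀ t, (γ t).2 ≠ 0 → 0 < F' t) :
    StrictMono F := by
  have hmono : Monotone F := monotone_of_hasDerivAt_nonneg hF h0
  intro a b hab
  refine (hmono hab.le).lt_of_ne fun he => ?_
  obtain ⟨t, ht, hy⟩ := h.exists_snd_ne_zero hab
  have e : F =ᶠ[nhds t] fun _ => F a := by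
    filter_upwards [isOpen_Ioo.mem_nhds ht] with s hs
    exact le_antisymm (he ▸ hmono hs.2.le) (hmono hs.1.le)
  exact (hpos t hy).ne' ((e.hasDerivAt_iff.1 (hF t)).unique (hasDerivAt_const t _))

/-- The Dulac function along a curve, normalized by the integrated divergence. -/
def normalized (m : ℝ) (V : ℝ → ℝ → ℝ) (γ : ℝ → ℝ × ℝ) (t : ℝ) : ℝ :=
  V (γ t).1 (γ t).2 * Real.exp (-(2 / 3 * ∫ s in (0 : ℝ)..t, divBacciotti m (γ s)))

lemma IsRotating.strictMono_normalized {m : ℝ} {V Vx Vy : ℝ → ℝ → ℝ} (hV : IsDulac m V Vx Vy)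
    {γ : ℝ → ℝ × ℝ} (h : IsRotating m γ) : StrictMono (normalized m V γ) := by
  have hc := h.isSolution.continuous
  have hcd : Continuous fun t => divBacciotti m (γ t) := by unfold divBacciotti; fun_prop
  have hI : ∀ t, HasDerivAt (fun t => ∫ s in (0 : ℝ)..t, divBacciotti m (γ s)) (divBacciotti m (γ t)) t :=
    fun t => intervalIntegral.integral_hasDerivAt_right (hcd.intervalIntegrable _ _)
      (hcd.stronglyMeasurableAtFilter _ _) hcd.continuousAt
  have hd : ∀ t, HasDerivAt (normalized m V γ) (scaledDiv m V Vx Vy (γ t).1 (γ t).2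
      * Real.exp (-(2 / 3 * ∫ s in (0 : ℝ)..t, divBacciotti m (γ s)))) t := fun t =>
    ((hV.comp (h.isSolution.fst t) (h.isSolution.snd t)).fun_mul
      ((hI t).const_mul (2 / 3)).fun_neg.exp).congr_deriv (by simp only [scaledDiv, divBacciotti]; ring)
  exact h.strictMono hd (fun t => mul_nonneg (hV.scaledDiv_nonneg (h.inSquare t)) (Real.exp_pos _).le)
    fun t ht => mul_pos (hV.scaledDiv_pos (h.inSquare t) ht) (Real.exp_pos _)

lemma IsRotating.dulac_pos_of_lt {m : ℝ} {V Vx Vy : ℝ → ℝ → ℝ} (hV : IsDulac m V Vx Vy)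
    {γ : ℝ → ℝ × ℝ} (h : IsRotating m γ) {t₀ t : ℝ} (ht : t₀ < t) (h0 : 0 ≤ V (γ t₀).1 (γ t₀).2) :
    0 < V (γ t).1 (γ t).2 := by
  have := (h.strictMono_normalized hV) ht
  have h1 : 0 ≤ normalized m V γ t₀ := mul_nonneg h0 (Real.exp_pos _).le
  exact pos_of_mul_pos_left (h1.trans_lt this) (Real.exp_pos _).le

lemma IsPeriodicOrbit.dulac_sign {m T : ℝ} {V Vx Vy : ℝ → ℝ → ℝ} (hV : IsDulac m V Vx Vy)
    {γ : ℝ → ℝ × ℝ} (hp : IsPeriodicOrbit m γ T) (h : IsRotating m γ) :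
    (∀ t, V (γ t).1 (γ t).2 < 0) ∨ ∀ t, 0 < V (γ t).1 (γ t).2 := by
  by_cases hn : ∃ t₀, 0 ≤ V (γ t₀).1 (γ t₀).2
  · obtain ⟨t₀, h0⟩ := hn
    refine Or.inr fun t => ?_
    obtain ⟨s, hs, e⟩ := hp.2.2.2.exists_mem_Ioc hp.2.2.1 t t₀
    rw [e]
    exact h.dulac_pos_of_lt hV hs.1 h0
  · exact Or.inl fun t => not_le.1 fun ht => hn ⟨t, ht⟩

lemma IsPeriodicOrbit.integral_div_pos {m T : ℝ} {V Vx Vy : ℝ → ℝ → ℝ} (hV : IsDulac m V Vx Vy)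
    {γ : ℝ → ℝ × ℝ} (hp : IsPeriodicOrbit m γ T) (h : IsRotating m γ)
    (hneg : ∀ t, V (γ t).1 (γ t).2 < 0) : 0 < ∫ t in (0 : ℝ)..T, divBacciotti m (γ t) := by
  have hlt := (h.strictMono_normalized hV) hp.2.2.1
  have hper : γ T = γ 0 := by simpa using hp.2.2.2 0
  simp only [normalized, hper, intervalIntegral.integral_same, mul_zero, neg_zero, Real.exp_zero, mul_one] at hlt
  by_contra! hle
  have h1 : 1 ≤ Real.exp (-(2 / 3 * ∫ s in (0 : ℝ)..T, divBacciotti m (γ s))) :=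
    Real.one_le_exp (by linarith)
  nlinarith [hneg 0]

lemma IsHeteroclinic.dulac_neg {m : ℝ} (hm : 0 < m) {V Vx Vy : ℝ → ℝ → ℝ} (hV : IsDulac m V Vx Vy)
    {γ : ℝ → ℝ × ℝ} (hh : IsHeteroclinic m γ) (h : IsRotating m γ) (t : ℝ) :
    V (γ t).1 (γ t).2 < 0 := by
  by_contra! h0
  have hlim := (hV.continuous.tendsto (pPlus m)).comp hh.2.2
  have hn := hlim.eventually (gt_mem_nhds (hV.saddle_neg (saddle_coord hm).2))
  obtain ⟨s, hs, hs'⟩ := (hn.and (eventually_gt_atTop t)).exists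
  exact absurd (h.dulac_pos_of_lt hV hs' h0) hs.not_gt

lemma hasDerivAt_integral_unit {F F' : ℝ → ℝ → ℝ}
    (hF : ∀ t, ∀ s ∈ Icc (0 : ℝ) 1, HasDerivAt (fun t => F t s) (F' t s) t)
    (hFc : ∀ t, ContinuousOn (F t) (Icc 0 1))
    (hF'c : ContinuousOn (fun z : ℝ × ℝ => F' z.1 z.2) (univ ×ˢ Icc 0 1)) (t : ℝ) :
    HasDerivAt (fun t => ∫ s in (0 : ℝ)..1, F t s) (∫ s in (0 : ℝ)..1, F' t s) t := by
  have hI : Set.uIcc (0 : ℝ) 1 = Icc 0 1 := uIcc_of_le zero_le_one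
  have hsub : Set.uIoc (0 : ℝ) 1 ⊆ Icc 0 1 := by rw [uIoc_of_le zero_le_one]; exact Ioc_subset_Icc_self
  obtain ⟨C, hC⟩ := ((isCompact_closedBall t 1).prod (isCompact_Icc (a := (0 : ℝ)) (b := 1))).exists_bound_of_continuousOn
    (hF'c.mono (prod_mono (subset_univ _) subset_rfl))
  have hint : ∀ {f : ℝ → ℝ}, ContinuousOn f (Icc 0 1) → IntervalIntegrable f MeasureTheory.volume 0 1 :=
    fun h => ContinuousOn.intervalIntegrable (by rwa [hI])
  have hF't : ContinuousOn (F' t) (Icc 0 1) :=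
    hF'c.comp (Continuous.prodMk_right t).continuousOn fun s hs => ⟨mem_univ _, hs⟩
  refine (intervalIntegral.hasDerivAt_integral_of_dominated_loc_of_deriv_le (bound := fun _ => C)
    (Metric.closedBall_mem_nhds t one_pos) (Eventually.of_forall fun t => ?_) (hint (hFc t)) ?_
    (Eventually.of_forall fun s hs r hr => hC (r, s) ⟨hr, hsub hs⟩) intervalIntegrable_const
    (Eventually.of_forall fun s hs r _ => hF r s (hsub hs))).2
  · rw [uIoc_of_le zero_le_one]
    exact (hint (hFc t)).1.aestronglyMeasurable
  · rw [uIoc_of_le zero_le_one]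
    exact (hint hF't).1.aestronglyMeasurable

/-- The density of the area between `lam • (x, y)` and `(x, y)` swept by the rescaled field. -/
def areaDensity (m : ℝ) (W : ℝ → ℝ → ℝ) (lam x y s : ℝ) : ℝ :=
  (1 - lam) * W ((lam + (1 - lam) * s) * x) ((lam + (1 - lam) * s) * y) ^ (-(3 / 2) : ℝ)
    * ((((lam + (1 - lam) * s) * y) ^ 3 - ((lam + (1 - lam) * s) * x) ^ 3) * y
      - (-((lam + (1 - lam) * s) * x) + m * ((lam + (1 - lam) * s) * y) ^ 5) * x)

/-- The flux of the field `W ^ (-3 / 2) X_m` through the segment from `lam • (x, y)` to `(x, y)`. -/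
def flux (m : ℝ) (W : ℝ → ℝ → ℝ) (lam x y : ℝ) : ℝ := ∫ s in (0 : ℝ)..1, areaDensity m W lam x y s

/-- The radial average that governs the rate of change of `flux`. -/
def fluxRate (m : ℝ) (W Wx Wy : ℝ → ℝ → ℝ) (lam x y : ℝ) : ℝ :=
  ∫ s in (0 : ℝ)..1, W ((lam + (1 - lam) * s) * x) ((lam + (1 - lam) * s) * y) ^ (-(5 / 2) : ℝ)
    * scaledDiv m W Wx Wy ((lam + (1 - lam) * s) * x) ((lam + (1 - lam) * s) * y) * (lam + (1 - lam) * s)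

lemma rpow_neg_three_halves {w : ℝ} (hw : 0 < w) : w ^ (-(3 / 2) : ℝ) = w * w ^ (-(5 / 2) : ℝ) := by
  rw [← Real.rpow_one_add' hw.le (by norm_num)]
  norm_num

lemma HasPartials.hasDerivAt_weight {W Wx Wy : ℝ → ℝ → ℝ} (hW : HasPartials W Wx Wy) {u w : ℝ → ℝ}
    {u' w' t : ℝ} (hu : HasDerivAt u u' t) (hw : HasDerivAt w w' t) (hpos : 0 < W (u t) (w t)) :
    HasDerivAt (fun t => W (u t) (w t) ^ (-(3 / 2) : ℝ))
      (-(3 / 2) * W (u t) (w t) ^ (-(5 / 2) : ℝ) * (Wx (u t) (w t) * u' + Wy (u t) (w t) * w')) t := by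
  have := (hW.comp hu hw).rpow_const (p := -(3 / 2)) (Or.inl hpos.ne')
  refine this.congr_deriv ?_
  norm_num
  ring

lemma HasPartials.hasDerivAt_flux {m : ℝ} {W Wx Wy : ℝ → ℝ → ℝ} (hW : HasPartials W Wx Wy)
    {γ : ℝ → ℝ × ℝ} (hγ : IsSolution m γ) {lam lam' : ℝ → ℝ} (hlam : ∀ t, HasDerivAt lam (lam' t) t)
    (hlam' : Continuous lam')
    (hpar : ∀ t, ((lam t * (γ t).2) ^ 3 - (lam t * (γ t).1) ^ 3)
        * (lam' t * (γ t).2 + lam t * (-(γ t).1 + m * (γ t).2 ^ 5))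
      = (-(lam t * (γ t).1) + m * (lam t * (γ t).2) ^ 5)
        * (lam' t * (γ t).1 + lam t * ((γ t).2 ^ 3 - (γ t).1 ^ 3)))
    (hpos : ∀ t, ∀ s ∈ Icc (0 : ℝ) 1,
      0 < W ((lam t + (1 - lam t) * s) * (γ t).1) ((lam t + (1 - lam t) * s) * (γ t).2)) (t : ℝ) :
    HasDerivAt (fun t => flux m W (lam t) (γ t).1 (γ t).2)
      (3 / 2 * (1 - lam t) * angular m (γ t).1 (γ t).2 * fluxRate m W Wx Wy (lam t) (γ t).1 (γ t).2) t := by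
  set x : ℝ → ℝ := fun t => (γ t).1 with hx
  set y : ℝ → ℝ := fun t => (γ t).2 with hy
  have hdx : ∀ t, HasDerivAt x (y t ^ 3 - x t ^ 3) t := hγ.fst
  have hdy : ∀ t, HasDerivAt y (-x t + m * y t ^ 5) t := hγ.snd
  have hxc : Continuous x := _root_.continuous_fst.comp hγ.continuous
  have hyc : Continuous y := _root_.continuous_snd.comp hγ.continuous
  have hlc : Continuous lam := continuous_iff_continuousAt.2 fun t => (hlam t).continuousAt
  set mu : ℝ → ℝ → ℝ := fun t s => lam t + (1 - lam t) * s with hmu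
  have hmut : ∀ t s, HasDerivAt (fun t => mu t s) (lam' t * (1 - s)) t := fun t s =>
    ((hlam t).fun_add (((hlam t).const_sub 1).mul_const s)).congr_deriv (by ring)
  have hmus : ∀ t s, HasDerivAt (fun s => mu t s) (1 - lam t) s := fun t s =>
    (((hasDerivAt_id' s).const_mul (1 - lam t)).const_add (lam t)).congr_deriv (by ring)
  set u : ℝ → ℝ → ℝ := fun t s => mu t s * x t with hu
  set w : ℝ → ℝ → ℝ := fun t s => mu t s * y t with hw
  set ut : ℝ → ℝ → ℝ := fun t s => lam' t * (1 - s) * x t + mu t s * (y t ^ 3 - x t ^ 3) with hut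
  set wt : ℝ → ℝ → ℝ := fun t s => lam' t * (1 - s) * y t + mu t s * (-x t + m * y t ^ 5) with hwt
  have hdut : ∀ t s, HasDerivAt (fun t => u t s) (ut t s) t := fun t s => (hmut t s).fun_mul (hdx t)
  have hdwt : ∀ t s, HasDerivAt (fun t => w t s) (wt t s) t := fun t s => (hmut t s).fun_mul (hdy t)
  have hdus : ∀ t s, HasDerivAt (fun s => u t s) ((1 - lam t) * x t) s := fun t s => (hmus t s).mul_const _
  have hdws : ∀ t s, HasDerivAt (fun s => w t s) ((1 - lam t) * y t) s := fun t s => (hmus t s).mul_const _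
  have hduts : ∀ t s, HasDerivAt (fun s => ut t s)
      (-lam' t * x t + (1 - lam t) * (y t ^ 3 - x t ^ 3)) s := fun t s =>
    (((((hasDerivAt_id' s).const_sub 1).const_mul (lam' t)).mul_const (x t)).fun_add
      ((hmus t s).mul_const _)).congr_deriv (by ring)
  have hdwts : ∀ t s, HasDerivAt (fun s => wt t s)
      (-lam' t * y t + (1 - lam t) * (-x t + m * y t ^ 5)) s := fun t s =>
    (((((hasDerivAt_id' s).const_sub 1).const_mul (lam' t)).mul_const (y t)).fun_add
      ((hmus t s).mul_const _)).congr_deriv (by ring)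
  set B : ℝ → ℝ → ℝ := fun t s => W (u t s) (w t s) ^ (-(3 / 2) : ℝ) with hB
  set Z : ℝ → ℝ → ℝ := fun t s => W (u t s) (w t s) ^ (-(5 / 2) : ℝ) with hZ
  set P : ℝ → ℝ → ℝ := fun t s => w t s ^ 3 - u t s ^ 3 with hP
  set Q : ℝ → ℝ → ℝ := fun t s => -u t s + m * w t s ^ 5 with hQ
  set gt : ℝ → ℝ → ℝ := fun t s =>
    (-lam' t * B t s + (1 - lam t) * (-(3 / 2) * Z t s * (Wx (u t s) (w t s) * ut t s + Wy (u t s) (w t s) * wt t s)))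
      * (P t s * y t - Q t s * x t)
    + (1 - lam t) * B t s * ((3 * w t s ^ 2 * wt t s - 3 * u t s ^ 2 * ut t s) * y t
        + P t s * (-x t + m * y t ^ 5)
      - ((-ut t s + m * (5 * w t s ^ 4 * wt t s)) * x t + Q t s * (y t ^ 3 - x t ^ 3))) with hgt
  set Es : ℝ → ℝ → ℝ := fun t s =>
    (-(3 / 2) * Z t s * (Wx (u t s) (w t s) * ((1 - lam t) * x t) + Wy (u t s) (w t s) * ((1 - lam t) * y t)))
      * (P t s * wt t s - Q t s * ut t s)
    + B t s * ((3 * w t s ^ 2 * ((1 - lam t) * y t) - 3 * u t s ^ 2 * ((1 - lam t) * x t)) * wt t s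
        + P t s * (-lam' t * y t + (1 - lam t) * (-x t + m * y t ^ 5))
      - ((-((1 - lam t) * x t) + m * (5 * w t s ^ 4 * ((1 - lam t) * y t))) * ut t s
        + Q t s * (-lam' t * x t + (1 - lam t) * (y t ^ 3 - x t ^ 3)))) with hEs
  have hWc : Continuous fun z : ℝ × ℝ => W (u z.1 z.2) (w z.1 z.2) :=
    hW.continuous.comp (f := fun z : ℝ × ℝ => (u z.1 z.2, w z.1 z.2)) (by fun_prop)
  have hWxc : Continuous fun z : ℝ × ℝ => Wx (u z.1 z.2) (w z.1 z.2) :=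
    hW.continuous_fst.comp (f := fun z : ℝ × ℝ => (u z.1 z.2, w z.1 z.2)) (by fun_prop)
  have hWyc : Continuous fun z : ℝ × ℝ => Wy (u z.1 z.2) (w z.1 z.2) :=
    hW.continuous_snd.comp (f := fun z : ℝ × ℝ => (u z.1 z.2, w z.1 z.2)) (by fun_prop)
  have hpc : ∀ p : ℝ, ContinuousOn (fun z : ℝ × ℝ => W (u z.1 z.2) (w z.1 z.2) ^ p) (univ ×ˢ Icc 0 1) :=
    fun p => hWc.continuousOn.rpow_const fun z hz => Or.inl (hpos z.1 z.2 hz.2).ne'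
  have hBc : ContinuousOn (fun z : ℝ × ℝ => B z.1 z.2) (univ ×ˢ Icc 0 1) := hpc _
  have hZc : ContinuousOn (fun z : ℝ × ℝ => Z z.1 z.2) (univ ×ˢ Icc 0 1) := hpc _
  have hsec : ∀ {f : ℝ → ℝ → ℝ}, ContinuousOn (fun z : ℝ × ℝ => f z.1 z.2) (univ ×ˢ Icc 0 1) →
      ∀ t, ContinuousOn (f t) (Icc 0 1) := fun hf t =>
    hf.comp (Continuous.prodMk_right t).continuousOn fun s hs => ⟨mem_univ _, hs⟩
  have hPc : Continuous fun z : ℝ × ℝ => P z.1 z.2 := by fun_prop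
  have hQc : Continuous fun z : ℝ × ℝ => Q z.1 z.2 := by fun_prop
  have hgtc : ContinuousOn (fun z : ℝ × ℝ => gt z.1 z.2) (univ ×ˢ Icc 0 1) := by
    have h1 : Continuous fun z : ℝ × ℝ => Wx (u z.1 z.2) (w z.1 z.2) * ut z.1 z.2 + Wy (u z.1 z.2) (w z.1 z.2) * wt z.1 z.2 :=
      (hWxc.mul (by fun_prop)).add (hWyc.mul (by fun_prop))
    have h2 : Continuous fun z : ℝ × ℝ => P z.1 z.2 * y z.1 - Q z.1 z.2 * x z.1 := by fun_prop
    have h3 : Continuous fun z : ℝ × ℝ => (3 * w z.1 z.2 ^ 2 * wt z.1 z.2 - 3 * u z.1 z.2 ^ 2 * ut z.1 z.2) * y z.1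
        + P z.1 z.2 * (-x z.1 + m * y z.1 ^ 5)
      - ((-ut z.1 z.2 + m * (5 * w z.1 z.2 ^ 4 * wt z.1 z.2)) * x z.1 + Q z.1 z.2 * (y z.1 ^ 3 - x z.1 ^ 3)) := by fun_prop
    have h4 : Continuous fun z : ℝ × ℝ => -lam' z.1 := by fun_prop
    have h5 : Continuous fun z : ℝ × ℝ => 1 - lam z.1 := by fun_prop
    exact (((h4.continuousOn.mul hBc).add (h5.continuousOn.mul ((continuousOn_const.mul hZc).mul h1.continuousOn))).mul
      h2.continuousOn).add ((h5.continuousOn.mul hBc).mul h3.continuousOn)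
  have hEsc : ∀ t, ContinuousOn (Es t) (Icc 0 1) := fun t => by
    have hWx' : Continuous fun s => Wx (u t s) (w t s) := hWxc.comp (Continuous.prodMk_right t)
    have hWy' : Continuous fun s => Wy (u t s) (w t s) := hWyc.comp (Continuous.prodMk_right t)
    have h1 : Continuous fun s => Wx (u t s) (w t s) * ((1 - lam t) * x t) + Wy (u t s) (w t s) * ((1 - lam t) * y t) :=
      (hWx'.mul continuous_const).add (hWy'.mul continuous_const)
    have h2 : Continuous fun s => P t s * wt t s - Q t s * ut t s := by fun_prop
    have h3 : Continuous fun s => (3 * w t s ^ 2 * ((1 - lam t) * y t) - 3 * u t s ^ 2 * ((1 - lam t) * x t)) * wt t s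
        + P t s * (-lam' t * y t + (1 - lam t) * (-x t + m * y t ^ 5))
      - ((-((1 - lam t) * x t) + m * (5 * w t s ^ 4 * ((1 - lam t) * y t))) * ut t s
        + Q t s * (-lam' t * x t + (1 - lam t) * (y t ^ 3 - x t ^ 3))) := by fun_prop
    exact (((continuousOn_const.mul (hsec hZc t)).mul h1.continuousOn).mul h2.continuousOn).add
      ((hsec hBc t).mul h3.continuousOn)
  have hg : ∀ t, ∀ s ∈ Icc (0 : ℝ) 1,
      HasDerivAt (fun t => areaDensity m W (lam t) (x t) (y t) s) (gt t s) t := fun t s hs => by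
    have e1 := hW.hasDerivAt_weight (hdut t s) (hdwt t s) (hpos t s hs)
    have eP := ((hdwt t s).fun_pow 3).fun_sub ((hdut t s).fun_pow 3)
    have eQ := (hdut t s).fun_neg.fun_add (((hdwt t s).fun_pow 5).const_mul m)
    refine ((((hlam t).const_sub 1).fun_mul e1).fun_mul
      ((eP.fun_mul (hdy t)).fun_sub (eQ.fun_mul (hdx t)))).congr_deriv ?_
    simp only [hgt, hB, hZ, hP, hQ, Nat.cast_ofNat, Nat.add_one_sub_one]
  have hE : ∀ t, ∀ s ∈ Icc (0 : ℝ) 1,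
      HasDerivAt (fun s => B t s * (P t s * wt t s - Q t s * ut t s)) (Es t s) s := fun t s hs => by
    have e1 := hW.hasDerivAt_weight (hdus t s) (hdws t s) (hpos t s hs)
    have eP := ((hdws t s).fun_pow 3).fun_sub ((hdus t s).fun_pow 3)
    have eQ := (hdus t s).fun_neg.fun_add (((hdws t s).fun_pow 5).const_mul m)
    refine (e1.fun_mul ((eP.fun_mul (hdwts t s)).fun_sub (eQ.fun_mul (hduts t s)))).congr_deriv ?_
    simp only [hEs, hB, hZ, hP, hQ, Nat.cast_ofNat, Nat.add_one_sub_one]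
  have hgc : ∀ t, ContinuousOn (areaDensity m W (lam t) (x t) (y t)) (Icc 0 1) := fun t => by
    have h2 : Continuous fun s => P t s * y t - Q t s * x t := by fun_prop
    exact (continuousOn_const.mul (hsec hBc t)).mul h2.continuousOn
  have hI : ∀ {f : ℝ → ℝ}, ContinuousOn f (Icc 0 1) → IntervalIntegrable f MeasureTheory.volume 0 1 :=
    fun h => ContinuousOn.intervalIntegrable (by rwa [uIcc_of_le zero_le_one])
  refine (hasDerivAt_integral_unit hg hgc hgtc t).congr_deriv ?_
  have hE0 : ∫ s in (0 : ℝ)..1, Es t s = 0 := by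
    rw [intervalIntegral.integral_eq_sub_of_hasDerivAt
      (fun s hs => hE t s (by rwa [uIcc_of_le zero_le_one] at hs)) (hI (hEsc t))]
    have k0 : P t 0 * wt t 0 - Q t 0 * ut t 0 = 0 := by
      have := hpar t
      simp only [hP, hQ, hut, hwt, hu, hw, hmu]
      linear_combination this
    have k1 : P t 1 * wt t 1 - Q t 1 * ut t 1 = 0 := by
      simp only [hP, hQ, hut, hwt, hu, hw, hmu]
      ring
    rw [k0, k1]
    ring
  have key : ∀ s ∈ Icc (0 : ℝ) 1, gt t s = Es t s + 3 / 2 * (1 - lam t) * angular m (x t) (y t) *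
      (Z t s * scaledDiv m W Wx Wy (u t s) (w t s) * mu t s) := fun s hs => by
    have hBZ : B t s = W (u t s) (w t s) * Z t s := rpow_neg_three_halves (hpos t s hs)
    simp only [hgt, hEs, hBZ, hP, hQ, hut, hwt, scaledDiv, angular]
    ring
  have hRc : Continuous fun s => scaledDiv m W Wx Wy (u t s) (w t s) * mu t s := by
    have hWx' : Continuous fun s => Wx (u t s) (w t s) := hWxc.comp (Continuous.prodMk_right t)
    have hWy' : Continuous fun s => Wy (u t s) (w t s) := hWyc.comp (Continuous.prodMk_right t)
    have hW' : Continuous fun s => W (u t s) (w t s) := hWc.comp (Continuous.prodMk_right t)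
    exact (((hWx'.mul (by fun_prop)).add (hWy'.mul (by fun_prop))).sub
      ((continuous_const.mul hW').mul (by fun_prop))).mul (by fun_prop)
  have hRi := (hI ((hsec hZc t).mul hRc.continuousOn)).const_mul (3 / 2 * (1 - lam t) * angular m (x t) (y t))
  simp only [Pi.mul_apply, ← mul_assoc (Z t _)] at hRi
  rw [intervalIntegral.integral_congr (fun s hs => key s (by rwa [uIcc_of_le zero_le_one] at hs)),
    intervalIntegral.integral_add (hI (hEsc t)) hRi, hE0, intervalIntegral.integral_const_mul, zero_add]
  rfl

lemma angular_nonpos {m x y : ℝ} (h1 : 1 / 2 ≤ m) (h2 : m < 3 / 5) (h : InSquare m (x, y)) :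
    angular m x y ≤ 0 := by
  by_cases h0 : x = 0 ∧ y = 0
  · simp [angular, h0.1, h0.2]
  by_cases hs : x = y ∧ m * x ^ 4 = 1
  · obtain ⟨rfl, hs⟩ := hs
    refine le_of_eq ?_
    rw [angular]
    linear_combination x ^ 2 * hs
  · exact (angular_neg h1 h2 h.1 h.2 h0 hs).le

lemma InSquare.segment {m lam x y : ℝ} (hm : 0 < m) (h : InSquare m (x, y)) (hl : InSquare m (lam * x, lam * y))
    (hlam : 0 ≤ lam) {s : ℝ} (hs : s ∈ Icc (0 : ℝ) 1) :
    InSquare m ((lam + (1 - lam) * s) * x, (lam + (1 - lam) * s) * y) := by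
  have hmu : 0 ≤ lam + (1 - lam) * s := by nlinarith [mul_nonneg hlam (sub_nonneg.2 hs.2), hs.1]
  rcases le_total lam 1 with h1 | h1
  · exact InSquare.smul hm (lam := 1) (by simpa using h) hmu
      (by nlinarith [mul_nonneg (sub_nonneg.2 h1) (sub_nonneg.2 hs.2)])
  · exact hl.smul hm hmu (by nlinarith [mul_nonneg (sub_nonneg.2 h1) hs.1])

lemma segment_nonneg {lam s : ℝ} (hlam : 0 ≤ lam) (hs : s ∈ Icc (0 : ℝ) 1) : 0 ≤ lam + (1 - lam) * s := by
  nlinarith [mul_nonneg hlam (sub_nonneg.2 hs.2), hs.1]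

lemma continuous_segment {W : ℝ → ℝ → ℝ} (hW : Continuous fun p : ℝ × ℝ => W p.1 p.2) (lam x y : ℝ) :
    Continuous fun s => W ((lam + (1 - lam) * s) * x) ((lam + (1 - lam) * s) * y) :=
  hW.comp (f := fun s => ((lam + (1 - lam) * s) * x, (lam + (1 - lam) * s) * y)) (by fun_prop)

lemma exists_flux_eq {m lam x y : ℝ} (h1 : 1 / 2 ≤ m) (h2 : m < 3 / 5) {W : ℝ → ℝ → ℝ}
    (hW : Continuous fun p : ℝ × ℝ => W p.1 p.2) (h : InSquare m (x, y)) (hl : InSquare m (lam * x, lam * y))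
    (hlam : 0 ≤ lam) (hang : angular m x y < 0)
    (hpos : ∀ s ∈ Icc (0 : ℝ) 1, 0 < W ((lam + (1 - lam) * s) * x) ((lam + (1 - lam) * s) * y)) :
    ∃ I, 0 < I ∧ flux m W lam x y = (1 - lam) * I := by
  refine ⟨∫ s in (0 : ℝ)..1, W ((lam + (1 - lam) * s) * x) ((lam + (1 - lam) * s) * y) ^ (-(3 / 2) : ℝ)
    * ((((lam + (1 - lam) * s) * y) ^ 3 - ((lam + (1 - lam) * s) * x) ^ 3) * y
      - (-((lam + (1 - lam) * s) * x) + m * ((lam + (1 - lam) * s) * y) ^ 5) * x), ?_, ?_⟩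
  rotate_left
  · rw [← intervalIntegral.integral_const_mul]
    simp only [flux, areaDensity, mul_assoc]
  · refine intervalIntegral.integral_pos one_pos ?_ (fun s hs => ?_) ⟨1, right_mem_Icc.2 zero_le_one, ?_⟩
    · refine ((continuous_segment hW lam x y).continuousOn.rpow_const fun s hs => Or.inl (hpos s hs).ne').mul ?_
      fun_prop
    · have hs' := Ioc_subset_Icc_self hs
      refine mul_nonneg (Real.rpow_nonneg (hpos s hs').le _) ?_
      rcases (segment_nonneg hlam hs').eq_or_lt with h0 | h0
      · simp [← h0]
      · have := angular_nonpos h1 h2 (h.segment (by linarith) hl hlam hs')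
        refine nonneg_of_mul_nonneg_right ?_ h0
        rw [angular] at this
        linarith
    · have := hpos 1 (right_mem_Icc.2 zero_le_one)
      refine mul_pos (Real.rpow_pos_of_pos this _) ?_
      rw [angular] at hang
      simp only [mul_one, add_sub_cancel, one_mul]
      linarith

lemma IsDulac.fluxRate_sign {m lam x y : ℝ} {V Vx Vy W : ℝ → ℝ → ℝ} (hV : IsDulac m V Vx Vy) (hm : 0 < m)
    (hW : Continuous fun p : ℝ × ℝ => W p.1 p.2) (h : InSquare m (x, y)) (hl : InSquare m (lam * x, lam * y))
    (hlam : 0 ≤ lam)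
    (hpos : ∀ s ∈ Icc (0 : ℝ) 1, 0 < W ((lam + (1 - lam) * s) * x) ((lam + (1 - lam) * s) * y)) :
    0 ≤ (∫ s in (0 : ℝ)..1, W ((lam + (1 - lam) * s) * x) ((lam + (1 - lam) * s) * y) ^ (-(5 / 2) : ℝ)
      * scaledDiv m V Vx Vy ((lam + (1 - lam) * s) * x) ((lam + (1 - lam) * s) * y) * (lam + (1 - lam) * s)) ∧
    (y ≠ 0 → 0 < ∫ s in (0 : ℝ)..1, W ((lam + (1 - lam) * s) * x) ((lam + (1 - lam) * s) * y) ^ (-(5 / 2) : ℝ)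
      * scaledDiv m V Vx Vy ((lam + (1 - lam) * s) * x) ((lam + (1 - lam) * s) * y) * (lam + (1 - lam) * s)) := by
  have hnn : ∀ s ∈ Icc (0 : ℝ) 1, 0 ≤ W ((lam + (1 - lam) * s) * x) ((lam + (1 - lam) * s) * y) ^ (-(5 / 2) : ℝ)
      * scaledDiv m V Vx Vy ((lam + (1 - lam) * s) * x) ((lam + (1 - lam) * s) * y) * (lam + (1 - lam) * s) :=
    fun s hs => mul_nonneg (mul_nonneg (Real.rpow_nonneg (hpos s hs).le _)
      (hV.scaledDiv_nonneg (h.segment hm hl hlam hs))) (segment_nonneg hlam hs)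
  refine ⟨intervalIntegral.integral_nonneg zero_le_one hnn, fun hy =>
    intervalIntegral.integral_pos one_pos ?_ (fun s hs => hnn s (Ioc_subset_Icc_self hs))
      ⟨1, right_mem_Icc.2 zero_le_one, ?_⟩⟩
  · have hN : Continuous fun p : ℝ × ℝ => scaledDiv m V Vx Vy p.1 p.2 :=
      ((hV.continuous_fst.mul (by fun_prop)).add (hV.continuous_snd.mul (by fun_prop))).sub
        ((continuous_const.mul hV.continuous).mul (by fun_prop))
    exact (((continuous_segment hW lam x y).continuousOn.rpow_const fun s hs => Or.inl (hpos s hs).ne').mul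
      (continuous_segment hN lam x y).continuousOn).mul (by fun_prop)
  · have := hpos 1 (right_mem_Icc.2 zero_le_one)
    simp only [mul_one, add_sub_cancel, one_mul] at this ⊢
    exact mul_pos (Real.rpow_pos_of_pos this _) (hV.scaledDiv_pos h hy)

lemma IsRotating.sq_add_sq_pos {m : ℝ} {γ : ℝ → ℝ × ℝ} (h : IsRotating m γ) (t : ℝ) :
    0 < (γ t).1 ^ 2 + (γ t).2 ^ 2 := by
  by_contra! h0
  have hx : (γ t).1 = 0 := by nlinarith [sq_nonneg (γ t).1, sq_nonneg (γ t).2]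
  have hy : (γ t).2 = 0 := by nlinarith [sq_nonneg (γ t).1, sq_nonneg (γ t).2]
  have := h.angular_neg t
  simp [angular, hx, hy] at this

lemma IsDulac.neg_on_segment {m : ℝ} {V Vx Vy : ℝ → ℝ → ℝ} (hm : 0 < m) (hV : IsDulac m V Vx Vy)
    {lam x y : ℝ} (hlam : 0 < lam) (h : InSquare m (x, y)) (hl : InSquare m (lam * x, lam * y))
    (hneg : V x y < 0) (hneg' : V (lam * x) (lam * y) < 0) {s : ℝ} (hs : s ∈ Icc (0 : ℝ) 1) :
    V ((lam + (1 - lam) * s) * x) ((lam + (1 - lam) * s) * y) < 0 := by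
  have hsq := h.segment hm hl hlam.le hs
  rcases le_total lam 1 with h1 | h1
  · exact hV.neg_of_neg hm hlam (by nlinarith [mul_nonneg (sub_nonneg.2 h1) hs.1]) hsq hneg'
  · exact hV.neg_of_neg hm one_pos (by nlinarith [mul_nonneg (sub_nonneg.2 h1) (sub_nonneg.2 hs.2)]) hsq
      (by simpa using hneg)

lemma IsRotating.strictMono_flux_sq {m : ℝ} (h1 : 1 / 2 ≤ m) (h2 : m < 3 / 5) {V Vx Vy : ℝ → ℝ → ℝ}
    (hV : IsDulac m V Vx Vy) {γ : ℝ → ℝ × ℝ} (hγ : IsRotating m γ) {lam lam' : ℝ → ℝ}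
    (hlam : ∀ t, HasDerivAt lam (lam' t) t) (hlam' : Continuous lam')
    (hpar : ∀ t, ((lam t * (γ t).2) ^ 3 - (lam t * (γ t).1) ^ 3)
        * (lam' t * (γ t).2 + lam t * (-(γ t).1 + m * (γ t).2 ^ 5))
      = (-(lam t * (γ t).1) + m * (lam t * (γ t).2) ^ 5)
        * (lam' t * (γ t).1 + lam t * ((γ t).2 ^ 3 - (γ t).1 ^ 3)))
    (hl0 : ∀ t, 0 < lam t) (hl1 : ∀ t, lam t ≠ 1)
    (hsq : ∀ t, InSquare m (lam t * (γ t).1, lam t * (γ t).2))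
    (hneg : ∀ t, V (γ t).1 (γ t).2 < 0) (hneg' : ∀ t, V (lam t * (γ t).1) (lam t * (γ t).2) < 0) :
    StrictMono fun t => flux m (fun x y => -V x y) (lam t) (γ t).1 (γ t).2 ^ 2 := by
  have hm : 0 < m := by linarith
  have hpos : ∀ t, ∀ s ∈ Icc (0 : ℝ) 1,
      0 < -V ((lam t + (1 - lam t) * s) * (γ t).1) ((lam t + (1 - lam t) * s) * (γ t).2) := fun t s hs =>
    neg_pos.2 (hV.neg_on_segment hm (hl0 t) (hγ.inSquare t) (hsq t) (hneg t) (hneg' t) hs)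
  have hd := hV.toHasPartials.neg.hasDerivAt_flux hγ.isSolution hlam hlam' hpar hpos
  choose I hI hfI using fun t => exists_flux_eq (W := fun x y => -V x y) h1 h2
    hV.toHasPartials.neg.continuous (hγ.inSquare t) (hsq t)
    (hl0 t).le (hγ.angular_neg t) (hpos t)
  have hJ := fun t => hV.fluxRate_sign (W := fun x y => -V x y) hm
    hV.toHasPartials.neg.continuous (hγ.inSquare t) (hsq t) (hl0 t).le (hpos t)
  have hR : ∀ t, fluxRate m (fun x y => -V x y) (fun x y => -Vx x y) (fun x y => -Vy x y) (lam t) (γ t).1 (γ t).2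
      = -∫ s in (0 : ℝ)..1, (-V ((lam t + (1 - lam t) * s) * (γ t).1) ((lam t + (1 - lam t) * s) * (γ t).2)) ^ (-(5 / 2) : ℝ)
        * scaledDiv m V Vx Vy ((lam t + (1 - lam t) * s) * (γ t).1) ((lam t + (1 - lam t) * s) * (γ t).2)
        * (lam t + (1 - lam t) * s) := fun t => by
    rw [fluxRate, ← intervalIntegral.integral_neg]
    refine intervalIntegral.integral_congr fun s _ => ?_
    simp only [scaledDiv]
    ring
  set J : ℝ → ℝ := fun t => ∫ s in (0 : ℝ)..1, (-V ((lam t + (1 - lam t) * s) * (γ t).1) ((lam t + (1 - lam t) * s) * (γ t).2)) ^ (-(5 / 2) : ℝ)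
        * scaledDiv m V Vx Vy ((lam t + (1 - lam t) * s) * (γ t).1) ((lam t + (1 - lam t) * s) * (γ t).2)
        * (lam t + (1 - lam t) * s) with hJdef
  have hF : ∀ t, HasDerivAt (fun t => flux m (fun x y => -V x y) (lam t) (γ t).1 (γ t).2 ^ 2)
      (3 * (1 - lam t) ^ 2 * I t * (-angular m (γ t).1 (γ t).2) * J t) t := fun t => by
    refine ((hd t).fun_pow 2).congr_deriv ?_
    rw [hR, hfI]
    norm_num
    ring
  have hc : ∀ t, 0 < 3 * (1 - lam t) ^ 2 * I t * (-angular m (γ t).1 (γ t).2) := fun t => by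
    have := sq_pos_of_ne_zero (sub_ne_zero.2 (hl1 t).symm)
    have := hI t
    have := neg_pos.2 (hγ.angular_neg t)
    positivity
  exact hγ.strictMono hF (fun t => mul_nonneg (hc t).le (hJ t).1) fun t ht => mul_pos (hc t) ((hJ t).2 ht)

lemma IsPeriodicOrbit.dulac_neg {m T : ℝ} (h1 : 1 / 2 ≤ m) (h2 : m < 3 / 5) {V Vx Vy : ℝ → ℝ → ℝ}
    (hV : IsDulac m V Vx Vy) {γ : ℝ → ℝ × ℝ} (hp : IsPeriodicOrbit m γ T) (t : ℝ) :
    V (γ t).1 (γ t).2 < 0 := by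
  have hm : 0 < m := by linarith
  have hγ := hp.isRotating h1 h2
  refine (hp.dulac_sign hV hγ).resolve_right (fun hVpos => ?_) t
  have hsq : ∀ t, InSquare m (0 * (γ t).1, 0 * (γ t).2) := fun t => by simp [InSquare]
  have hpos : ∀ t, ∀ s ∈ Icc (0 : ℝ) 1, 0 < V ((0 + (1 - 0) * s) * (γ t).1) ((0 + (1 - 0) * s) * (γ t).2) :=
    fun t s hs => hV.pos_of_pos hm (by simpa using hs.1) (by simpa using hs.2) (hγ.inSquare t) (hVpos t)
  have hd := hV.toHasPartials.hasDerivAt_flux hγ.isSolution (lam := fun _ => 0) (lam' := fun _ => 0)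
    (fun t => hasDerivAt_const t 0) continuous_const (fun t => by simp) hpos
  have hJ := fun t => hV.fluxRate_sign hm hV.continuous (hγ.inSquare t) (hsq t) le_rfl (hpos t)
  have hc : ∀ t, 0 < 3 / 2 * (-angular m (γ t).1 (γ t).2) := fun t => by
    have := neg_pos.2 (hγ.angular_neg t)
    positivity
  have hmono := hγ.strictMono (F := fun t => -flux m V 0 (γ t).1 (γ t).2)
    (F' := fun t => 3 / 2 * (-angular m (γ t).1 (γ t).2) * fluxRate m V Vx Vy 0 (γ t).1 (γ t).2)
    (fun t => (hd t).fun_neg.congr_deriv (by ring)) (fun t => mul_nonneg (hc t).le (hJ t).1)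
    (fun t ht => mul_pos (hc t) ((hJ t).2 ht))
  have := hmono hp.2.2.1
  simp only [hp.2.2.2.eq] at this
  exact lt_irrefl _ this

/-- `ψ` is a clockwise polar angle along `γ`. -/
structure IsLift (m : ℝ) (γ : ℝ → ℝ × ℝ) (ψ : ℝ → ℝ) : Prop where
  hasDerivAt : ∀ t, HasDerivAt ψ (-angular m (γ t).1 (γ t).2 / ((γ t).1 ^ 2 + (γ t).2 ^ 2)) t
  fst : ∀ t, (γ t).1 = √((γ t).1 ^ 2 + (γ t).2 ^ 2) * cos (ψ t)
  snd : ∀ t, (γ t).2 = -(√((γ t).1 ^ 2 + (γ t).2 ^ 2) * sin (ψ t))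

lemma eq_of_hasDerivAt_zero {f : ℝ → ℝ} (h : ∀ t, HasDerivAt f 0 t) (a b : ℝ) : f a = f b :=
  is_const_of_deriv_eq_zero (fun t => (h t).differentiableAt) (fun t => (h t).deriv) a b

lemma IsRotating.exists_lift {m : ℝ} {γ : ℝ → ℝ × ℝ} (h : IsRotating m γ) : ∃ ψ, IsLift m γ ψ := by
  have hc := h.isSolution.continuous
  have hr := h.sq_add_sq_pos
  have hωc : Continuous fun t => -angular m (γ t).1 (γ t).2 / ((γ t).1 ^ 2 + (γ t).2 ^ 2) := by
    refine Continuous.div (by unfold angular; fun_prop) (by fun_prop) fun t => (hr t).ne'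
  obtain ⟨θ, h0c, h0s⟩ : ∃ θ, (γ 0).1 = √((γ 0).1 ^ 2 + (γ 0).2 ^ 2) * cos θ ∧
      (γ 0).2 = -(√((γ 0).1 ^ 2 + (γ 0).2 ^ 2) * sin θ) := by
    have hn : ‖(⟨(γ 0).1, -(γ 0).2⟩ : ℂ)‖ = √((γ 0).1 ^ 2 + (γ 0).2 ^ 2) := by
      rw [Complex.norm_eq_sqrt_sq_add_sq, neg_sq]
    refine ⟨Complex.arg ⟨(γ 0).1, -(γ 0).2⟩, ?_, ?_⟩
    · rw [← hn, Complex.norm_mul_cos_arg]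
    · rw [← hn, Complex.norm_mul_sin_arg, neg_neg]
  have hψ : ∀ t, HasDerivAt (fun t => θ + ∫ s in (0 : ℝ)..t,
      -angular m (γ s).1 (γ s).2 / ((γ s).1 ^ 2 + (γ s).2 ^ 2))
      (-angular m (γ t).1 (γ t).2 / ((γ t).1 ^ 2 + (γ t).2 ^ 2)) t := fun t =>
    (intervalIntegral.integral_hasDerivAt_right (hωc.intervalIntegrable _ _)
      (hωc.stronglyMeasurableAtFilter _ _) hωc.continuousAt).const_add θ
  set ψ : ℝ → ℝ := fun t => θ + ∫ s in (0 : ℝ)..t,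
    -angular m (γ s).1 (γ s).2 / ((γ s).1 ^ 2 + (γ s).2 ^ 2) with hψdef
  have hψ0 : ψ 0 = θ := by simp [hψdef]
  have hr' : ∀ t, √((γ t).1 ^ 2 + (γ t).2 ^ 2) ≠ 0 := fun t => (Real.sqrt_pos.2 (hr t)).ne'
  have hk : ∀ t, HasDerivAt (fun t => ((γ t).1 * cos (ψ t) - (γ t).2 * sin (ψ t)) / √((γ t).1 ^ 2 + (γ t).2 ^ 2)) 0 t := by
    intro t
    have hx := h.isSolution.fst t
    have hy := h.isSolution.snd t
    refine (((hx.fun_mul (hψ t).cos).fun_sub (hy.fun_mul (hψ t).sin)).fun_div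
      (((hx.fun_pow 2).fun_add (hy.fun_pow 2)).sqrt (hr t).ne') (hr' t)).congr_deriv ?_
    set r := √((γ t).1 ^ 2 + (γ t).2 ^ 2) with hrdef
    have hr2 : r ^ 2 = (γ t).1 ^ 2 + (γ t).2 ^ 2 := Real.sq_sqrt (hr t).le
    set x := (γ t).1
    set y := (γ t).2
    obtain ⟨ω, hω⟩ : ∃ ω, ω = -angular m x y / (x ^ 2 + y ^ 2) := ⟨_, rfl⟩
    have hωr : ω * r ^ 2 = y * (y ^ 3 - x ^ 3) - x * (-x + m * y ^ 5) := by
      rw [hω, hr2, div_mul_cancel₀ _ (hr t).ne', angular]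
      ring
    obtain ⟨A, hA⟩ : ∃ A, A = x * (y ^ 3 - x ^ 3) + y * (-x + m * y ^ 5) := ⟨_, rfl⟩
    have hd : ((2 : ℕ) * x ^ (2 - 1) * (y ^ 3 - x ^ 3) + (2 : ℕ) * y ^ (2 - 1) * (-x + m * y ^ 5)) / (2 * r) = A / r := by
      rw [hA, div_eq_div_iff (mul_ne_zero two_ne_zero (hr' t)) (hr' t)]
      norm_num
      ring
    rw [hd, ← hω, div_eq_zero_iff]
    left
    refine mul_right_cancel₀ (hr' t) ?_
    have hAr : A / r * r = A := div_mul_cancel₀ _ (hr' t)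
    linear_combination (-(x * sin (ψ t)) - y * cos (ψ t)) * hωr
      + ((y ^ 3 - x ^ 3) * cos (ψ t) - (-x + m * y ^ 5) * sin (ψ t)) * hr2
      - (x * cos (ψ t) - y * sin (ψ t)) * (hAr + hA)
  have hk1 : ∀ t, (γ t).1 * cos (ψ t) - (γ t).2 * sin (ψ t) = √((γ t).1 ^ 2 + (γ t).2 ^ 2) := by
    intro t
    have := eq_of_hasDerivAt_zero hk t 0
    simp only [hψ0] at this
    rw [div_eq_div_iff (hr' t) (hr' 0)] at this
    have e0 : (γ 0).1 * cos θ - (γ 0).2 * sin θ = √((γ 0).1 ^ 2 + (γ 0).2 ^ 2) := by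
      linear_combination cos θ * h0c - sin θ * h0s
        + √((γ 0).1 ^ 2 + (γ 0).2 ^ 2) * sin_sq_add_cos_sq θ
    rw [e0, mul_comm (√((γ 0).1 ^ 2 + (γ 0).2 ^ 2))] at this
    exact mul_right_cancel₀ (hr' 0) this
  have hz : ∀ t, ((γ t).1 - √((γ t).1 ^ 2 + (γ t).2 ^ 2) * cos (ψ t)) ^ 2
      + ((γ t).2 + √((γ t).1 ^ 2 + (γ t).2 ^ 2) * sin (ψ t)) ^ 2 = 0 := by
    intro t
    have hr2 := Real.sq_sqrt (hr t).le
    linear_combination (-2 * √((γ t).1 ^ 2 + (γ t).2 ^ 2)) * hk1 t - hr2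
      + √((γ t).1 ^ 2 + (γ t).2 ^ 2) ^ 2 * sin_sq_add_cos_sq (ψ t)
  refine ⟨ψ, hψ, fun t => ?_, fun t => ?_⟩
  · have : ((γ t).1 - √((γ t).1 ^ 2 + (γ t).2 ^ 2) * cos (ψ t)) ^ 2 = 0 := by
      nlinarith [hz t, sq_nonneg ((γ t).1 - √((γ t).1 ^ 2 + (γ t).2 ^ 2) * cos (ψ t)),
        sq_nonneg ((γ t).2 + √((γ t).1 ^ 2 + (γ t).2 ^ 2) * sin (ψ t))]
    exact sub_eq_zero.1 (pow_eq_zero_iff two_ne_zero |>.1 this)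
  · have : ((γ t).2 + √((γ t).1 ^ 2 + (γ t).2 ^ 2) * sin (ψ t)) ^ 2 = 0 := by
      nlinarith [hz t, sq_nonneg ((γ t).1 - √((γ t).1 ^ 2 + (γ t).2 ^ 2) * cos (ψ t)),
        sq_nonneg ((γ t).2 + √((γ t).1 ^ 2 + (γ t).2 ^ 2) * sin (ψ t))]
    exact eq_neg_of_add_eq_zero_left (pow_eq_zero_iff two_ne_zero |>.1 this)

lemma IsLift.strictMono {m : ℝ} {γ : ℝ → ℝ × ℝ} {ψ : ℝ → ℝ} (hγ : IsRotating m γ) (h : IsLift m γ ψ) :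
    StrictMono ψ :=
  strictMono_of_hasDerivAt_pos h.hasDerivAt fun t => div_pos (neg_pos.2 (hγ.angular_neg t)) (hγ.sq_add_sq_pos t)

lemma IsLift.continuous {m : ℝ} {γ : ℝ → ℝ × ℝ} {ψ : ℝ → ℝ} (h : IsLift m γ ψ) : Continuous ψ :=
  continuous_iff_continuousAt.2 fun t => (h.hasDerivAt t).continuousAt

lemma IsLift.neg {m : ℝ} {γ : ℝ → ℝ × ℝ} {ψ : ℝ → ℝ} (h : IsLift m γ ψ) :
    IsLift m (fun t => -γ t) (fun t => ψ t + π) where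
  hasDerivAt t := ((h.hasDerivAt t).add_const π).congr_deriv (by
    simp only [Prod.fst_neg, Prod.snd_neg, neg_sq, angular]
    ring_nf)
  fst t := by
    simp only [Prod.fst_neg, Prod.snd_neg, neg_sq, cos_add_pi, mul_neg]
    rw [← h.fst]
  snd t := by
    simp only [Prod.fst_neg, Prod.snd_neg, neg_sq, sin_add_pi, mul_neg]
    rw [← h.snd]

lemma IsLift.add_eq_add {m a b c : ℝ} {γ : ℝ → ℝ × ℝ} {ψ : ℝ → ℝ} (h : IsLift m γ ψ)
    (hab : ∀ t, angular m (γ (t + a)).1 (γ (t + a)).2 / ((γ (t + a)).1 ^ 2 + (γ (t + a)).2 ^ 2)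
      = angular m (γ t).1 (γ t).2 / ((γ t).1 ^ 2 + (γ t).2 ^ 2)) (hb : ψ (b + a) = ψ b + c) (t : ℝ) :
    ψ (t + a) = ψ t + c := by
  have := eq_of_hasDerivAt_zero (f := fun t => ψ (t + a) - ψ t) (fun t =>
    (((h.hasDerivAt (t + a)).comp_add_const t a).fun_sub (h.hasDerivAt t)).congr_deriv (by
      rw [neg_div, neg_div, hab, sub_self])) t b
  linarith

lemma IsLift.exists_int_of_eq {m s t : ℝ} {γ₁ γ₂ : ℝ → ℝ × ℝ} {ψ₁ ψ₂ : ℝ → ℝ} (hγ : IsRotating m γ₂)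
    (h₁ : IsLift m γ₁ ψ₁) (h₂ : IsLift m γ₂ ψ₂)
    (he : γ₁ s = γ₂ t) : ∃ k : ℤ, ψ₁ s = ψ₂ t + 2 * π * k := by
  have hr := (Real.sqrt_pos.2 (hγ.sq_add_sq_pos t)).ne'
  have e1 := h₁.fst s
  have e2 := h₁.snd s
  rw [he] at e1 e2
  have hcos : cos (ψ₁ s) = cos (ψ₂ t) := mul_left_cancel₀ hr (by rw [← e1, ← h₂.fst])
  have hsin : sin (ψ₁ s) = sin (ψ₂ t) := mul_left_cancel₀ hr (neg_injective (by rw [← e2, ← h₂.snd]))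
  obtain ⟨k, hk⟩ := Real.Angle.angle_eq_iff_two_pi_dvd_sub.1 (Real.Angle.cos_sin_inj hcos hsin)
  exact ⟨k, by linarith⟩

lemma IsPeriodicOrbit.exists_lift_add {m T : ℝ} {γ : ℝ → ℝ × ℝ} {ψ : ℝ → ℝ} (hγ : IsRotating m γ)
    (hp : IsPeriodicOrbit m γ T) (h : IsLift m γ ψ) :
    ∃ n : ℕ, 0 < n ∧ ∀ t, ψ (t + T) = ψ t + 2 * π * n := by
  obtain ⟨k, hk⟩ := h.exists_int_of_eq hγ h (hp.2.2.2 0)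
  have h0 : 0 < 2 * π * k := by
    have := h.strictMono hγ (show (0 : ℝ) < 0 + T by linarith [hp.2.2.1])
    linarith
  have hk0 : 0 < k := by exact_mod_cast pos_of_mul_pos_right h0 (by positivity)
  refine ⟨k.toNat, by omega, fun t => h.add_eq_add (fun t => by rw [hp.2.2.2]) (b := 0) ?_ t⟩
  rw [hk]
  have : ((k.toNat : ℤ) : ℝ) = k := by rw [Int.toNat_of_nonneg hk0.le]
  rw [← this, Int.cast_natCast]

lemma apply_add_nat_mul {K T : ℝ} {ψ : ℝ → ℝ} (h : ∀ t, ψ (t + T) = ψ t + K) (n : ℕ) (t : ℝ) :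
    ψ (t + n * T) = ψ t + n * K := by
  induction n with
  | zero => simp
  | succ n ih =>
    have := h (t + n * T)
    push_cast
    rw [show t + (n + 1) * T = t + n * T + T by ring, this, ih]
    ring

lemma surjective_of_add_eq {K T : ℝ} {ψ : ℝ → ℝ} (hc : Continuous ψ) (hm : Monotone ψ) (hK : 0 < K)
    (h : ∀ t, ψ (t + T) = ψ t + K) : Function.Surjective ψ := by
  refine hc.surjective (tendsto_atTop_atTop_of_monotone hm fun b => ?_) (tendsto_atBot_atBot_of_monotone hm fun b => ?_)
  · obtain ⟨n, hn⟩ := exists_nat_gt ((b - ψ 0) / K)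
    refine ⟨0 + n * T, ?_⟩
    rw [apply_add_nat_mul h, ← sub_le_iff_le_add']
    exact ((div_lt_iff₀ hK).1 hn).le
  · obtain ⟨n, hn⟩ := exists_nat_gt ((ψ 0 - b) / K)
    refine ⟨-(n * T), ?_⟩
    have := apply_add_nat_mul h n (-(n * T))
    rw [neg_add_cancel] at this
    have := (div_lt_iff₀ hK).1 hn
    linarith

/-- The factor `r` with `q = r • p`, for proportional vectors. -/
def ratio (p q : ℝ × ℝ) : ℝ := (p.1 * q.1 + p.2 * q.2) / (p.1 ^ 2 + p.2 ^ 2)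

lemma ratio_eq {p q : ℝ × ℝ} {r : ℝ} (hp : 0 < p.1 ^ 2 + p.2 ^ 2) (h₁ : q.1 = r * p.1) (h₂ : q.2 = r * p.2) :
    ratio p q = r := by
  rw [ratio, div_eq_iff hp.ne', h₁, h₂]
  ring

lemma hasDerivAt_orderIso_symm {e : ℝ ≃o ℝ} {e' : ℝ} {θ : ℝ} (h : HasDerivAt e e' (e.symm θ)) (h0 : e' ≠ 0) :
    HasDerivAt e.symm e'⁻¹ θ :=
  HasDerivAt.of_local_left_inverse e.symm.continuous.continuousAt h h0
    (Eventually.of_forall e.apply_symm_apply)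

lemma IsLift.exists_ratio {m : ℝ} {γ₁ γ₂ : ℝ → ℝ × ℝ} {ψ₂ : ℝ → ℝ} {e : ℝ ≃o ℝ}
    (hγ₁ : IsRotating m γ₁) (h₁ : IsLift m γ₁ e) (hγ₂ : IsRotating m γ₂) (h₂ : IsLift m γ₂ ψ₂) (t : ℝ) :
    0 < ratio (γ₂ t) (γ₁ (e.symm (ψ₂ t))) ∧
    (γ₁ (e.symm (ψ₂ t))).1 = ratio (γ₂ t) (γ₁ (e.symm (ψ₂ t))) * (γ₂ t).1 ∧
    (γ₁ (e.symm (ψ₂ t))).2 = ratio (γ₂ t) (γ₁ (e.symm (ψ₂ t))) * (γ₂ t).2 := by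
  have hr₁ := Real.sqrt_pos.2 (hγ₁.sq_add_sq_pos (e.symm (ψ₂ t)))
  have hr₂ := Real.sqrt_pos.2 (hγ₂.sq_add_sq_pos t)
  have a1 := h₁.fst (e.symm (ψ₂ t))
  have a2 := h₁.snd (e.symm (ψ₂ t))
  have b1 := h₂.fst t
  have b2 := h₂.snd t
  rw [e.apply_symm_apply] at a1 a2
  have c1 : (γ₁ (e.symm (ψ₂ t))).1 = √((γ₁ (e.symm (ψ₂ t))).1 ^ 2 + (γ₁ (e.symm (ψ₂ t))).2 ^ 2) /
      √((γ₂ t).1 ^ 2 + (γ₂ t).2 ^ 2) * (γ₂ t).1 := by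
    rw [div_mul_eq_mul_div, eq_div_iff hr₂.ne']
    linear_combination √((γ₂ t).1 ^ 2 + (γ₂ t).2 ^ 2) * a1
      - √((γ₁ (e.symm (ψ₂ t))).1 ^ 2 + (γ₁ (e.symm (ψ₂ t))).2 ^ 2) * b1
  have c2 : (γ₁ (e.symm (ψ₂ t))).2 = √((γ₁ (e.symm (ψ₂ t))).1 ^ 2 + (γ₁ (e.symm (ψ₂ t))).2 ^ 2) /
      √((γ₂ t).1 ^ 2 + (γ₂ t).2 ^ 2) * (γ₂ t).2 := by
    rw [div_mul_eq_mul_div, eq_div_iff hr₂.ne']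
    linear_combination √((γ₂ t).1 ^ 2 + (γ₂ t).2 ^ 2) * a2
      - √((γ₁ (e.symm (ψ₂ t))).1 ^ 2 + (γ₁ (e.symm (ψ₂ t))).2 ^ 2) * b2
  have hr := ratio_eq (hγ₂.sq_add_sq_pos t) c1 c2
  exact ⟨hr ▸ div_pos hr₁ hr₂, hr.symm ▸ c1, hr.symm ▸ c2⟩

lemma IsLift.strictMono_flux_sq {m : ℝ} (h1 : 1 / 2 ≤ m) (h2 : m < 3 / 5) {V Vx Vy : ℝ → ℝ → ℝ}
    (hV : IsDulac m V Vx Vy) {γ₁ γ₂ : ℝ → ℝ × ℝ} {ψ₂ : ℝ → ℝ} {e : ℝ ≃o ℝ}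
    (hγ₁ : IsRotating m γ₁) (h₁ : IsLift m γ₁ e) (hγ₂ : IsRotating m γ₂) (h₂ : IsLift m γ₂ ψ₂)
    (hn₁ : ∀ t, V (γ₁ t).1 (γ₁ t).2 < 0) (hn₂ : ∀ t, V (γ₂ t).1 (γ₂ t).2 < 0)
    (hne : ∀ t, γ₁ (e.symm (ψ₂ t)) ≠ γ₂ t) :
    StrictMono fun t =>
      flux m (fun x y => -V x y) (ratio (γ₂ t) (γ₁ (e.symm (ψ₂ t)))) (γ₂ t).1 (γ₂ t).2 ^ 2 := by
  have hrat := h₁.exists_ratio hγ₁ hγ₂ h₂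
  set τ : ℝ → ℝ := fun t => e.symm (ψ₂ t) with hτ
  set lam : ℝ → ℝ := fun t => ratio (γ₂ t) (γ₁ (τ t)) with hlam
  have hrat' : ∀ t, 0 < lam t ∧ (γ₁ (τ t)).1 = lam t * (γ₂ t).1 ∧ (γ₁ (τ t)).2 = lam t * (γ₂ t).2 := hrat
  set ω₁ : ℝ → ℝ := fun t => -angular m (γ₁ t).1 (γ₁ t).2 / ((γ₁ t).1 ^ 2 + (γ₁ t).2 ^ 2) with hω₁
  set ω₂ : ℝ → ℝ := fun t => -angular m (γ₂ t).1 (γ₂ t).2 / ((γ₂ t).1 ^ 2 + (γ₂ t).2 ^ 2) with hω₂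
  have hω₁0 : ∀ t, ω₁ t ≠ 0 := fun t =>
    (div_pos (neg_pos.2 (hγ₁.angular_neg t)) (hγ₁.sq_add_sq_pos t)).ne'
  have hωc : ∀ {γ : ℝ → ℝ × ℝ}, IsRotating m γ →
      Continuous fun t => -angular m (γ t).1 (γ t).2 / ((γ t).1 ^ 2 + (γ t).2 ^ 2) := fun {γ} h => by
    have := h.isSolution.continuous
    exact Continuous.div (by unfold angular; fun_prop) (by fun_prop) fun t => (h.sq_add_sq_pos t).ne'
  have hω₁c : Continuous ω₁ := hωc hγ₁
  have hω₂c : Continuous ω₂ := hωc hγ₂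
  have hc₁ := hγ₁.isSolution.continuous
  have hc₂ := hγ₂.isSolution.continuous
  have hτc : Continuous τ := e.symm.continuous.comp h₂.continuous
  set τ' : ℝ → ℝ := fun t => (ω₁ (τ t))⁻¹ * ω₂ t with hτ'
  have hτ'c : Continuous τ' := ((hω₁c.comp hτc).inv₀ fun t => hω₁0 _).mul hω₂c
  have hdτ : ∀ t, HasDerivAt τ (τ' t) t := fun t =>
    (hasDerivAt_orderIso_symm (h₁.hasDerivAt _) (hω₁0 _)).comp t (h₂.hasDerivAt t)
  have hd1 : ∀ t, HasDerivAt (fun t => (γ₁ (τ t)).1) (((γ₁ (τ t)).2 ^ 3 - (γ₁ (τ t)).1 ^ 3) * τ' t) t :=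
    fun t => (hγ₁.isSolution.fst (τ t)).comp t (hdτ t)
  have hd2 : ∀ t, HasDerivAt (fun t => (γ₁ (τ t)).2) ((-(γ₁ (τ t)).1 + m * (γ₁ (τ t)).2 ^ 5) * τ' t) t :=
    fun t => (hγ₁.isSolution.snd (τ t)).comp t (hdτ t)
  set lam' : ℝ → ℝ := fun t =>
    ((γ₂ t).1 * (((γ₁ (τ t)).2 ^ 3 - (γ₁ (τ t)).1 ^ 3) * τ' t - lam t * ((γ₂ t).2 ^ 3 - (γ₂ t).1 ^ 3))
      + (γ₂ t).2 * ((-(γ₁ (τ t)).1 + m * (γ₁ (τ t)).2 ^ 5) * τ' t - lam t * (-(γ₂ t).1 + m * (γ₂ t).2 ^ 5)))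
      / ((γ₂ t).1 ^ 2 + (γ₂ t).2 ^ 2) with hlam'
  have hlamc : Continuous lam := by
    refine Continuous.div ?_ ?_ fun t => (hγ₂.sq_add_sq_pos t).ne' <;> fun_prop
  have hlam'c : Continuous lam' := by
    refine Continuous.div ?_ ?_ fun t => (hγ₂.sq_add_sq_pos t).ne' <;> fun_prop
  have hdlam : ∀ t, HasDerivAt lam (lam' t) t := fun t => by
    have hx := hγ₂.isSolution.fst t
    have hy := hγ₂.isSolution.snd t
    have h0 := (hγ₂.sq_add_sq_pos t).ne'
    refine (((hx.fun_mul (hd1 t)).fun_add (hy.fun_mul (hd2 t))).fun_div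
      ((hx.fun_pow 2).fun_add (hy.fun_pow 2)) h0).congr_deriv ?_
    rw [hlam', div_eq_div_iff (pow_ne_zero 2 h0) h0]
    generalize ((γ₁ (τ t)).2 ^ 3 - (γ₁ (τ t)).1 ^ 3) * τ' t = A
    generalize (-(γ₁ (τ t)).1 + m * (γ₁ (τ t)).2 ^ 5) * τ' t = B
    rw [(hrat' t).2.1, (hrat' t).2.2]
    norm_num
    ring
  have hpar1 : ∀ t, ((γ₁ (τ t)).2 ^ 3 - (γ₁ (τ t)).1 ^ 3) * τ' t
      = lam' t * (γ₂ t).1 + lam t * ((γ₂ t).2 ^ 3 - (γ₂ t).1 ^ 3) := fun t =>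
    (hd1 t).unique (((hdlam t).fun_mul (hγ₂.isSolution.fst t)).congr_of_eventuallyEq
      (Eventually.of_forall fun t => (hrat t).2.1))
  have hpar2 : ∀ t, (-(γ₁ (τ t)).1 + m * (γ₁ (τ t)).2 ^ 5) * τ' t
      = lam' t * (γ₂ t).2 + lam t * (-(γ₂ t).1 + m * (γ₂ t).2 ^ 5) := fun t =>
    (hd2 t).unique (((hdlam t).fun_mul (hγ₂.isSolution.snd t)).congr_of_eventuallyEq
      (Eventually.of_forall fun t => (hrat t).2.2))
  have hpt : ∀ t, (lam t * (γ₂ t).1, lam t * (γ₂ t).2) = γ₁ (τ t) := fun t =>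
    (Prod.ext (hrat t).2.1 (hrat t).2.2).symm
  refine hγ₂.strictMono_flux_sq h1 h2 hV hdlam hlam'c (fun t => ?_) (fun t => (hrat t).1) (fun t h => hne t ?_)
    (fun t => ?_) hn₂ fun t => ?_
  · rw [← hpar1 t, ← hpar2 t, ← (hrat' t).2.1, ← (hrat' t).2.2]
    ring
  · have h : lam t = 1 := h
    change γ₁ (τ t) = γ₂ t
    rw [← hpt t, h, one_mul, one_mul]
  · rw [hpt]
    exact hγ₁.inSquare _
  · have := hn₁ (τ t)
    rwa [← hpt t] at this

lemma IsPeriodicOrbit.exists_eq_of_lift {m T₁ T₂ : ℝ} (h1 : 1 / 2 ≤ m) (h2 : m < 3 / 5) {V Vx Vy : ℝ → ℝ → ℝ}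
    (hV : IsDulac m V Vx Vy) {γ₁ γ₂ : ℝ → ℝ × ℝ} {ψ₂ : ℝ → ℝ} {e : ℝ ≃o ℝ}
    (hp₁ : IsPeriodicOrbit m γ₁ T₁) (h₁ : IsLift m γ₁ e) (hp₂ : IsPeriodicOrbit m γ₂ T₂) (h₂ : IsLift m γ₂ ψ₂) :
    ∃ t, γ₁ (e.symm (ψ₂ t)) = γ₂ t := by
  by_contra! hne
  have hγ₁ := hp₁.isRotating h1 h2
  have hγ₂ := hp₂.isRotating h1 h2
  have hmono := h₁.strictMono_flux_sq h1 h2 hV hγ₁ hγ₂ h₂ (hp₁.dulac_neg h1 h2 hV) (hp₂.dulac_neg h1 h2 hV) hne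
  obtain ⟨n₁, hn₁, hT₁⟩ := hp₁.exists_lift_add hγ₁ h₁
  obtain ⟨n₂, hn₂, hT₂⟩ := hp₂.exists_lift_add hγ₂ h₂
  have hτ : e.symm (ψ₂ (0 + n₁ * T₂)) = e.symm (ψ₂ 0) + n₂ * T₁ := by
    rw [OrderIso.symm_apply_eq, apply_add_nat_mul hT₁, apply_add_nat_mul hT₂, e.apply_symm_apply]
    ring
  have hpos : (0 : ℝ) < 0 + n₁ * T₂ := by
    have := hp₂.2.2.1
    positivity
  have hlt := hmono hpos
  have e₁ : γ₁ (e.symm (ψ₂ (0 + n₁ * T₂))) = γ₁ (e.symm (ψ₂ 0)) := by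
    rw [hτ]
    exact hp₁.2.2.2.nat_mul n₂ _
  have e₂ : γ₂ (0 + n₁ * T₂) = γ₂ 0 := hp₂.2.2.2.nat_mul n₁ 0
  simp only [e₁, e₂, lt_irrefl] at hlt

lemma IsPeriodicOrbit.exists_orderIso_lift {m T : ℝ} (h1 : 1 / 2 ≤ m) (h2 : m < 3 / 5) {γ : ℝ → ℝ × ℝ}
    (hp : IsPeriodicOrbit m γ T) : ∃ e : ℝ ≃o ℝ, IsLift m γ e := by
  have hγ := hp.isRotating h1 h2
  obtain ⟨ψ, hψ⟩ := hγ.exists_lift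
  obtain ⟨n, hn, hT⟩ := hp.exists_lift_add hγ hψ
  have hm := hψ.strictMono hγ
  exact ⟨hm.orderIsoOfSurjective ψ (surjective_of_add_eq hψ.continuous hm.monotone (by positivity) hT), hψ⟩

lemma IsRotating.eq_translate {m : ℝ} (h1 : 1 / 2 ≤ m) {γ₁ γ₂ : ℝ → ℝ × ℝ} (hγ₁ : IsRotating m γ₁)
    (hγ₂ : IsRotating m γ₂) {s t : ℝ} (h : γ₁ s = γ₂ t) (r : ℝ) : γ₁ (r + (s - t)) = γ₂ r :=
  congrFun ((hγ₁.isSolution.comp_add_const (s - t)).unique_of_bounded hγ₂.isSolution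
    (fun r => (hγ₁.inSquare _).norm_le h1) (fun r => (hγ₂.inSquare r).norm_le h1) (t₀ := t)
    (by simpa using h)) r

lemma IsPeriodicOrbit.range_eq {m T₁ T₂ : ℝ} (h1 : 1 / 2 ≤ m) (h2 : m < 3 / 5) {V Vx Vy : ℝ → ℝ → ℝ}
    (hV : IsDulac m V Vx Vy) {γ₁ γ₂ : ℝ → ℝ × ℝ} (hp₁ : IsPeriodicOrbit m γ₁ T₁)
    (hp₂ : IsPeriodicOrbit m γ₂ T₂) : range γ₁ = range γ₂ := by
  obtain ⟨e, he⟩ := hp₁.exists_orderIso_lift h1 h2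
  have hγ₁ := hp₁.isRotating h1 h2
  have hγ₂ := hp₂.isRotating h1 h2
  obtain ⟨ψ₂, h₂⟩ := hγ₂.exists_lift
  obtain ⟨t, ht⟩ := hp₁.exists_eq_of_lift h1 h2 hV he hp₂ h₂
  have hγ := hγ₁.eq_translate h1 hγ₂ ht
  refine Subset.antisymm ?_ ?_
  · rintro _ ⟨r, rfl⟩
    exact ⟨r - (e.symm (ψ₂ t) - t), by rw [← hγ, sub_add_cancel]⟩
  · rintro _ ⟨r, rfl⟩
    exact ⟨_, hγ r⟩

lemma IsPeriodicOrbit.neg {m T : ℝ} {γ : ℝ → ℝ × ℝ} (hp : IsPeriodicOrbit m γ T) :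
    IsPeriodicOrbit m (fun t => -γ t) T :=
  ⟨hp.1.neg, fun ⟨c, hc⟩ => hp.2.1 ⟨-c, fun t => neg_eq_iff_eq_neg.1 (hc t)⟩, hp.2.2.1,
    fun t => congrArg Neg.neg (hp.2.2.2 t)⟩

lemma IsPeriodicOrbit.antiperiodic_symm {m T : ℝ} (h1 : 1 / 2 ≤ m) (h2 : m < 3 / 5) {V Vx Vy : ℝ → ℝ → ℝ}
    (hV : IsDulac m V Vx Vy) {γ : ℝ → ℝ × ℝ} {e : ℝ ≃o ℝ} (hp : IsPeriodicOrbit m γ T) (h : IsLift m γ e) :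
    Function.Antiperiodic (fun θ => γ (e.symm θ)) π := by
  have hγ := hp.isRotating h1 h2
  obtain ⟨t, ht⟩ := hp.exists_eq_of_lift h1 h2 hV h hp.neg h.neg
  have htr := hγ.eq_translate h1 hγ.neg ht
  have hadd := h.add_eq_add (a := e.symm (e t + π) - t) (b := t) (c := π)
    (fun r => by
      rw [htr]
      simp only [Prod.fst_neg, Prod.snd_neg, neg_sq, angular]
      ring_nf) (by rw [add_sub_cancel, e.apply_symm_apply])
  intro θ
  have : e.symm (θ + π) = e.symm θ + (e.symm (e t + π) - t) := by
    rw [OrderIso.symm_apply_eq, hadd, e.apply_symm_apply]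
  simp only [this, htr]

lemma continuousAt_flux {m : ℝ} {W : ℝ → ℝ → ℝ} (hW : Continuous fun p : ℝ × ℝ => W p.1 p.2) {z₀ : ℝ × ℝ × ℝ}
    (hpos : ∀ s ∈ Icc (0 : ℝ) 1,
      0 < W ((z₀.1 + (1 - z₀.1) * s) * z₀.2.1) ((z₀.1 + (1 - z₀.1) * s) * z₀.2.2)) :
    ContinuousAt (fun z : ℝ × ℝ × ℝ => flux m W z.1 z.2.1 z.2.2) z₀ := by
  have hcont : ∀ s ∈ Icc (0 : ℝ) 1,
      ContinuousAt (fun w : (ℝ × ℝ × ℝ) × ℝ => areaDensity m W w.1.1 w.1.2.1 w.1.2.2 w.2) (z₀, s) := fun s hs => by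
    have hc : Continuous fun w : (ℝ × ℝ × ℝ) × ℝ =>
        W ((w.1.1 + (1 - w.1.1) * w.2) * w.1.2.1) ((w.1.1 + (1 - w.1.1) * w.2) * w.1.2.2) :=
      hW.comp (f := fun w : (ℝ × ℝ × ℝ) × ℝ =>
        ((w.1.1 + (1 - w.1.1) * w.2) * w.1.2.1, (w.1.1 + (1 - w.1.1) * w.2) * w.1.2.2)) (by fun_prop)
    have hr : ContinuousAt (fun w : (ℝ × ℝ × ℝ) × ℝ =>
        W ((w.1.1 + (1 - w.1.1) * w.2) * w.1.2.1) ((w.1.1 + (1 - w.1.1) * w.2) * w.1.2.2) ^ (-(3 / 2) : ℝ)) (z₀, s) :=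
      hc.continuousAt.rpow_const (Or.inl (hpos s hs).ne')
    unfold areaDensity
    exact (ContinuousAt.mul (by fun_prop) hr).mul (by fun_prop)
  have hcs : ContinuousOn (fun s => areaDensity m W z₀.1 z₀.2.1 z₀.2.2 s) (Icc 0 1) := fun s hs =>
    (ContinuousAt.comp (f := fun s => (z₀, s)) (x := s) (hcont s hs) (by fun_prop)).continuousWithinAt
  have hsub : Set.uIoc (0 : ℝ) 1 ⊆ Icc 0 1 := by rw [uIoc_of_le zero_le_one]; exact Ioc_subset_Icc_self
  obtain ⟨C, hC⟩ := isCompact_Icc.exists_bound_of_continuousOn hcs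
  have hev : ∀ᶠ z in nhds z₀, ∀ s ∈ Icc (0 : ℝ) 1, ‖areaDensity m W z.1 z.2.1 z.2.2 s‖ < C + 1 := by
    refine isCompact_Icc.eventually_forall_of_forall_eventually fun s hs => ?_
    exact (hcont s hs).norm.eventually (gt_mem_nhds ((hC s hs).trans_lt (lt_add_one C)))
  refine intervalIntegral.continuousAt_of_dominated_interval (bound := fun _ => C + 1)
    (Eventually.of_forall fun z => ?_) ?_ intervalIntegrable_const (Eventually.of_forall fun s hs => ?_)
  · refine Measurable.aestronglyMeasurable ?_
    have hm := (continuous_segment hW z.1 z.2.1 z.2.2).measurable.pow_const (-(3 / 2) : ℝ)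
    unfold areaDensity
    exact (measurable_const.mul hm).mul (by fun_prop)
  · filter_upwards [hev] with z hz
    exact Eventually.of_forall fun s hs => (hz s (hsub hs)).le
  · exact ContinuousAt.comp (f := fun z => (z, s)) (x := z₀) (hcont s (hsub hs)) (by fun_prop)

lemma bddAbove_of_cos_ne_zero {ψ : ℝ → ℝ} (hc : Continuous ψ) (hm : Monotone ψ)
    (h : ∀ᶠ t in atTop, cos (ψ t) ≠ 0) : BddAbove (range ψ) := by
  obtain ⟨t₀, ht₀⟩ := eventually_atTop.1 h
  obtain ⟨n, hn⟩ := exists_nat_gt (ψ t₀)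
  have hle : ψ t₀ ≤ (2 * (n : ℤ) + 1) * π / 2 := by
    have := pi_gt_three
    have : (0 : ℝ) ≤ n := n.cast_nonneg
    push_cast
    nlinarith
  refine ⟨(2 * (n : ℤ) + 1) * π / 2, ?_⟩
  rintro _ ⟨t, rfl⟩
  by_contra! hlt
  have htt : t₀ ≤ t := by
    by_contra! h'
    linarith [hm h'.le]
  obtain ⟨s, hs, he⟩ := intermediate_value_Icc htt hc.continuousOn ⟨hle, hlt.le⟩
  exact ht₀ s hs.1 (Real.cos_eq_zero_iff.2 ⟨n, he⟩)

lemma IsLift.tendsto_fst {m L : ℝ} {γ : ℝ → ℝ × ℝ} {ψ : ℝ → ℝ} {p : ℝ × ℝ} {l : Filter ℝ} [l.NeBot]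
    (h : IsLift m γ ψ) (hγ : Tendsto γ l (nhds p)) (hψ : Tendsto ψ l (nhds L)) :
    p.1 = √(p.1 ^ 2 + p.2 ^ 2) * cos L ∧ p.2 = -(√(p.1 ^ 2 + p.2 ^ 2) * sin L) := by
  have h1 := (continuous_fst.tendsto p).comp hγ
  have h2 := (continuous_snd.tendsto p).comp hγ
  have hr : Tendsto (fun t => √((γ t).1 ^ 2 + (γ t).2 ^ 2)) l (nhds √(p.1 ^ 2 + p.2 ^ 2)) :=
    ((h1.pow 2).add (h2.pow 2)).sqrt
  exact ⟨tendsto_nhds_unique h1 ((hr.mul ((continuous_cos.tendsto L).comp hψ)).congr fun t => (h.fst t).symm),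
    tendsto_nhds_unique h2 ((hr.mul ((continuous_sin.tendsto L).comp hψ)).neg.congr fun t => (h.snd t).symm)⟩

lemma IsHeteroclinic.exists_lift_limits {m : ℝ} (hm : 0 < m) {γ : ℝ → ℝ × ℝ} {ψ : ℝ → ℝ}
    (hh : IsHeteroclinic m γ) (hγ : IsRotating m γ) (h : IsLift m γ ψ) :
    ∃ a b, Tendsto ψ atBot (nhds a) ∧ Tendsto ψ atTop (nhds b) ∧ ∃ k : ℤ, b = a + π + k * (2 * π) := by
  obtain ⟨hc, -⟩ := saddle_coord hm
  have hmono := (h.strictMono hγ).monotone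
  have hcos : ∀ t, (γ t).1 ≠ 0 → cos (ψ t) ≠ 0 := fun t h1 h2 => h1 (by rw [h.fst, h2, mul_zero])
  have hba : BddAbove (range ψ) := by
    refine bddAbove_of_cos_ne_zero h.continuous hmono ?_
    exact (((continuous_fst.tendsto _).comp hh.2.2).eventually (isOpen_ne.mem_nhds hc.ne')).mono hcos
  have hbb : BddBelow (range ψ) := by
    have hneg : Tendsto (fun t => (γ (-t)).1) atTop (nhds (pMinus m).1) :=
      (continuous_fst.tendsto _).comp (hh.2.1.comp tendsto_neg_atTop_atBot)
    obtain ⟨B, hB⟩ := bddAbove_of_cos_ne_zero (ψ := fun t => -ψ (-t)) (h.continuous.comp continuous_neg).neg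
      (fun s t hst => neg_le_neg (hmono (neg_le_neg hst)))
      ((hneg.eventually (isOpen_ne.mem_nhds (neg_ne_zero.2 hc.ne'))).mono fun t ht => by
        rw [cos_neg]
        exact hcos _ ht)
    refine ⟨-B, ?_⟩
    rintro _ ⟨t, rfl⟩
    have := hB ⟨-t, rfl⟩
    simp only [neg_neg] at this
    linarith
  have htop := tendsto_atTop_ciSup hmono hba
  have hbot := tendsto_atBot_ciInf hmono hbb
  refine ⟨_, _, hbot, htop, ?_⟩
  obtain ⟨b1, b2⟩ := h.tendsto_fst hh.2.2 htop
  obtain ⟨a1, a2⟩ := h.tendsto_fst hh.2.1 hbot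
  simp only [pMinus, pPlus, neg_sq] at a1 a2 b1 b2
  have hr : √((m ^ (-(1 : ℝ) / 4)) ^ 2 + (m ^ (-(1 : ℝ) / 4)) ^ 2) ≠ 0 := by positivity
  have e1 : cos (⨆ t, ψ t) = cos ((⨅ t, ψ t) + π) := by
    rw [cos_add_pi]
    refine mul_left_cancel₀ hr ?_
    linear_combination -b1 - a1
  have e2 : sin (⨆ t, ψ t) = sin ((⨅ t, ψ t) + π) := by
    rw [sin_add_pi]
    refine mul_left_cancel₀ hr ?_
    linear_combination b2 + a2
  obtain ⟨k, hk⟩ := Real.Angle.angle_eq_iff_two_pi_dvd_sub.1 (Real.Angle.cos_sin_inj e1 e2)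
  exact ⟨k, by linear_combination hk⟩

lemma flux_neg {m lam x y : ℝ} {W : ℝ → ℝ → ℝ} (hW : ∀ x y, W (-x) (-y) = W x y) :
    flux m W lam (-x) (-y) = flux m W lam x y := by
  refine intervalIntegral.integral_congr fun s _ => ?_
  simp only [areaDensity, mul_neg, hW]
  ring

lemma StrictMono.false_of_tendsto {f : ℝ → ℝ} {L : ℝ} (hf : StrictMono f) (hbot : Tendsto f atBot (nhds L))
    (htop : Tendsto f atTop (nhds L)) : False :=
  absurd (hf zero_lt_one) (not_lt.2 ((hf.monotone.ge_of_tendsto htop 1).trans (hf.monotone.le_of_tendsto hbot 0)))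

lemma IsPeriodicOrbit.tendsto_flux {m T θ : ℝ} (h1 : 1 / 2 ≤ m) (h2 : m < 3 / 5) {V Vx Vy : ℝ → ℝ → ℝ}
    (hV : IsDulac m V Vx Vy) {γ₁ γ₂ : ℝ → ℝ × ℝ} {ψ₂ : ℝ → ℝ} {e : ℝ ≃o ℝ} (hp₁ : IsPeriodicOrbit m γ₁ T)
    (h₁ : IsLift m γ₁ e) (hγ₂ : IsRotating m γ₂) (h₂ : IsLift m γ₂ ψ₂) {l : Filter ℝ} [l.NeBot] {p : ℝ × ℝ}
    (hp : V p.1 p.2 < 0) (hpsq : InSquare m p) (hp0 : 0 < p.1 ^ 2 + p.2 ^ 2)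
    (hl : Tendsto γ₂ l (nhds p)) (hψ : Tendsto ψ₂ l (nhds θ)) :
    Tendsto (fun t => flux m (fun x y => -V x y) (ratio (γ₂ t) (γ₁ (e.symm (ψ₂ t)))) (γ₂ t).1 (γ₂ t).2) l
      (nhds (flux m (fun x y => -V x y) (ratio p (γ₁ (e.symm θ))) p.1 p.2)) := by
  have hγ₁ := hp₁.isRotating h1 h2
  have hq : Tendsto (fun t => γ₁ (e.symm (ψ₂ t))) l (nhds (γ₁ (e.symm θ))) :=
    ((hγ₁.isSolution.continuous.comp e.symm.continuous).tendsto θ).comp hψ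
  have hl1 := (continuous_fst.tendsto p).comp hl
  have hl2 := (continuous_snd.tendsto p).comp hl
  have hq1 := (continuous_fst.tendsto _).comp hq
  have hq2 := (continuous_snd.tendsto _).comp hq
  have hrat := h₁.exists_ratio hγ₁ hγ₂ h₂
  have hr : Tendsto (fun t => ratio (γ₂ t) (γ₁ (e.symm (ψ₂ t)))) l (nhds (ratio p (γ₁ (e.symm θ)))) :=
    ((hl1.mul hq1).add (hl2.mul hq2)).div ((hl1.pow 2).add (hl2.pow 2)) hp0.ne'
  have e1 : (γ₁ (e.symm θ)).1 = ratio p (γ₁ (e.symm θ)) * p.1 :=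
    tendsto_nhds_unique hq1 ((hr.mul hl1).congr fun t => ((hrat t).2.1).symm)
  have e2 : (γ₁ (e.symm θ)).2 = ratio p (γ₁ (e.symm θ)) * p.2 :=
    tendsto_nhds_unique hq2 ((hr.mul hl2).congr fun t => ((hrat t).2.2).symm)
  have h0 : 0 ≤ ratio p (γ₁ (e.symm θ)) := ge_of_tendsto' hr fun t => (hrat t).1.le
  have hlam : 0 < ratio p (γ₁ (e.symm θ)) := h0.lt_of_ne fun h => by
    have := hγ₁.sq_add_sq_pos (e.symm θ)
    rw [e1, e2, ← h] at this
    norm_num at this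
  have hsq := hγ₁.inSquare (e.symm θ)
  have hneg := hp₁.dulac_neg h1 h2 hV (e.symm θ)
  rw [e1, e2] at hneg
  have hsq' : InSquare m (ratio p (γ₁ (e.symm θ)) * p.1, ratio p (γ₁ (e.symm θ)) * p.2) := by
    rwa [← e1, ← e2]
  have hflux := continuousAt_flux (m := m) (W := fun x y => -V x y) (z₀ := (ratio p (γ₁ (e.symm θ)), p.1, p.2))
    hV.continuous.neg fun s hs =>
      neg_pos.2 (hV.neg_on_segment (by linarith) hlam hpsq hsq' hp hneg hs)
  have hz : Tendsto (fun t => (ratio (γ₂ t) (γ₁ (e.symm (ψ₂ t))), (γ₂ t).1, (γ₂ t).2)) l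
      (nhds (ratio p (γ₁ (e.symm θ)), p.1, p.2)) := hr.prodMk_nhds (hl1.prodMk_nhds hl2)
  simpa only [Function.comp_def] using
    Tendsto.comp (g := fun z : ℝ × ℝ × ℝ => flux m (fun x y => -V x y) z.1 z.2.1 z.2.2) hflux hz

lemma IsPeriodicOrbit.not_isHeteroclinic {m T : ℝ} (h1 : 1 / 2 ≤ m) (h2 : m < 3 / 5) {V Vx Vy : ℝ → ℝ → ℝ}
    (hV : IsDulac m V Vx Vy) {γ₁ γ₂ : ℝ → ℝ × ℝ} (hp₁ : IsPeriodicOrbit m γ₁ T) : ¬ IsHeteroclinic m γ₂ := by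
  intro hh
  have hm : 0 < m := by linarith
  obtain ⟨hc, hc4⟩ := saddle_coord hm
  have hγ₁ := hp₁.isRotating h1 h2
  have hγ₂ := hh.isRotating h1 h2
  obtain ⟨e, h₁⟩ := hp₁.exists_orderIso_lift h1 h2
  obtain ⟨ψ₂, h₂⟩ := hγ₂.exists_lift
  obtain ⟨a, b, ha, hb, k, hk⟩ := hh.exists_lift_limits hm hγ₂ h₂
  by_cases hne : ∀ t, γ₁ (e.symm (ψ₂ t)) ≠ γ₂ t
  · have hanti := hp₁.antiperiodic_symm h1 h2 hV h₁
    have hab : γ₁ (e.symm b) = -γ₁ (e.symm a) := by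
      rw [hk]
      exact (hanti.periodic_two_mul.int_mul k _).trans (hanti a)
    have hmono := h₁.strictMono_flux_sq h1 h2 hV hγ₁ hγ₂ h₂ (hp₁.dulac_neg h1 h2 hV)
      (fun t => hh.dulac_neg hm hV hγ₂ t) hne
    have hsq : InSquare m (pPlus m) := ⟨hc4.le, hc4.le⟩
    have hsq' : InSquare m (pMinus m) := by
      simp only [InSquare, pMinus]
      constructor <;> · rw [Even.neg_pow (by decide)]; exact hc4.le
    have hVp : V (pPlus m).1 (pPlus m).2 < 0 := hV.saddle_neg hc4
    have hVm : V (pMinus m).1 (pMinus m).2 < 0 := by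
      simp only [pMinus, hV.even]
      exact hV.saddle_neg hc4
    have htop := (hp₁.tendsto_flux h1 h2 hV h₁ hγ₂ h₂ hVp hsq (by simp only [pPlus]; positivity) hh.2.2 hb).pow 2
    have hbot := (hp₁.tendsto_flux h1 h2 hV h₁ hγ₂ h₂ hVm hsq' (by simp only [pMinus, neg_sq]; positivity)
      hh.2.1 ha).pow 2
    refine hmono.false_of_tendsto hbot ?_
    convert htop using 3
    rw [hab, ← neg_pPlus, Prod.fst_neg, Prod.snd_neg, flux_neg fun x y => congrArg Neg.neg (hV.even x y)]
    congr 1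
    simp only [ratio, Prod.fst_neg, Prod.snd_neg]
    ring
  · push Not at hne
    obtain ⟨t, ht⟩ := hne
    have htr := hγ₁.eq_translate h1 hγ₂ ht
    have hper : Function.Periodic γ₂ T := fun r => by
      rw [← htr, ← htr, add_right_comm]
      exact hp₁.2.2.2 _
    refine hh.not_constant hm ⟨pPlus m, fun r => tendsto_nhds_unique ?_
      (hh.2.2.comp (tendsto_atTop_add_const_left atTop r
        (tendsto_natCast_atTop_atTop.atTop_mul_const hp₁.2.2.1)))⟩
    exact tendsto_const_nhds.congr fun n => (hper.nat_mul n r).symm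

theorem bacciotti_uniqueness_hyperbolicity (m : ℝ) (hm₁ : 1 / 2 ≤ m) (hm₂ : m < 3 / 5) :
    (∀ (γ₁ : ℝ → ℝ × ℝ) (T₁ : ℝ) (γ₂ : ℝ → ℝ × ℝ) (T₂ : ℝ),
        IsPeriodicOrbit m γ₁ T₁ → IsPeriodicOrbit m γ₂ T₂ →
        Set.range γ₁ = Set.range γ₂) ∧
    ¬ ((∃ (γ : ℝ → ℝ × ℝ) (T : ℝ), IsPeriodicOrbit m γ T) ∧
        (∃ γ : ℝ → ℝ × ℝ, IsHeteroclinic m γ)) ∧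
    (∀ (γ : ℝ → ℝ × ℝ) (T : ℝ), IsPeriodicOrbit m γ T → IsMinimalPeriod γ T →
        0 < ∫ t in (0:ℝ)..T, divBacciotti m (γ t)) := by
  have hδ : 0 < (3 / 5 - m) ^ (3⁻¹ : ℝ) := Real.rpow_pos_of_pos (sub_pos.2 hm₂) _
  have hm : m = 3 / 5 - ((3 / 5 - m) ^ (3⁻¹ : ℝ)) ^ 3 := by
    rw [← Real.rpow_natCast, ← Real.rpow_mul (sub_nonneg.2 hm₂.le)]
    norm_num
  have hV := isDulac_dulac hm₁ hδ hm
  refine ⟨fun γ₁ T₁ γ₂ T₂ hp₁ hp₂ => hp₁.range_eq hm₁ hm₂ hV hp₂, ?_, fun γ T hp _ => ?_⟩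
  · rintro ⟨⟨γ₁, T, hp⟩, γ₂, hh⟩
    exact hp.not_isHeteroclinic hm₁ hm₂ hV hh
  · exact hp.integral_div_pos hV (hp.isRotating hm₁ hm₂) (hp.dulac_neg hm₁ hm₂ hV)

end
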